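/- arXiv:2106.12781 — 5 statements merged into one kernel-verified Lean document; each statement's English description precedes it below -/
import Mathlib

section
/- For n ≥ 3, the group G = Hol(C_{2^n}) has exactly 2^n one-dimensional complex representations, i.e., the abelianization G/G' has order 2^n. -/
/-- The cyclic group of order `m`, written multiplicatively. -/
abbrev Cyc (m : ℕ) := Multiplicative (ZMod m)

/-- The holomorph `Hol(C_m) = C_m ⋊ Aut(C_m)`. -/
abbrev Hol (m : ℕ) := Cyc m ⋊[MonoidHom.id (MulAut (Cyc m))] MulAut (Cyc m)

/-- An automorphism of `C_m` is multiplication by the image of the generator. -/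
lemma cyc_aut_apply {m : ℕ} (φ : MulAut (Cyc m)) (x : ZMod m) :
    (φ (Multiplicative.ofAdd x)).toAdd = x * (φ (Multiplicative.ofAdd 1)).toAdd := by
  obtain ⟨k, rfl⟩ := ZMod.intCast_surjective x
  have h : (Multiplicative.ofAdd (k : ZMod m)) = (Multiplicative.ofAdd (1 : ZMod m)) ^ k := by
    rw [← ofAdd_zsmul]; simp
  rw [h, map_zpow, toAdd_zpow, zsmul_eq_mul]

lemma cyc_aut_comm {m : ℕ} (φ ψ : MulAut (Cyc m)) : φ * ψ = ψ * φ := by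
  ext x
  have h : ∀ (α β : MulAut (Cyc m)) (y : ZMod m), (α (β (Multiplicative.ofAdd y))).toAdd =
      y * (β (Multiplicative.ofAdd 1)).toAdd * (α (Multiplicative.ofAdd 1)).toAdd := by
    intro α β y
    rw [← cyc_aut_apply β y]
    exact cyc_aut_apply α _
  apply Multiplicative.toAdd.injective
  have h1 := h φ ψ x.toAdd
  have h2 := h ψ φ x.toAdd
  simp only [ofAdd_toAdd] at h1 h2
  rw [MulAut.mul_apply, MulAut.mul_apply, h1, h2]
  exact mul_right_comm (x.toAdd : ZMod m) _ _

/-- An automorphism of `C_m`, with `m` even, acts trivially modulo `2`. -/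
lemma cyc_aut_mod_two {m : ℕ} (hm : 2 ∣ m) (φ : MulAut (Cyc m)) (x : Cyc m) :
    ZMod.castHom hm (ZMod 2) (φ x).toAdd = ZMod.castHom hm (ZMod 2) x.toAdd := by
  have h1 := cyc_aut_apply φ (φ⁻¹ (Multiplicative.ofAdd 1)).toAdd
  rw [ofAdd_toAdd, MulAut.apply_inv_self, toAdd_ofAdd] at h1
  have h2 := congrArg (ZMod.castHom hm (ZMod 2)) h1
  rw [map_one, map_mul] at h2
  have h3 : ∀ a b : ZMod 2, 1 = a * b → b = 1 := by decide
  have h4 := cyc_aut_apply φ x.toAdd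
  rw [ofAdd_toAdd] at h4
  rw [h4, map_mul, h3 _ _ h2, mul_one]

/-- The map `Hol(C_m) → C_2 × Aut(C_m)` for even `m`. -/
def holMap {m : ℕ} (hm : 2 ∣ m) : Hol m →* Multiplicative (ZMod 2) × MulAut (Cyc m) where
  toFun g := (Multiplicative.ofAdd (ZMod.castHom hm (ZMod 2) g.left.toAdd), g.right)
  map_one' := by simp
  map_mul' a b := by
    ext1
    · simp only [SemidirectProduct.mul_left, toAdd_mul, map_add, Prod.mk_mul_mk, ofAdd_add,
        MonoidHom.id_apply, cyc_aut_mod_two]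
    · simp

lemma holMap_surjective {m : ℕ} (hm : 2 ∣ m) : Function.Surjective (holMap hm) := by
  rintro ⟨x, φ⟩
  obtain ⟨y, hy⟩ := ZMod.ringHom_surjective (ZMod.castHom hm (ZMod 2)) x.toAdd
  refine ⟨⟨Multiplicative.ofAdd y, φ⟩, ?_⟩
  change (Multiplicative.ofAdd (ZMod.castHom hm (ZMod 2) y), φ) = _
  rw [hy, ofAdd_toAdd]

lemma holMap_ker {m : ℕ} (hm : 2 ∣ m) : (holMap hm).ker = commutator (Hol m) := by
  apply le_antisymm
  · rintro ⟨x, φ⟩ hg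
    rw [MonoidHom.mem_ker] at hg
    have h1 : ZMod.castHom hm (ZMod 2) x.toAdd = 0 := congrArg (fun p => p.1.toAdd) hg
    have h2 : φ = 1 := congrArg Prod.snd hg
    subst h2
    obtain ⟨k, hk⟩ := ZMod.intCast_surjective x.toAdd
    rw [← hk, map_intCast, ZMod.intCast_zmod_eq_zero_iff_dvd] at h1
    obtain ⟨l, hl⟩ := h1
    have key : ∃ a b : Hol m, (⟨x, 1⟩ : Hol m) = a * b * a⁻¹ * b⁻¹ := by
      refine ⟨SemidirectProduct.inr (MulEquiv.inv (Cyc m)),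
        SemidirectProduct.inl (Multiplicative.ofAdd (-(l : ZMod m))), ?_⟩
      rw [← map_inv SemidirectProduct.inr, ← SemidirectProduct.inl_aut,
        ← map_inv SemidirectProduct.inl, ← map_mul]
      ext1
      · apply Multiplicative.toAdd.injective
        rw [SemidirectProduct.left_inl]
        change x.toAdd = - -(l : ZMod m) + - -(l : ZMod m)
        rw [← hk, hl, neg_neg, ← two_mul]
        push_cast
        rfl
      · rfl
    obtain ⟨a, b, key⟩ := key
    rw [key, ← commutatorElement_def]
    exact Subgroup.commutator_mem_commutator (Subgroup.mem_top _) (Subgroup.mem_top _)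
  · rw [commutator_def, Subgroup.commutator_le]
    intro a _ b _
    rw [MonoidHom.mem_ker, map_commutatorElement, commutatorElement_eq_one_iff_mul_comm]
    exact Prod.ext (mul_comm _ _) (cyc_aut_comm _ _)

/-- For `n ≥ 3`, `Hol(C_{2^n})` has exactly `2^n` one-dimensional complex
representations, i.e. its abelianization has order `2^n`. -/
theorem stmt10 (n : ℕ) (hn : 3 ≤ n) :
    Nat.card (Hol (2 ^ n) →* ℂˣ) = 2 ^ n ∧
    Nat.card (Abelianization (Hol (2 ^ n))) = 2 ^ n := by
  have hm : 2 ∣ 2 ^ n := dvd_pow_self 2 (by omega)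
  have hcard : Nat.card (Abelianization (Hol (2 ^ n))) = 2 ^ n := by
    have e := (QuotientGroup.quotientMulEquivOfEq (holMap_ker hm).symm).trans
      (QuotientGroup.quotientKerEquivOfSurjective _ (holMap_surjective hm))
    have h1 : Nat.card (Abelianization (Hol (2 ^ n))) =
        Nat.card (Multiplicative (ZMod 2) × MulAut (Cyc (2 ^ n))) := Nat.card_congr e.toEquiv
    rw [h1, Nat.card_prod, IsCyclic.card_mulAut, Nat.card_congr Multiplicative.toAdd,
      Nat.card_congr Multiplicative.toAdd, Nat.card_zmod, Nat.card_zmod,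
      Nat.totient_prime_pow Nat.prime_two (by omega)]
    obtain ⟨k, rfl⟩ : ∃ k, n = k + 1 := ⟨n - 1, by omega⟩
    simp [pow_succ, mul_comm]
  refine ⟨?_, hcard⟩
  have : Finite (Abelianization (Hol (2 ^ n))) :=
    Nat.finite_of_card_ne_zero (by rw [hcard]; positivity)
  have : NeZero (Monoid.exponent (Abelianization (Hol (2 ^ n)))) :=
    ⟨Monoid.exponent_ne_zero_of_finite⟩
  have : NeZero ((Monoid.exponent (Abelianization (Hol (2 ^ n))) : ℕ) : ℂ) :=
    NeZero.charZero
  rw [Nat.card_congr (Abelianization.lift (G := Hol (2 ^ n)) (A := ℂˣ)),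
    CommGroup.card_monoidHom_of_hasEnoughRootsOfUnity, hcard]
end

section
/- For p an odd prime and n ≥ 1, the Schur index over ℚ of every irreducible complex character of Hol(C_{p^n}) is equal to 1. -/
open CategoryTheory

theorem irr_of_simple {G : Type} [Group G] (V : FDRep ℂ G) (hV : Simple V)
    (U : Submodule ℂ V) (hU : ∀ g, ∀ u ∈ U, V.ρ g u ∈ U) : U = ⊥ ∨ U = ⊤ := by
  let σ : Representation ℂ G U :=
    { toFun := fun g => (V.ρ g).restrict (hU g)
      map_one' := by ext; simp
      map_mul' := by intro a b; ext; simp }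
  let W : FDRep ℂ G := FDRep.of σ
  let f : W ⟶ V :=
    { hom := FGModuleCat.ofHom U.subtype
      comm := by
        intro g
        rfl }
  have : Mono f := by
    constructor
    intro Z a b hab
    ext x
    exact congrArg (fun t => t.hom.hom.hom x) hab
  by_cases h0 : f = 0
  · left
    rw [eq_bot_iff]
    intro u hu
    have := congrArg (fun t : W ⟶ V => t.hom.hom.hom (⟨u, hu⟩ : U)) h0
    exact this
  · right
    have : IsIso f := isIso_of_mono_of_nonzero h0
    rw [eq_top_iff]
    intro v _
    have h1 := congrArg (fun t : V ⟶ V => t.hom.hom.hom v) (IsIso.inv_hom_id f)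
    have h2 : ((inv f).hom.hom.hom v : U).1 = v := h1
    rw [← h2]; exact ((inv f).hom.hom.hom v : U).2

theorem nontriv_of_simple {G : Type} [Group G] (V : FDRep ℂ G) (hV : Simple V) : Nontrivial V := by
  by_contra h
  rw [not_nontrivial_iff_subsingleton] at h
  apply id_nonzero V
  ext x
  exact Subsingleton.elim (α := V) _ _

theorem realize {G : Type} [Group G] [Finite G] {V : Type} [AddCommGroup V] [Module ℂ V]
    [FiniteDimensional ℂ V] (ρ : Representation ℂ G V)
    (hirr : ∀ U : Submodule ℂ V, (∀ g, ∀ u ∈ U, ρ g u ∈ U) → U = ⊥ ∨ U = ⊤)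
    (K : IntermediateField ℚ ℂ) (v : V) (hv : v ≠ 0) (l : V →ₗ[ℂ] ℂ) (hl : l ≠ 0)
    (hK : ∀ g, l (ρ g v) ∈ K) :
    ∃ W : FDRep K G, ∀ g, (W.character g : ℂ) = LinearMap.trace ℂ V (ρ g) := by
  classical
  let W0 : Submodule K V := Submodule.span K (Set.range fun g => ρ g v)
  have hfd : FiniteDimensional K W0 := FiniteDimensional.span_of_finite K (Set.finite_range _)
  have hW0 : ∀ g, ∀ w ∈ W0, ρ g w ∈ W0 := by
    intro g w hw
    induction hw using Submodule.span_induction with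
    | mem x hx =>
      obtain ⟨h, rfl⟩ := hx
      refine Submodule.subset_span ⟨g * h, ?_⟩
      simp
    | zero => simp
    | add x y _ _ hx hy => rw [map_add]; exact add_mem hx hy
    | smul a x _ hx =>
      rw [IntermediateField.smul_def, map_smul, ← IntermediateField.smul_def]
      exact W0.smul_mem a hx
  have hlW : ∀ w ∈ W0, l w ∈ K := by
    intro w hw
    induction hw using Submodule.span_induction with
    | mem x hx => obtain ⟨h, rfl⟩ := hx; exact hK h
    | zero => simp
    | add x y _ _ hx hy => rw [map_add]; exact add_mem hx hy
    | smul a x _ hx =>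
      rw [IntermediateField.smul_def, map_smul, smul_eq_mul]
      exact mul_mem a.2 hx
  -- separation
  have hsep : ∀ w, (∀ g, l (ρ g w) = 0) → w = 0 := by
    let U : Submodule ℂ V := ⨅ g, LinearMap.ker (l ∘ₗ ρ g)
    have hU : ∀ w, w ∈ U ↔ ∀ g, l (ρ g w) = 0 := by intro w; simp [U]
    rcases hirr U (by
      intro g u hu
      rw [hU] at hu ⊢
      intro h
      have := hu (h * g)
      simpa using this) with h | h
    · intro w hw
      rw [← hU, h] at hw
      simpa using hw
    · exfalso
      apply hl
      ext w
      have : w ∈ U := by rw [h]; trivial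
      rw [hU] at this
      simpa using this 1
  let b := Module.finBasis K W0
  have hli : LinearIndependent ℂ (fun i => (b i : V)) := by
    rw [Fintype.linearIndependent_iff]
    intro c hc i
    rw [← Module.forall_dual_apply_eq_zero_iff K]
    intro θ
    have h0 : ∑ i, θ (c i) • b i = 0 := by
      apply Subtype.ext
      apply hsep
      intro g
      have e1 : ∑ i, c i * l (ρ g (b i)) = 0 := by
        have := congrArg (fun t => l (ρ g t)) hc
        simpa using this
      have e2 : ∀ i, ∃ k : K, (k : ℂ) = l (ρ g (b i)) := fun i =>
        ⟨⟨_, hlW _ (hW0 g _ (b i).2)⟩, rfl⟩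
      choose k hk using e2
      have e3 : ∑ i, k i • c i = 0 := by
        rw [← e1]
        refine Finset.sum_congr rfl fun i _ => ?_
        rw [← hk, IntermediateField.smul_def, smul_eq_mul, mul_comm]
      have e4 := congrArg θ e3
      simp only [map_sum, map_smul, map_zero, smul_eq_mul] at e4
      have e5 := congrArg (fun t : K => (t : ℂ)) e4
      simp only [Submodule.coe_sum, Submodule.coe_smul, map_sum, IntermediateField.smul_def, map_smul,
        smul_eq_mul, ← hk]
      push_cast at e5
      rw [← e5]
      exact Finset.sum_congr rfl fun i _ => mul_comm _ _
    exact Fintype.linearIndependent_iff.1 b.linearIndependent _ h0 i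
  have hsp : ⊤ ≤ Submodule.span ℂ (Set.range fun i => (b i : V)) := by
    have hW : ∀ w ∈ W0, w ∈ Submodule.span ℂ (Set.range fun i => (b i : V)) := by
      intro w hw
      have := b.sum_repr ⟨w, hw⟩
      have := congrArg (fun t : W0 => (t : V)) this
      simp only [Submodule.coe_sum, Submodule.coe_smul] at this
      rw [← this]
      refine Submodule.sum_mem _ fun i _ => ?_
      rw [IntermediateField.smul_def]
      exact Submodule.smul_mem _ _ (Submodule.subset_span ⟨i, rfl⟩)
    rcases hirr (Submodule.span ℂ (Set.range fun i => (b i : V))) (by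
      intro g u hu
      induction hu using Submodule.span_induction with
      | mem x hx => obtain ⟨i, rfl⟩ := hx; exact hW _ (hW0 g _ (b i).2)
      | zero => simp
      | add x y _ _ hx hy => rw [map_add]; exact add_mem hx hy
      | smul a x _ hx => rw [map_smul]; exact Submodule.smul_mem _ a hx) with h | h
    · exfalso
      apply hv
      have := hW v (Submodule.subset_span ⟨1, by simp⟩)
      rw [h] at this
      simpa using this
    · exact h.ge
  let B := Module.Basis.mk hli hsp
  let σ : Representation K G W0 :=
    { toFun := fun g =>
        { toFun := fun w => ⟨ρ g w, hW0 g w w.2⟩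
          map_add' := by intro x y; ext; simp
          map_smul' := by
            intro a x
            ext
            simp [IntermediateField.smul_def] }
      map_one' := by ext; simp
      map_mul' := by intro a b; ext; simp }
  refine ⟨FDRep.of σ, fun g => ?_⟩
  have h1 : (FDRep.of σ).character g = LinearMap.trace K W0 (σ g) := rfl
  rw [h1, LinearMap.trace_eq_matrix_trace K b, LinearMap.trace_eq_matrix_trace ℂ B]
  simp only [Matrix.trace, Matrix.diag]
  push_cast
  refine Finset.sum_congr rfl fun i _ => ?_
  rw [LinearMap.toMatrix_apply, LinearMap.toMatrix_apply]
  have h2 : ρ g (B i) = ∑ j, ((b.repr (σ g (b i)) j : K) : ℂ) • B j := by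
    have := congrArg (fun t : W0 => (t : V)) (b.sum_repr (σ g (b i)))
    simp only [Submodule.coe_sum, Submodule.coe_smul] at this
    have hB : ∀ i, B i = (b i : V) := fun i => by simp [B]
    simp only [hB]
    exact this.symm
  rw [h2, Module.Basis.repr_sum_self]

/-- Rank one version. -/
theorem realize' {G : Type} [Group G] [Finite G] {V : Type} [AddCommGroup V] [Module ℂ V]
    [FiniteDimensional ℂ V] (ρ : Representation ℂ G V)
    (hirr : ∀ U : Submodule ℂ V, (∀ g, ∀ u ∈ U, ρ g u ∈ U) → U = ⊥ ∨ U = ⊤)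
    (K : IntermediateField ℚ ℂ) (hK : ∀ g, LinearMap.trace ℂ V (ρ g) ∈ K)
    (e : V →ₗ[ℂ] V) (he : e ∈ Submodule.span K (Set.range fun g => ρ g))
    (he0 : e ≠ 0) (v : V) (hev : ∀ w, ∃ c : ℂ, e w = c • v) :
    ∃ W : FDRep K G, ∀ g, (W.character g : ℂ) = LinearMap.trace ℂ V (ρ g) := by
  have hv : v ≠ 0 := by
    rintro rfl
    apply he0
    ext w
    obtain ⟨c, hc⟩ := hev w
    simpa using hc
  choose c hc using hev
  let l : V →ₗ[ℂ] ℂ :=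
    { toFun := c
      map_add' := by
        intro x y
        apply smul_left_injective ℂ hv
        simp only [add_smul, ← hc, map_add]
      map_smul' := by
        intro a x
        apply smul_left_injective ℂ hv
        simp only [smul_assoc, ← hc, map_smul, RingHom.id_apply] }
  have hl : ∀ w, e w = l w • v := hc
  refine realize ρ hirr K v hv l ?_ ?_
  · intro h
    apply he0
    ext w
    rw [hl, h]; simp
  · intro g
    have h1 : LinearMap.trace ℂ V (e ∘ₗ ρ g) = l (ρ g v) := by
      have : e ∘ₗ ρ g = (l ∘ₗ ρ g).smulRight v := by
        ext w; simp [hl]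
      rw [this, LinearMap.trace_smulRight]; rfl
    rw [← h1]
    clear h1
    clear hl l hc c he0
    induction he using Submodule.span_induction with
    | mem x hx =>
      obtain ⟨h, rfl⟩ := hx
      have := hK (h * g)
      rw [map_mul] at this
      exact this
    | zero => simp
    | add x y _ _ hx hy => rw [LinearMap.add_comp, map_add]; exact add_mem hx hy
    | smul a x _ hx =>
      rw [IntermediateField.smul_def, LinearMap.smul_comp, map_smul]
      exact mul_mem a.2 hx

theorem nt_lemma (p : ℕ) (hp : p.Prime) (hodd : Odd p) (j k b M : ℕ) (hj : 1 ≤ j) (hjk : j < k)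
    (h1 : (p : ℤ) ^ j ∣ (b : ℤ) - 1) (h2 : ¬ (p : ℤ) ^ (j + 1) ∣ (b : ℤ) - 1)
    (hM : ∀ i : ℕ, ((p : ℤ) ^ k ∣ (b : ℤ) ^ i - 1) ↔ M ∣ i) :
    ∃ N : ℕ, ¬ p ∣ N ∧ ∑ i ∈ Finset.range M, b ^ i = p ^ (k - j) * N := by
  have hpi : Prime (p : ℤ) := Nat.prime_iff_prime_int.1 hp
  have hpb : (p : ℤ) ∣ (b : ℤ) - 1 := (dvd_pow_self _ (by omega)).trans h1
  have hpb' : ¬ (p : ℤ) ∣ (b : ℤ) := by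
    intro h
    have := dvd_sub h hpb
    simp only [sub_sub_cancel] at this
    exact hpi.not_dvd_one this
  have hv : emultiplicity (p : ℤ) ((b : ℤ) - 1) = j := by
    rw [emultiplicity_eq_coe]; exact ⟨h1, h2⟩
  have lte : ∀ i : ℕ, emultiplicity (p : ℤ) ((b : ℤ) ^ i - 1) = j + emultiplicity p i := by
    intro i
    have := Int.emultiplicity_pow_sub_pow hp hodd (x := b) (y := 1) hpb hpb' i
    rw [one_pow, hv] at this
    exact this
  have hMe : M = p ^ (k - j) := by
    have key : ∀ i : ℕ, p ^ (k - j) ∣ i ↔ M ∣ i := by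
      intro i
      rw [← hM, pow_dvd_iff_le_emultiplicity, pow_dvd_iff_le_emultiplicity, lte]
      have : (k : ℕ∞) = (j : ℕ∞) + ((k - j : ℕ) : ℕ∞) := by
        rw [← Nat.cast_add]; congr 1; omega
      rw [this, ENat.add_le_add_iff_left (ENat.natCast_ne_top j)]
    exact Nat.dvd_antisymm ((key _).1 dvd_rfl) ((key _).2 dvd_rfl)
  have hg : ((∑ i ∈ Finset.range M, b ^ i : ℕ) : ℤ) * ((b : ℤ) - 1) = (b : ℤ) ^ M - 1 := by
    push_cast; exact geom_sum_mul _ _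
  have hN : emultiplicity p (∑ i ∈ Finset.range M, b ^ i) = (k - j : ℕ) := by
    have := congrArg (emultiplicity (p : ℤ)) hg
    rw [emultiplicity_mul hpi, hv, lte, hMe, Int.natCast_emultiplicity,
      hp.emultiplicity_pow_self, add_comm] at this
    rw [hMe]
    exact ENat.add_right_injective_of_ne_top (ENat.natCast_ne_top j) this
  rw [emultiplicity_eq_coe] at hN
  obtain ⟨⟨N, hN1⟩, hN2⟩ := hN
  refine ⟨N, ?_, hN1⟩
  rintro ⟨t, rfl⟩
  apply hN2
  rw [hN1, pow_succ]
  exact ⟨t, by ring⟩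

section core
variable {m : ℕ} {V : Type} [AddCommGroup V] [Module ℂ V]

/-- stabilizer of the character `x ↦ ψ (c x)` -/
def Bst (ψ : AddChar (ZMod m) ℂ) (c : ZMod m) : Subgroup (ZMod m)ˣ where
  carrier := {a | ∀ x, ψ (c * (a * x)) = ψ (c * x)}
  one_mem' := by intro x; simp
  mul_mem' := by
    intro a b ha hb x
    rw [Units.val_mul, mul_assoc, ha, hb]
  inv_mem' := by
    intro a ha x
    rw [← ha]; simp

theorem mem_Bst {ψ : AddChar (ZMod m) ℂ} {c : ZMod m} {a : (ZMod m)ˣ} :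
    a ∈ Bst ψ c ↔ ∀ x, ψ (c * (a * x)) = ψ (c * x) := Iff.rfl

variable [NeZero m]

/-- averaging operator -/
noncomputable def Pav (X : ZMod m → Module.End ℂ V) (ψ : AddChar (ZMod m) ℂ) (c : ZMod m) :
    Module.End ℂ V := ∑ x, (ψ (c * x))⁻¹ • X (c * x)

theorem Pav_apply (X : ZMod m → Module.End ℂ V) (A : (ZMod m)ˣ →* Module.End ℂ V)
    (ψ : AddChar (ZMod m) ℂ) (v₀ : V)
    (hXA : ∀ a x, X x (A a v₀) = ψ ((a⁻¹ : (ZMod m)ˣ) * x) • A a v₀) (c : ZMod m) (a : (ZMod m)ˣ) :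
    (a ∈ Bst ψ c → Pav X ψ c (A a v₀) = (m : ℂ) • A a v₀) ∧
    (a ∉ Bst ψ c → Pav X ψ c (A a v₀) = 0) := by
  have hs : Pav X ψ c (A a v₀) =
      (∑ x, ψ.mulShift ((a⁻¹ : (ZMod m)ˣ) * c - c) x) • A a v₀ := by
    simp only [Pav, LinearMap.sum_apply, LinearMap.smul_apply, hXA, Finset.sum_smul, smul_smul]
    refine Finset.sum_congr rfl fun x _ => ?_
    congr 1
    rw [AddChar.mulShift_apply, sub_mul, AddChar.map_sub_eq_div, mul_assoc, div_eq_inv_mul]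
  have hone : ψ.mulShift ((a⁻¹ : (ZMod m)ˣ) * c - c) = 1 ↔ a ∈ Bst ψ c := by
    rw [← inv_mem_iff, mem_Bst, DFunLike.ext_iff]
    refine forall_congr' fun x => ?_
    have h0 : ψ (c * x) ≠ 0 := (ψ.val_isUnit _).ne_zero
    rw [AddChar.mulShift_apply, sub_mul, AddChar.map_sub_eq_div, AddChar.one_apply,
      div_eq_one_iff_eq h0]
    rw [show ((a⁻¹ : (ZMod m)ˣ) : ZMod m) * c * x = c * (((a⁻¹ : (ZMod m)ˣ) : ZMod m) * x) by ring]
  constructor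
  · intro h
    rw [hs, hone.2 h]
    simp
  · intro h
    rw [hs, AddChar.sum_eq_zero_of_ne_one (fun h' => h (hone.1 h')), zero_smul]

theorem final_lemma (K : IntermediateField ℚ ℂ) (R : Subalgebra K (Module.End ℂ V))
    (X : ZMod m → Module.End ℂ V) (A : (ZMod m)ˣ →* Module.End ℂ V)
    (hXR : ∀ x, X x ∈ R) (hAR : ∀ a, A a ∈ R)
    (ψ : AddChar (ZMod m) ℂ) (v₀ : V) (hv₀ : v₀ ≠ 0)
    (hXA : ∀ a x, X x (A a v₀) = ψ ((a⁻¹ : (ZMod m)ˣ) * x) • A a v₀)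
    (hspan : Submodule.span ℂ (Set.range fun a => A a v₀) = ⊤)
    (c : ZMod m) (hc : ∀ x, ψ (c * x) ∈ K)
    (β : (ZMod m)ˣ) (hβ : ∀ a ∈ Bst ψ c, ∃ i : ℕ, β ^ i = a)
    (κ : ℂ) (hκ : κ ∈ K) (hκ0 : κ ≠ 0) (c₀ : ZMod m)
    (hg : ((κ • (X c₀ * A β)) ^ (orderOf (β : (ZMod m)ˣ ⧸ Bst ψ 1))) v₀ = v₀) :
    ∃ e ∈ R, e ≠ 0 ∧ ∃ v, ∀ w, ∃ t : ℂ, e w = t • v := by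
  set M := orderOf (β : (ZMod m)ˣ ⧸ Bst ψ 1) with hM
  set g := κ • (X c₀ * A β) with hgdef
  have hsmulR : ∀ t ∈ K, ∀ f ∈ R, t • f ∈ R := fun t ht f hf => R.smul_mem hf (⟨t, ht⟩ : K)
  have hgR : g ∈ R := hsmulR _ hκ _ (mul_mem (hXR _) (hAR _))
  have hPR : Pav X ψ c ∈ R := sum_mem fun x _ => hsmulR _ (inv_mem (hc x)) _ (hXR _)
  have hMpos : 0 < M := orderOf_pos (β : (ZMod m)ˣ ⧸ Bst ψ 1)
  have hm0 : (m : ℂ) ≠ 0 := Nat.cast_ne_zero.2 (NeZero.ne m)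
  have hgi : ∀ i : ℕ, ∃ t : ℂ, t ≠ 0 ∧ (g ^ i) v₀ = t • A (β ^ i) v₀ := by
    intro i
    induction i with
    | zero => exact ⟨1, one_ne_zero, by simp⟩
    | succ i ih =>
      obtain ⟨t, ht, h⟩ := ih
      refine ⟨t * κ * ψ (((β ^ (i + 1))⁻¹ : (ZMod m)ˣ) * c₀),
        mul_ne_zero (mul_ne_zero ht hκ0) (ψ.val_isUnit _).ne_zero, ?_⟩
      rw [pow_succ', Module.End.mul_apply, h, map_smul, hgdef, LinearMap.smul_apply,
        Module.End.mul_apply, ← Module.End.mul_apply (A β), ← map_mul, ← pow_succ', hXA]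
      simp only [smul_smul]
      congr 1; ring
  set E := ∑ i ∈ Finset.range M, g ^ i with hE
  set v := E v₀ with hv
  have hgv : g v = v := by
    have h1 : (g - 1) * E = g ^ M - 1 := mul_geom_sum g M
    have h2 := congrArg (fun f => f v₀) h1
    simp only [Module.End.mul_apply, LinearMap.sub_apply, hg, Module.End.one_apply, sub_self] at h2
    exact sub_eq_zero.1 h2
  have hgiv : ∀ i : ℕ, (g ^ i) v = v := by
    intro i
    induction i with
    | zero => simp
    | succ i ih => rw [pow_succ, Module.End.mul_apply, hgv, ih]
  have hone : (1 : (ZMod m)ˣ) ∈ Bst ψ c := one_mem _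
  have hAv : A 1 v₀ = v₀ := by simp
  have hv0 : v ≠ 0 := by
    intro h
    have h1 : Pav X ψ 1 v = (m : ℂ) • v₀ := by
      rw [hv, hE, LinearMap.sum_apply, map_sum, Finset.sum_eq_single 0]
      · have := (Pav_apply X A ψ v₀ hXA 1 1).1 (one_mem _)
        rw [hAv] at this
        simpa using this
      · intro i hi hi0
        obtain ⟨t, _, h⟩ := hgi i
        rw [h, map_smul, (Pav_apply X A ψ v₀ hXA 1 (β ^ i)).2, smul_zero]
        intro hb
        rw [← QuotientGroup.eq_one_iff, QuotientGroup.mk_pow, ← orderOf_dvd_iff_pow_eq_one] at hb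
        have := Nat.le_of_dvd (Nat.pos_of_ne_zero hi0) hb
        have := Finset.mem_range.1 hi
        omega
      · intro h; exact absurd (Finset.mem_range.2 hMpos) h
    rw [h, map_zero] at h1
    exact smul_ne_zero hm0 hv₀ h1.symm
  refine ⟨E * Pav X ψ c, mul_mem (sum_mem fun i _ => pow_mem hgR i) hPR, ?_, v, ?_⟩
  · intro h
    have h1 := congrArg (fun f => f v₀) h
    have h2 := (Pav_apply X A ψ v₀ hXA c 1).1 hone
    rw [hAv] at h2
    simp only [Module.End.mul_apply, h2, map_smul, LinearMap.zero_apply] at h1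
    exact smul_ne_zero hm0 hv0 h1
  · intro w
    have hw : w ∈ Submodule.span ℂ (Set.range fun a => A a v₀) := by rw [hspan]; trivial
    induction hw using Submodule.span_induction with
    | mem x hx =>
      obtain ⟨a, rfl⟩ := hx
      by_cases ha : a ∈ Bst ψ c
      · obtain ⟨i, rfl⟩ := hβ a ha
        obtain ⟨t, ht, h⟩ := hgi i
        refine ⟨m * t⁻¹, ?_⟩
        rw [Module.End.mul_apply, (Pav_apply X A ψ v₀ hXA c _).1 ha, map_smul, mul_smul]
        congr 1
        rw [eq_inv_smul_iff₀ ht, ← map_smul, ← h, ← Module.End.mul_apply]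
        have : Commute E (g ^ i) := Commute.sum_left _ _ _ fun r _ => Commute.pow_pow_self g r i
        rw [this.eq, Module.End.mul_apply, hgiv]
      · refine ⟨0, ?_⟩
        rw [Module.End.mul_apply, (Pav_apply X A ψ v₀ hXA c _).2 ha]; simp
    | zero => exact ⟨0, by simp⟩
    | add x y _ _ hx hy =>
      obtain ⟨s, hs⟩ := hx
      obtain ⟨t, ht⟩ := hy
      exact ⟨s + t, by rw [map_add, hs, ht, add_smul]⟩
    | smul a x _ hx =>
      obtain ⟨s, hs⟩ := hx
      exact ⟨a * s, by rw [map_smul, hs, mul_smul]⟩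
end core

theorem core_thm (p n : ℕ) (hp : p.Prime) (hodd : Odd p) [NeZero (p ^ n)]
    {V : Type} [AddCommGroup V] [Module ℂ V] [FiniteDimensional ℂ V] [Nontrivial V]
    (K : IntermediateField ℚ ℂ) (R : Subalgebra K (Module.End ℂ V))
    (X : ZMod (p ^ n) → Module.End ℂ V) (A : (ZMod (p ^ n))ˣ →* Module.End ℂ V)
    (hXR : ∀ x, X x ∈ R) (hAR : ∀ a, A a ∈ R)
    (hX0 : X 0 = 1) (hXadd : ∀ x y, X (x + y) = X x * X y)
    (hrel : ∀ a x, A a * X x = X (a * x) * A a)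
    (hirr : ∀ U : Submodule ℂ V, (∀ x, ∀ u ∈ U, X x u ∈ U) → (∀ a, ∀ u ∈ U, A a u ∈ U) →
      U = ⊥ ∨ U = ⊤)
    (hK : ∀ a, LinearMap.trace ℂ V (A a) ∈ K) :
    ∃ e ∈ R, e ≠ 0 ∧ ∃ v, ∀ w, ∃ t : ℂ, e w = t • v := by
  have hXnat : ∀ i : ℕ, X (i : ZMod (p ^ n)) = X 1 ^ i := by
    intro i
    induction i with
    | zero => simp [hX0]
    | succ i ih => rw [Nat.cast_succ, hXadd, ih, pow_succ]
  have hcast : ∀ x : ZMod (p ^ n), ((x.val : ℕ) : ZMod (p ^ n)) = x := ZMod.natCast_zmod_val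
  -- eigenvalue of `X 1`
  obtain ⟨ζ, hζ⟩ := Module.End.exists_eigenvalue (X 1)
  have hpow : ∀ (w : V) (z : ℂ) (f : Module.End ℂ V), f w = z • w → ∀ i : ℕ, (f ^ i) w = z ^ i • w := by
    intro w z f h i
    induction i with
    | zero => simp
    | succ i ih => rw [pow_succ, Module.End.mul_apply, h, map_smul, ih, smul_smul, pow_succ']
  have hζ1 : ζ ^ (p ^ n) = 1 := by
    obtain ⟨w, hw⟩ := hζ.exists_hasEigenvector
    have h1 := hpow w ζ (X 1) hw.apply_eq_smul (p ^ n)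
    rw [← hXnat, ZMod.natCast_self, hX0, Module.End.one_apply] at h1
    have h2 : (1 : ℂ) • w = ζ ^ (p ^ n) • w := by rw [one_smul]; exact h1
    exact (smul_left_injective ℂ hw.2 h2).symm
  set ψ : AddChar (ZMod (p ^ n)) ℂ := AddChar.zmodChar (p ^ n) hζ1 with hψ
  have hψn : ∀ i : ℕ, ψ (i : ZMod (p ^ n)) = ζ ^ i := fun i => AddChar.zmodChar_apply' hζ1 i
  have hψ1 : ψ 1 = ζ := by simpa using hψn 1
  have hXψ : ∀ w, X 1 w = ζ • w → ∀ x, X x w = ψ x • w := by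
    intro w hw x
    rw [← hcast x, hXnat, hpow w ζ _ hw, hψn]
  -- generator of `S`
  have hp2 : p ≠ 2 := by rintro rfl; exact absurd hodd (by decide)
  have hcyc : IsCyclic (ZMod (p ^ n))ˣ := ZMod.isCyclic_units_of_prime_pow p hp hp2 n
  have hgen : ∀ c, ∃ β ∈ Bst ψ c, ∀ a ∈ Bst ψ c, ∃ i : ℕ, β ^ i = a := by
    intro c
    obtain ⟨β, hβ⟩ := IsCyclic.exists_generator (α := Bst ψ c)
    refine ⟨β, β.2, fun a ha => ?_⟩
    have := hβ ⟨a, ha⟩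
    rw [← mem_powers_iff_mem_zpowers] at this
    obtain ⟨i, hi⟩ := this
    exact ⟨i, congrArg Subtype.val hi⟩
  obtain ⟨s₀, hs₀, hs₀gen⟩ := hgen 1
  obtain ⟨v₀, ω, hv₀, hXv₀, hAv₀⟩ : ∃ v₀ : V, ∃ ω : ℂ, v₀ ≠ 0 ∧ X 1 v₀ = ζ • v₀ ∧ A s₀ v₀ = ω • v₀ := by
    let E := Module.End.eigenspace (X 1) ζ
    have hE : ∀ w, w ∈ E ↔ X 1 w = ζ • w := fun w => Module.End.mem_eigenspace_iff
    have hinv : ∀ w ∈ E, A s₀ w ∈ E := by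
      intro w hw
      rw [hE] at hw ⊢
      have h1 : X 1 * A s₀ = A s₀ * X ((s₀⁻¹ : (ZMod (p ^ n))ˣ) : ZMod (p ^ n)) := by
        rw [hrel]; simp
      rw [← Module.End.mul_apply, h1, Module.End.mul_apply, hXψ w hw, map_smul]
      congr 1
      have := mem_Bst.1 (inv_mem hs₀) 1
      simp only [one_mul, mul_one] at this
      rw [this, hψ1]
    have : Nontrivial E := by
      obtain ⟨w, hw⟩ := hζ.exists_hasEigenvector
      exact ⟨⟨⟨w, hw.1⟩, 0, fun h => hw.2 (congrArg Subtype.val h)⟩⟩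
    obtain ⟨ω, hω⟩ := Module.End.exists_eigenvalue ((A s₀).restrict hinv)
    obtain ⟨w, hw⟩ := hω.exists_hasEigenvector
    refine ⟨w, ω, fun h => hw.2 (Subtype.ext h), (hE _).1 w.2, ?_⟩
    have := congrArg Subtype.val hw.apply_eq_smul
    simpa using this
  have hXA : ∀ a x, X x (A a v₀) = ψ ((a⁻¹ : (ZMod (p ^ n))ˣ) * x) • A a v₀ := by
    intro a x
    have h1 : X x * A a = A a * X ((a⁻¹ : (ZMod (p ^ n))ˣ) * x) := by
      rw [hrel]; simp
    rw [← Module.End.mul_apply, h1, Module.End.mul_apply, hXψ v₀ hXv₀, map_smul]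
  have hspan : Submodule.span ℂ (Set.range fun a => A a v₀) = ⊤ := by
    have hmem : v₀ ∈ Submodule.span ℂ (Set.range fun a => A a v₀) :=
      Submodule.subset_span ⟨1, by simp⟩
    refine (hirr _ ?_ ?_).resolve_left ?_
    · intro x u hu
      induction hu using Submodule.span_induction with
      | mem y hy =>
        obtain ⟨a, rfl⟩ := hy
        change X x (A a v₀) ∈ _
        rw [hXA]
        exact Submodule.smul_mem _ _ (Submodule.subset_span ⟨a, rfl⟩)
      | zero => simp
      | add x y _ _ hx hy => rw [map_add]; exact add_mem hx hy
      | smul a x _ hx => rw [map_smul]; exact Submodule.smul_mem _ a hx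
    · intro b u hu
      induction hu using Submodule.span_induction with
      | mem y hy =>
        obtain ⟨a, rfl⟩ := hy
        exact Submodule.subset_span ⟨b * a, by simp⟩
      | zero => simp
      | add x y _ _ hx hy => rw [map_add]; exact add_mem hx hy
      | smul a x _ hx => rw [map_smul]; exact Submodule.smul_mem _ a hx
    · intro h
      rw [h] at hmem
      exact hv₀ (by simpa using hmem)
  have hAs : A s₀ = ω • (1 : Module.End ℂ V) := by
    apply LinearMap.ext_on_range hspan
    intro a
    rw [← Module.End.mul_apply, ← map_mul, mul_comm, map_mul, Module.End.mul_apply, hAv₀]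
    simp
  have hωK : ω ∈ K := by
    have h := hK s₀
    rw [hAs, map_smul, LinearMap.trace_one, smul_eq_mul] at h
    have h2 : ((Module.finrank ℂ V : ℕ) : ℂ) ≠ 0 := Nat.cast_ne_zero.2 Module.finrank_pos.ne'
    have h3 := K.div_mem h (natCast_mem K (Module.finrank ℂ V))
    rwa [mul_div_cancel_right₀ _ h2] at h3
  have hω0 : ω ≠ 0 := by
    rintro rfl
    have h1 : A (s₀⁻¹ * s₀) v₀ = 0 := by
      rw [map_mul, Module.End.mul_apply, hAv₀]; simp
    simp at h1
    exact hv₀ h1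
  have hS : ∀ s ∈ Bst ψ 1, ∃ i : ℕ, A s v₀ = ω ^ i • v₀ := by
    intro s hs
    obtain ⟨i, rfl⟩ := hs₀gen s hs
    exact ⟨i, by rw [map_pow]; exact hpow v₀ ω _ hAv₀ i⟩
  have hordS : ∀ β : (ZMod (p ^ n))ˣ, ∀ i : ℕ,
      orderOf (β : (ZMod (p ^ n))ˣ ⧸ Bst ψ 1) ∣ i ↔ β ^ i ∈ Bst ψ 1 := by
    intro β i
    rw [orderOf_dvd_iff_pow_eq_one, ← QuotientGroup.mk_pow, QuotientGroup.eq_one_iff]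
  -- Case I
  by_cases hζK : ζ ∈ K
  · refine final_lemma K R X A hXR hAR ψ v₀ hv₀ hXA hspan 1 ?_ s₀ hs₀gen ω⁻¹ (K.inv_mem hωK)
      (inv_ne_zero hω0) 0 ?_
    · intro x
      rw [one_mul, ← hcast x, hψn]
      exact pow_mem hζK _
    · rw [hpow v₀ 1]
      · simp
      · rw [hX0, one_mul, LinearMap.smul_apply, hAv₀, smul_smul, inv_mul_cancel₀ hω0]
  -- Case II
  by_cases hω1 : ω = 1
  · obtain ⟨β, hβ, hβgen⟩ := hgen 0
    refine final_lemma K R X A hXR hAR ψ v₀ hv₀ hXA hspan 0 ?_ β hβgen 1 (one_mem K) one_ne_zero 0 ?_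
    · intro x
      simp
    · rw [hX0, one_mul, one_smul, ← map_pow]
      obtain ⟨i, hi⟩ := hS _ ((hordS β _).1 dvd_rfl)
      rw [hi, hω1]; simp
  -- Case III
  obtain ⟨k, hkn, hk⟩ := (Nat.dvd_prime_pow hp).1 (orderOf_dvd_of_pow_eq_one hζ1)
  have hζp : IsPrimitiveRoot ζ (p ^ k) := hk ▸ IsPrimitiveRoot.orderOf ζ
  have hk1 : 1 ≤ k := by
    by_contra h
    have : k = 0 := by omega
    subst this
    rw [pow_zero, orderOf_eq_one_iff] at hk
    exact hζK (hk ▸ one_mem K)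
  have hpi : Prime (p : ℤ) := Nat.prime_iff_prime_int.1 hp
  -- membership in the stabilisers, arithmetically
  have hBst : ∀ (r : ℕ), r ≤ k → ∀ a : (ZMod (p ^ n))ˣ, a ∈ Bst ψ ((p ^ (k - r) : ℕ) : ZMod (p ^ n)) ↔
      (p : ℤ) ^ r ∣ (((a : ZMod (p ^ n)).val : ℕ) : ℤ) - 1 := by
    intro r hr a
    have hb : (a : ZMod (p ^ n)) = (((a : ZMod (p ^ n)).val : ℕ) : ZMod (p ^ n)) := (hcast _).symm
    generalize (a : ZMod (p ^ n)).val = b at hb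
    have h1 : a ∈ Bst ψ ((p ^ (k - r) : ℕ) : ZMod (p ^ n)) ↔
        ζ ^ (p ^ (k - r) * b) = ζ ^ (p ^ (k - r)) := by
      rw [mem_Bst]
      constructor
      · intro h
        have := h 1
        rw [mul_one, mul_one, hb, ← Nat.cast_mul, hψn, hψn] at this
        exact this
      · intro h x
        rw [← hcast x, hb, ← Nat.cast_mul, ← Nat.cast_mul, ← Nat.cast_mul, hψn, hψn,
          ← mul_assoc, pow_mul, h, pow_mul]
    rw [h1]
    have hr' : IsPrimitiveRoot (ζ ^ (p ^ (k - r))) (p ^ r) :=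
      hζp.pow (pow_pos hp.pos k) (by rw [← pow_add]; congr 1; omega)
    rw [pow_mul]
    have h2 : (ζ ^ (p ^ (k - r))) ^ b = ζ ^ (p ^ (k - r)) ↔
        (ζ ^ (p ^ (k - r))) ^ ((b : ℤ) - 1) = 1 := by
      have h0 : ζ ^ (p ^ (k - r)) ≠ 0 := hr'.ne_zero (pow_pos hp.pos r).ne'
      rw [zpow_sub₀ h0, zpow_one, zpow_natCast, div_eq_one_iff_eq h0]
    rw [h2, hr'.zpow_eq_one_iff_dvd]
    push_cast
    rfl
  have hB1 : ∀ a : (ZMod (p ^ n))ˣ, a ∈ Bst ψ 1 ↔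
      (p : ℤ) ^ k ∣ (((a : ZMod (p ^ n)).val : ℕ) : ℤ) - 1 := by
    intro a
    have := hBst k le_rfl a
    simpa using this
  -- `b`-powers
  have hval : ∀ (b : ℕ) (z : ℤ) (r : ℕ), r ≤ n → ((b : ZMod (p ^ n)) : ZMod (p ^ n)) = (z : ZMod (p ^ n)) →
      ((p : ℤ) ^ r ∣ (b : ℤ) - 1 ↔ (p : ℤ) ^ r ∣ z - 1) := by
    intro b z r hr h
    have h1 : ((p ^ n : ℕ) : ℤ) ∣ (b : ℤ) - z := by
      rw [← ZMod.intCast_zmod_eq_zero_iff_dvd]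
      push_cast
      rw [h, sub_self]
    have h2 : (p : ℤ) ^ r ∣ (b : ℤ) - z := by
      refine dvd_trans ?_ h1
      push_cast
      exact pow_dvd_pow _ hr
    rw [show (b : ℤ) - 1 = ((b : ℤ) - z) + (z - 1) by ring]
    exact dvd_add_right h2
  have hωn : ω ^ (p ^ n) = 1 := by
    have h1 : s₀ ^ (p ^ n) = 1 := by
      have hd : (p : ℤ) ∣ (((s₀ : ZMod (p ^ n)).val : ℕ) : ℤ) - 1 :=
        (dvd_pow_self _ (by omega)).trans ((hB1 s₀).1 hs₀)
      have h2 := dvd_sub_pow_of_dvd_sub (R := ℤ) hd n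
      have h3 : ((p ^ n : ℕ) : ℤ) ∣
          ((((s₀ : ZMod (p ^ n)).val : ℕ) : ℤ) ^ p ^ n - 1 ^ p ^ n) := by
        refine dvd_trans ?_ h2
        push_cast
        exact pow_dvd_pow _ (Nat.le_succ n)
      rw [← ZMod.intCast_zmod_eq_zero_iff_dvd] at h3
      push_cast at h3
      rw [hcast, one_pow, sub_eq_zero] at h3
      ext
      push_cast
      exact h3
    have h2 := hpow v₀ ω _ hAv₀ (p ^ n)
    rw [← map_pow, h1, map_one, Module.End.one_apply] at h2
    have h3 : (1 : ℂ) • v₀ = ω ^ (p ^ n) • v₀ := by rw [one_smul]; exact h2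
    exact (smul_left_injective ℂ hv₀ h3).symm
  obtain ⟨j, hjn, hj⟩ := (Nat.dvd_prime_pow hp).1 (orderOf_dvd_of_pow_eq_one hωn)
  have hωp : IsPrimitiveRoot ω (p ^ j) := hj ▸ IsPrimitiveRoot.orderOf ω
  have hj1 : 1 ≤ j := by
    by_contra h
    have : j = 0 := by omega
    subst this
    rw [pow_zero, orderOf_eq_one_iff] at hj
    exact hω1 hj
  have hrootK : ∀ z : ℂ, z ^ (p ^ j) = 1 → z ∈ K := by
    intro z hz
    have : NeZero (p ^ j) := ⟨(pow_pos hp.pos j).ne'⟩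
    obtain ⟨i, _, rfl⟩ := hωp.eq_pow_of_pow_eq_one hz
    exact pow_mem hωK i
  have hjk : j < k := by
    by_contra h
    apply hζK
    apply hrootK
    rw [hζp.pow_eq_one_iff_dvd]
    exact pow_dvd_pow _ (by omega)
  have hr' : IsPrimitiveRoot (ζ ^ (p ^ (k - j))) (p ^ j) :=
      hζp.pow (pow_pos hp.pos k) (by rw [← pow_add]; congr 1; omega)
  obtain ⟨β, hβ, hβgen⟩ := hgen ((p ^ (k - j) : ℕ) : ZMod (p ^ n))
  set M := orderOf (β : (ZMod (p ^ n))ˣ ⧸ Bst ψ 1) with hMdef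
  obtain ⟨b, hb⟩ : ∃ b : ℕ, b = (β : ZMod (p ^ n)).val := ⟨_, rfl⟩
  have hbβ : (b : ZMod (p ^ n)) = β := by rw [hb, hcast]
  obtain ⟨N, hN, hNsum⟩ := nt_lemma p hp hodd j k b M hj1 hjk
    (by rw [hb]; exact (hBst j hjk.le β).1 hβ)
    (by
      intro hcon
      -- the unit `1 + p ^ j`
      have hcop : Nat.Coprime (1 + p ^ j) (p ^ n) := by
        apply Nat.Coprime.pow_right
        rw [Nat.coprime_comm, hp.coprime_iff_not_dvd]
        intro h
        have h2 : p ∣ p ^ j := dvd_pow_self _ (by omega)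
        exact hp.one_lt.ne' (Nat.dvd_one.1 ((Nat.dvd_add_left h2).1 h))
      let a := ZMod.unitOfCoprime (1 + p ^ j) hcop
      have ha : (a : ZMod (p ^ n)) = (((1 + p ^ j : ℕ) : ℤ) : ZMod (p ^ n)) := by
        rw [ZMod.coe_unitOfCoprime]; push_cast; rfl
      have hamem : a ∈ Bst ψ ((p ^ (k - j) : ℕ) : ZMod (p ^ n)) := by
        rw [hBst j hjk.le, hval _ ((1 + p ^ j : ℕ) : ℤ) j hjn (by rw [hcast, ha])]
        push_cast
        simp
      obtain ⟨i, hi⟩ := hβgen a hamem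
      have h3 : ((1 + p ^ j : ℕ) : ZMod (p ^ n)) = (((b : ℤ) ^ i : ℤ) : ZMod (p ^ n)) := by
        push_cast
        rw [hbβ, ← Units.val_pow_eq_pow_val, hi, ha]
        push_cast; rfl
      have h4 := (hval _ _ (j + 1) (by omega) h3).2
        (hcon.trans (by simpa using sub_dvd_pow_sub_pow (b : ℤ) 1 i))
      push_cast at h4
      rw [add_sub_cancel_left, pow_dvd_pow_iff hpi.ne_zero hpi.not_isUnit] at h4
      omega)
    (by
      intro i
      rw [hordS β i, hB1, hval _ ((b : ℤ) ^ i) k hkn]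
      push_cast
      rw [hcast, hbβ])
  obtain ⟨q, hq⟩ := hS _ ((hordS β M).1 dvd_rfl)
  have hNp : IsPrimitiveRoot (ζ ^ (p ^ (k - j) * N)) (p ^ j) := by
    rw [pow_mul]
    exact hr'.pow_of_coprime N (Nat.Coprime.pow_right _ (by
      rw [Nat.coprime_comm, hp.coprime_iff_not_dvd]; exact hN))
  obtain ⟨d, hd⟩ : ∃ d : ℕ, (ζ ^ (p ^ (k - j) * N)) ^ d = (ω ^ q)⁻¹ := by
    have : NeZero (p ^ j) := ⟨(pow_pos hp.pos j).ne'⟩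
    obtain ⟨d, _, hd⟩ := hNp.eq_pow_of_pow_eq_one (ξ := (ω ^ q)⁻¹) (by
      rw [inv_pow, pow_right_comm, hωp.pow_eq_one]; simp)
    exact ⟨d, hd⟩
  have hgpow : ∀ i : ℕ, (X (d : ZMod (p ^ n)) * A β) ^ i =
      X ((d * ∑ r ∈ Finset.range i, b ^ r : ℕ) : ZMod (p ^ n)) * A (β ^ i) := by
    intro i
    induction i with
    | zero => simp [hX0]
    | succ i ih =>
      rw [pow_succ', ih]
      have e1 : X (d : ZMod (p ^ n)) * A β *
          (X ((d * ∑ r ∈ Finset.range i, b ^ r : ℕ) : ZMod (p ^ n)) * A (β ^ i)) =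
          X (d : ZMod (p ^ n)) * (A β *
          X ((d * ∑ r ∈ Finset.range i, b ^ r : ℕ) : ZMod (p ^ n))) * A (β ^ i) := by
        simp only [mul_assoc]
      rw [e1, hrel, ← mul_assoc, ← hXadd, mul_assoc, ← map_mul, ← pow_succ', ← hbβ]
      congr 2
      rw [Finset.sum_range_succ']
      push_cast
      simp only [pow_succ', ← Finset.mul_sum]
      ring
  refine final_lemma K R X A hXR hAR ψ v₀ hv₀ hXA hspan _ ?_ β hβgen 1 (one_mem K) one_ne_zero
    (d : ZMod (p ^ n)) ?_
  · intro x
    apply hrootK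
    rw [← hcast x, ← Nat.cast_mul, hψn, pow_mul, pow_right_comm, hr'.pow_eq_one, one_pow]
  · rw [one_smul, hgpow, Module.End.mul_apply, hq, map_smul, hXψ v₀ hXv₀, hψn, hNsum, mul_comm d,
      pow_mul, hd, smul_smul, mul_inv_cancel₀ (pow_ne_zero _ hω0), one_smul]

/-- Multiplication by a unit as an automorphism of the cyclic group. -/
def unitAut (m : ℕ) : (ZMod m)ˣ →* MulAut (Cyc m) where
  toFun a :=
    { toFun := fun x => Multiplicative.ofAdd ((a : ZMod m) * x.toAdd)
      invFun := fun x => Multiplicative.ofAdd (((a⁻¹ : (ZMod m)ˣ) : ZMod m) * x.toAdd)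
      left_inv := by intro x; simp
      right_inv := by intro x; simp
      map_mul' := by intro x y; simp [mul_add] }
  map_one' := by ext x; simp
  map_mul' := by
    intro a b
    ext x
    apply Multiplicative.toAdd.injective
    simp [mul_assoc]

theorem unitAut_apply (m : ℕ) (a : (ZMod m)ˣ) (x : ZMod m) :
    unitAut m a (Multiplicative.ofAdd x) = Multiplicative.ofAdd ((a : ZMod m) * x) := rfl

theorem aut_apply (m : ℕ) [NeZero m] (f : MulAut (Cyc m)) (x : ZMod m) :
    f (Multiplicative.ofAdd x) =
      Multiplicative.ofAdd ((f (Multiplicative.ofAdd 1)).toAdd * x) := by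
  have : x = x.val • (1 : ZMod m) := by simp
  have h : Multiplicative.ofAdd x = (Multiplicative.ofAdd (1 : ZMod m)) ^ x.val := by
    rw [← ofAdd_nsmul, ← this]
  rw [h, map_pow]
  apply Multiplicative.toAdd.injective
  rw [toAdd_pow, toAdd_ofAdd, nsmul_eq_mul, ZMod.natCast_zmod_val, mul_comm]

theorem unitAut_surjective (m : ℕ) [NeZero m] : Function.Surjective (unitAut m) := by
  intro f
  have key : ∀ f g : MulAut (Cyc m), f * g = 1 →
      (f (Multiplicative.ofAdd 1)).toAdd * (g (Multiplicative.ofAdd 1)).toAdd = 1 := by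
    intro f g h
    have h1 := congrArg (fun t : MulAut (Cyc m) => (t (Multiplicative.ofAdd (1 : ZMod m))).toAdd) h
    simp only [MulAut.mul_apply, MulAut.one_apply, toAdd_ofAdd] at h1
    rw [← ofAdd_toAdd (g (Multiplicative.ofAdd 1)), aut_apply] at h1
    exact h1
  refine ⟨⟨(f (Multiplicative.ofAdd 1)).toAdd, (f⁻¹ (Multiplicative.ofAdd 1)).toAdd,
    key _ _ (by simp), key _ _ (by simp)⟩, ?_⟩
  ext x
  exact congrArg _ (aut_apply m f x.toAdd).symm

theorem stmt11 (p n : ℕ) (hp : p.Prime) (hodd : Odd p) (hn : 1 ≤ n)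
    (V : FDRep ℂ (Hol (p ^ n))) (hV : Simple V) :
    ∃ W : FDRep (IntermediateField.adjoin ℚ (Set.range V.character)) (Hol (p ^ n)),
      ∀ g : Hol (p ^ n), (W.character g : ℂ) = V.character g := by
  have hne : NeZero (p ^ n) := ⟨(pow_pos hp.pos n).ne'⟩
  have hfinA : Finite (MulAut (Cyc (p ^ n))) := Finite.of_surjective _ (unitAut_surjective (p ^ n))
  have hfin : Finite (Hol (p ^ n)) := Finite.of_equiv _ SemidirectProduct.equivProd.symm
  set K := IntermediateField.adjoin ℚ (Set.range V.character) with hKdef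
  have hK : ∀ g, LinearMap.trace ℂ V (V.ρ g) ∈ K := fun g =>
    IntermediateField.subset_adjoin ℚ _ ⟨g, rfl⟩
  have hirr := irr_of_simple V hV
  have hnt : Nontrivial V := nontriv_of_simple V hV
  let R : Subalgebra K (Module.End ℂ V) := Algebra.adjoin K (Set.range fun g => V.ρ g)
  let X : ZMod (p ^ n) → Module.End ℂ V := fun x =>
    V.ρ (SemidirectProduct.inl (Multiplicative.ofAdd x))
  let A : (ZMod (p ^ n))ˣ →* Module.End ℂ V :=
    (V.ρ.comp SemidirectProduct.inr).comp (unitAut (p ^ n))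
  have hA : ∀ a, A a = V.ρ (SemidirectProduct.inr (unitAut (p ^ n) a)) := fun a => rfl
  obtain ⟨e, heR, he0, v, hev⟩ := core_thm p n hp hodd K R X A
    (fun x => Algebra.subset_adjoin ⟨_, rfl⟩) (fun a => Algebra.subset_adjoin ⟨_, rfl⟩)
    (by simp [X]) (by intro x y; simp only [X]; rw [ofAdd_add, map_mul, map_mul])
    (by
      intro a x
      rw [hA]
      simp only [X]
      rw [← map_mul, ← map_mul]
      congr 1
      rw [← unitAut_apply]
      have := SemidirectProduct.inl_aut (φ := MonoidHom.id (MulAut (Cyc (p ^ n))))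
        (unitAut (p ^ n) a) (Multiplicative.ofAdd x)
      rw [MonoidHom.id_apply] at this
      rw [this]
      simp)
    (by
      intro U hUX hUA
      apply hirr
      intro g u hu
      obtain ⟨a, ha⟩ := unitAut_surjective (p ^ n) g.right
      have hg : g = SemidirectProduct.inl (Multiplicative.ofAdd g.left.toAdd) *
          SemidirectProduct.inr (unitAut (p ^ n) a) := by
        rw [ha, ofAdd_toAdd, SemidirectProduct.inl_left_mul_inr_right]
      rw [hg, map_mul]
      exact hUX _ _ (hUA a u hu))
    (fun a => hK _)
  refine realize' V.ρ hirr K hK e ?_ he0 v hev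
  have h1 : e ∈ Subalgebra.toSubmodule R := heR
  rw [Algebra.adjoin_eq_span] at h1
  have h2 : (Submonoid.closure (Set.range fun g => V.ρ g) : Set (Module.End ℂ V)) ⊆
      Set.range fun g => V.ρ g := by
    have : Submonoid.closure (Set.range fun g => V.ρ g) ≤ MonoidHom.mrange V.ρ := by
      rw [Submonoid.closure_le]
      rintro _ ⟨g, rfl⟩
      exact ⟨g, rfl⟩
    exact this
  exact Submodule.span_mono h2 h1
end

section
/- For n ≥ 3, the Schur index over ℚ of every irreducible complex character of Hol(C_{2^n}) is equal to 1. -/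
open CategoryTheory

theorem lemA {G : Type} [Group G] [Fintype G] {V : Type} [AddCommGroup V] [Module ℂ V]
    [FiniteDimensional ℂ V] (ρ : Representation ℂ G V)
    (hirr : ∀ w : V, w ≠ 0 → Submodule.span ℂ (Set.range fun g => ρ g w) = ⊤)
    (K : IntermediateField ℚ ℂ) (hK : ∀ g, LinearMap.trace ℂ V (ρ g) ∈ K)
    (F : V →ₗ[ℂ] V) (hF : F ∈ Submodule.span K (Set.range fun g => ρ g))
    (hF0 : F ≠ 0) (v₀ : V) (hFv : ∀ x, ∃ c : ℂ, F x = c • v₀) :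
    ∃ W : FDRep K G, ∀ g : G, (W.character g : ℂ) = LinearMap.trace ℂ V (ρ g) := by
  classical
  obtain ⟨x₀, hx₀⟩ : ∃ x, F x ≠ 0 := by
    by_contra! h
    exact hF0 (LinearMap.ext h)
  have hv₀ : v₀ ≠ 0 := by
    rintro rfl
    obtain ⟨c, hc⟩ := hFv x₀
    exact hx₀ (by simpa using hc)
  choose φ' hφ' using hFv
  have hinj : ∀ a b : ℂ, a • v₀ = b • v₀ → a = b := fun a b h => smul_left_injective ℂ hv₀ h
  let φ : V →ₗ[ℂ] ℂ :=
    { toFun := φ'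
      map_add' := fun x y => hinj _ _ (by rw [add_smul, ← hφ', ← hφ', ← hφ', map_add])
      map_smul' := fun c x => hinj _ _ (by
        rw [smul_eq_mul, mul_smul, ← hφ', RingHom.id_apply, ← hφ', map_smul]) }
  have hφ : ∀ x, F x = φ x • v₀ := hφ'
  have hFs : F = φ.smulRight v₀ := by ext x; simp [hφ]
  have hφ0 : φ ≠ 0 := by
    intro h
    apply hF0; rw [hFs, h]; ext; simp
  -- values in K
  have hmem : ∀ g, ∀ F ∈ Submodule.span K (Set.range fun g => ρ g),
      LinearMap.trace ℂ V (ρ g ∘ₗ F) ∈ K := by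
    intro g F hF
    induction hF using Submodule.span_induction with
    | mem x hx =>
      obtain ⟨h, rfl⟩ := hx
      have : ρ g ∘ₗ ρ h = ρ (g * h) := by rw [map_mul]; rfl
      simp only [this]; exact hK _
    | zero => simp
    | add x y _ _ hx hy =>
      rw [LinearMap.comp_add, map_add]; exact K.add_mem hx hy
    | smul a x _ hx =>
      have : ρ g ∘ₗ (a • x) = (a : ℂ) • (ρ g ∘ₗ x) := by
        ext y; simp [IntermediateField.smul_def]
      rw [this, map_smul]
      exact K.mul_mem a.2 hx
  have hval : ∀ g, φ (ρ g v₀) ∈ K := by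
    intro g
    have h1 : ρ g ∘ₗ F = φ.smulRight (ρ g v₀) := by ext x; simp [hφ]
    rw [← LinearMap.trace_smulRight, ← h1]
    exact hmem g F hF
  let W0 : Submodule K V := Submodule.span K (Set.range fun g => ρ g v₀)
  have hstab : ∀ g, ∀ x ∈ W0, ((ρ g).restrictScalars K) x ∈ W0 := by
    intro g x hx
    induction hx using Submodule.span_induction with
    | mem x hx =>
      obtain ⟨h, rfl⟩ := hx
      exact Submodule.subset_span ⟨g * h, by simp⟩
    | zero => simp
    | add x y _ _ hx hy => rw [map_add]; exact W0.add_mem hx hy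
    | smul a x _ hx => rw [map_smul]; exact W0.smul_mem _ hx
  have hvalW : ∀ g, ∀ x ∈ W0, φ (ρ g x) ∈ K := by
    intro g x hx
    induction hx using Submodule.span_induction with
    | mem x hx =>
      obtain ⟨h, rfl⟩ := hx
      have : ρ g (ρ h v₀) = ρ (g * h) v₀ := by simp
      simp only [this]; exact hval _
    | zero => simp
    | add x y _ _ hx hy => rw [map_add, map_add]; exact K.add_mem hx hy
    | smul a x _ hx =>
      rw [IntermediateField.smul_def, map_smul, map_smul]; exact K.mul_mem a.2 hx
  have : Module.Finite K W0 := Module.Finite.span_of_finite K (Set.finite_range _)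
  let σ : Representation K G W0 :=
    { toFun := fun g => ((ρ g).restrictScalars K).restrict (hstab g)
      map_one' := by ext; simp
      map_mul' := fun a b => by ext; simp }
  refine ⟨FDRep.of σ, fun g => ?_⟩
  let b := Module.finBasis K W0
  have hli : LinearIndependent ℂ (fun i => (b i : V)) := by
    rw [Fintype.linearIndependent_iff]
    intro z hz i
    by_contra hzi
    obtain ⟨t, ht⟩ : ∃ t : Module.Dual K ℂ, t (z i) ≠ 0 := by
      by_contra! h
      exact hzi ((Module.forall_dual_apply_eq_zero_iff K (z i)).1 h)
    set w : V := ∑ j, t (z j) • (b j : V) with hw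
    have hker : ∀ g, φ (ρ g w) = 0 := by
      intro g
      have h1 : ∑ j, z j * φ (ρ g (b j)) = 0 := by
        have := congrArg (fun x => φ (ρ g x)) hz
        simpa using this
      have h2 : t (∑ j, z j * φ (ρ g (b j))) = 0 := by rw [h1, map_zero]
      rw [map_sum] at h2
      rw [hw]
      simp only [IntermediateField.smul_def, map_sum, map_smul, smul_eq_mul]
      have h3 : ∀ j, t (z j * φ (ρ g (b j))) = t (z j) * ⟨φ (ρ g (b j)), hvalW g _ (b j).2⟩ := by
        intro j
        have : z j * φ (ρ g (b j)) = (⟨φ (ρ g (b j)), hvalW g _ (b j).2⟩ : K) • z j := by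
          rw [IntermediateField.smul_def, smul_eq_mul, mul_comm]
        rw [this, map_smul, smul_eq_mul, mul_comm]
      simp only [h3] at h2
      have h4 := congrArg (fun x : K => (x : ℂ)) h2
      simpa using h4
    have hw0 : w = 0 := by
      by_contra hne
      apply hφ0
      have := hirr w hne
      refine LinearMap.ext_on_range (v := fun g => ρ g w) this ?_
      intro g; simpa using hker g
    have hb := Fintype.linearIndependent_iff.1 b.linearIndependent (fun j => t (z j)) (by
      apply Subtype.ext
      simpa using hw0) i
    exact ht hb
  have hsp : ⊤ ≤ Submodule.span ℂ (Set.range (fun i => (b i : V))) := by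
    rw [← hirr v₀ hv₀, Submodule.span_le]
    rintro _ ⟨h, rfl⟩
    have hm : ρ h v₀ ∈ W0 := Submodule.subset_span ⟨h, rfl⟩
    have := b.sum_repr ⟨_, hm⟩
    have h2 := congrArg (fun x : W0 => (x : V)) this
    simp only [AddSubmonoidClass.coe_finsetSum, SetLike.val_smul] at h2
    change ρ h v₀ ∈ _
    rw [← h2]
    refine Submodule.sum_mem _ fun i _ => ?_
    rw [IntermediateField.smul_def]
    exact Submodule.smul_mem _ _ (Submodule.subset_span ⟨i, rfl⟩)
  let B := Module.Basis.mk hli hsp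
  have hB : ∀ i, B i = (b i : V) := fun i => by simp [B]
  rw [LinearMap.trace_eq_matrix_trace ℂ B]
  have hc : (FDRep.of σ).character g = LinearMap.trace K W0 (σ g) := rfl
  rw [hc, LinearMap.trace_eq_matrix_trace K b]
  simp only [Matrix.trace, Matrix.diag_apply, LinearMap.toMatrix_apply]
  rw [AddSubmonoidClass.coe_finsetSum]
  refine Finset.sum_congr rfl fun i _ => ?_
  have h5 : ρ g (B i) = ∑ j, ((b.repr (σ g (b i)) j : K) : ℂ) • B j := by
    have := congrArg (fun x : W0 => (x : V)) (b.sum_repr (σ g (b i)))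
    simp only [AddSubmonoidClass.coe_finsetSum, SetLike.val_smul] at this
    simp only [hB, ← IntermediateField.smul_def]
    rw [this]; rfl
  rw [h5]
  simp [Finsupp.single_apply]

theorem irr_of_simple_s12 {G : Type} [Group G] (V : FDRep ℂ G) (hV : Simple V) :
    ∀ w : V, w ≠ 0 → Submodule.span ℂ (Set.range fun g => V.ρ g w) = ⊤ := by
  intro w hw
  set S := Submodule.span ℂ (Set.range fun g => V.ρ g w) with hS
  have hstab : ∀ g, ∀ x ∈ S, V.ρ g x ∈ S := by
    intro g x hx
    induction hx using Submodule.span_induction with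
    | mem x hx =>
      obtain ⟨h, rfl⟩ := hx
      exact Submodule.subset_span ⟨g * h, by simp⟩
    | zero => simp
    | add x y _ _ hx hy => rw [map_add]; exact S.add_mem hx hy
    | smul a x _ hx => rw [map_smul]; exact S.smul_mem _ hx
  let σ : Representation ℂ G S :=
    { toFun := fun g => (V.ρ g).restrict (hstab g)
      map_one' := by ext; simp
      map_mul' := fun a b => by ext; simp }
  let f : FDRep.of σ ⟶ V := ⟨InducedCategory.homMk (ModuleCat.ofHom S.subtype), fun g => by
    ext x; rfl⟩
  have hf : ∀ x : S, f.hom.hom.hom x = (x : V) := fun x => rfl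
  have : Mono f := by
    have : Mono ((forget (FDRep ℂ G)).map f) := by
      rw [mono_iff_injective]
      exact Subtype.val_injective
    exact (forget (FDRep ℂ G)).mono_of_mono_map this
  have hne : f ≠ 0 := by
    intro h
    have hw' : w ∈ S := Submodule.subset_span ⟨1, by simp⟩
    have := hf ⟨w, hw'⟩
    rw [h] at this
    exact hw this.symm
  have := isIso_of_mono_of_nonzero hne
  rw [eq_top_iff]
  intro x _
  let e := FDRep.isoToLinearEquiv (asIso f)
  have h1 := e.apply_symm_apply x
  have h2 : e (e.symm x) = ((e.symm x : S) : V) := rfl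
  rw [← h1, h2]
  exact (e.symm x : S).2

theorem nt1 (e : ℕ) : ∃ c, Odd c ∧ 5 ^ (2 ^ e) = 1 + 2 ^ (e + 2) * c := by
  induction e with
  | zero => exact ⟨1, odd_one, by norm_num⟩
  | succ e ih =>
    obtain ⟨c, hc, h⟩ := ih
    refine ⟨c + 2 ^ (e + 1) * c ^ 2, ?_, ?_⟩
    · refine hc.add_even ?_
      rw [pow_succ]
      exact (even_two.mul_left _).mul_right _
    · rw [pow_succ 2 e, pow_mul, h]; ring

theorem nt2 (e f w : ℕ) (hw : w ≡ 1 [MOD 2 ^ (e + 2)]) :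
    ∃ i, 5 ^ (2 ^ e * i) ≡ w [MOD 2 ^ (e + f + 2)] := by
  induction f with
  | zero => exact ⟨0, by simpa using hw.symm⟩
  | succ f ih =>
    obtain ⟨i, hi⟩ := ih
    by_cases h : 5 ^ (2 ^ e * i) ≡ w [MOD 2 ^ (e + (f + 1) + 2)]
    · exact ⟨i, h⟩
    · obtain ⟨c, hc, h5⟩ := nt1 (e + f)
      refine ⟨i + 2 ^ f, ?_⟩
      have h6 : 5 ^ (2 ^ e * (i + 2 ^ f)) = 5 ^ (2 ^ e * i) * (1 + 2 ^ (e + f + 2) * c) := by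
        rw [← h5, ← pow_add]; ring_nf
      rw [h6]
      rw [← Int.natCast_modEq_iff] at *
      have h5o : Odd ((5 : ℤ) ^ (2 ^ e * i)) := Odd.pow (by decide)
      have hco : Odd (c : ℤ) := by exact_mod_cast hc
      rw [Int.modEq_iff_dvd] at *
      push_cast at *
      obtain ⟨d, hd⟩ := hi
      have hdo : Odd d := by
        rw [← Int.not_even_iff_odd]
        rintro ⟨y, rfl⟩
        apply h
        refine ⟨y, ?_⟩
        rw [hd]; ring
      obtain ⟨y, hy⟩ := hdo.sub_odd (h5o.mul hco)
      refine ⟨y, ?_⟩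
      have : (w : ℤ) - 5 ^ (2 ^ e * i) * (1 + 2 ^ (e + f + 2) * c) =
        2 ^ (e + f + 2) * (d - 5 ^ (2 ^ e * i) * c) := by linear_combination hd
      rw [this, hy]; ring

theorem nt3 (e f i : ℕ) (h : 5 ^ (2 ^ e * i) ≡ 1 [MOD 2 ^ (e + f + 2)]) (hi : i < 2 ^ f) :
    i = 0 := by
  have h1 : (5 : ZMod (2 ^ (e + f + 2))) ^ (2 ^ e * i) = 1 := by
    have := (ZMod.natCast_eq_natCast_iff _ _ _).2 h
    simpa using this
  have h2 := orderOf_dvd_of_pow_eq_one h1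
  rw [ZMod.orderOf_five, pow_add] at h2
  have h3 : 2 ^ f ∣ i := Nat.dvd_of_mul_dvd_mul_left (by positivity) h2
  exact Nat.eq_zero_of_dvd_of_lt h3 hi

theorem nt4 (e f : ℕ) : ∃ c, Odd c ∧
    ∑ l ∈ Finset.range (2 ^ f), (5 ^ (2 ^ e)) ^ l = 2 ^ f * c := by
  obtain ⟨c, hc, h⟩ := nt1 e
  obtain ⟨d, hd, h'⟩ := nt1 (e + f)
  have hg := mul_geom_sum ((5 : ℤ) ^ (2 ^ e)) (2 ^ f)
  rw [← pow_mul, ← pow_add] at hg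
  zify at h h'
  rw [h', h] at hg
  set S := ∑ l ∈ Finset.range (2 ^ f), (5 ^ (2 ^ e)) ^ l with hS
  have hg' : c * S = 2 ^ f * d := by
    have hz : ((2 : ℤ) ^ (e + 2)) ≠ 0 := by positivity
    have : (c : ℤ) * S = 2 ^ f * d := by
      apply mul_left_cancel₀ hz
      rw [hS]; push_cast
      rw [h]
      linear_combination hg
    exact_mod_cast this
  have hcop : Nat.Coprime (2 ^ f) c := (Nat.coprime_two_left.2 hc).pow_left f
  obtain ⟨x, hx⟩ : 2 ^ f ∣ S := hcop.dvd_of_dvd_mul_left ⟨d, hg'⟩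
  refine ⟨x, ?_, hx⟩
  have : c * x = d := by
    rw [hx] at hg'
    have h2 : 0 < 2 ^ f := by positivity
    apply Nat.eq_of_mul_eq_mul_left h2
    linarith
  rw [← this] at hd
  exact (Nat.odd_mul.1 hd).2

theorem lemB {G : Type} [Group G] {V : Type} [AddCommGroup V] [Module ℂ V]
    [FiniteDimensional ℂ V] [Nontrivial V] (ρ : Representation ℂ G V)
    (hirr : ∀ w : V, w ≠ 0 → Submodule.span ℂ (Set.range fun g => ρ g w) = ⊤)
    (K : IntermediateField ℚ ℂ) (hK : ∀ g, LinearMap.trace ℂ V (ρ g) ∈ K)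
    (n : ℕ) (t : ZMod (2 ^ n) → G) (s : (ZMod (2 ^ n))ˣ →* G) (π : G →* (ZMod (2 ^ n))ˣ)
    (htadd : ∀ a b, t (a + b) = t a * t b)
    (hπs : ∀ u, π (s u) = u) (hπt : ∀ a, π (t a) = 1)
    (hconj : ∀ x a, x * t a = t (π x * a) * x)
    (hdec : ∀ x, ∃ a, x = t a * s (π x)) :
    ∃ (F : V →ₗ[ℂ] V) (v₁ : V), F ∈ Submodule.span K (Set.range fun g => ρ g) ∧ F ≠ 0 ∧
      ∀ x, ∃ c : ℂ, F x = c • v₁ := by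
  classical
  have : NeZero (2 ^ n) := ⟨by positivity⟩
  have ht0 : t 0 = 1 := by
    have := htadd 0 0
    simpa using this
  have htnat : ∀ m : ℕ, t (m : ZMod (2 ^ n)) = t 1 ^ m := by
    intro m
    induction m with
    | zero => simpa using ht0
    | succ m ih => push_cast; rw [htadd, ih, pow_succ]
  -- an eigenvector of the normal cyclic subgroup
  obtain ⟨ζ, hζ⟩ := Module.End.exists_eigenvalue (K := ℂ) (ρ (t 1))
  obtain ⟨v₀, hv⟩ := hζ.exists_hasEigenvector
  have hv0 : v₀ ≠ 0 := hv.2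
  have hpow : ∀ m : ℕ, ρ (t (m : ZMod (2 ^ n))) v₀ = ζ ^ m • v₀ := by
    intro m
    rw [htnat, map_pow, hv.pow_apply]
  have hζN : ζ ^ (2 ^ n) = 1 := by
    have h1 := hpow (2 ^ n)
    rw [ZMod.natCast_self, ht0, map_one] at h1
    have h2 : (1 : ℂ) • v₀ = ζ ^ (2 ^ n) • v₀ := by rw [← h1]; simp
    exact (smul_left_injective ℂ hv0 h2).symm
  let ψ : AddChar (ZMod (2 ^ n)) ℂ := AddChar.zmodChar (2 ^ n) hζN
  have hψnat : ∀ m : ℕ, ψ (m : ZMod (2 ^ n)) = ζ ^ m := fun m => AddChar.zmodChar_apply' hζN m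
  have hψ1 : ψ 1 = ζ := by simpa using hψnat 1
  have hTv : ∀ a, ρ (t a) v₀ = ψ a • v₀ := by
    intro a
    rw [← ZMod.natCast_zmod_val a, hpow, hψnat]
  have hψmul : ∀ a b, ψ (a * b) = ψ b ^ a.val := by
    intro a b
    conv_lhs => rw [← ZMod.natCast_zmod_val a, ← nsmul_eq_mul, AddChar.map_nsmul_eq_pow]
  have hψcongr : ∀ a b c, ψ b = ψ c → ψ (a * b) = ψ (a * c) := by
    intro a b c h; rw [hψmul, hψmul, h]
  have hTx : ∀ x a, ρ (t a) (ρ x v₀) = ψ (((π x)⁻¹ : (ZMod (2 ^ n))ˣ) * a) • ρ x v₀ := by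
    intro x a
    have h1 := hconj x (((π x)⁻¹ : (ZMod (2 ^ n))ˣ) * a)
    rw [Units.mul_inv_cancel_left] at h1
    rw [← Module.End.mul_apply, ← map_mul, ← h1, map_mul, Module.End.mul_apply, hTv, map_smul]
  have hext : ∀ A B : V →ₗ[ℂ] V, (∀ x, A (ρ x v₀) = B (ρ x v₀)) → A = B := by
    intro A B h
    exact LinearMap.ext_on_range (v := fun g => ρ g v₀) (hirr v₀ hv0) h
  -- elements acting trivially
  have htriv : ∀ b, ψ b = 1 → ρ (t b) = 1 := by
    intro b hb
    apply hext
    intro x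
    rw [hTx, hψmul, hb]; simp
  have hstab : ∀ u : (ZMod (2 ^ n))ˣ, ψ u = ψ 1 → ∀ a, ψ ((u : ZMod (2 ^ n)) * a) = ψ a := by
    intro u hu a
    rw [mul_comm, hψcongr a _ _ hu, mul_one]
  have hcomm : ∀ u : (ZMod (2 ^ n))ˣ, ψ u = ψ 1 → ∀ x, ρ (s u) * ρ x = ρ x * ρ (s u) := by
    intro u hu x
    obtain ⟨a, ha⟩ := hdec x
    have h1 : s u * x = t ((u : ZMod (2 ^ n)) * a - a) * (x * s u) := by
      rw [ha]
      have e1 := hconj (s u) a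
      rw [hπs] at e1
      have e2 : s (π x) * s u = s u * s (π x) := by rw [← map_mul, ← map_mul, mul_comm]
      rw [← mul_assoc, e1, mul_assoc (t a), e2, ← mul_assoc, ← mul_assoc, ← htadd,
        sub_add_cancel]
    have h2 : ψ ((u : ZMod (2 ^ n)) * a - a) = 1 := by
      rw [AddChar.map_sub_eq_div, hstab u hu, div_self]
      intro h0
      have := AddChar.map_add_eq_mul ψ a (-a)
      rw [h0] at this; simp at this
    rw [← map_mul, h1, map_mul, htriv _ h2, one_mul, map_mul]
  have hscal : ∀ u : (ZMod (2 ^ n))ˣ, ψ u = ψ 1 → ∃ c : ℂ, ρ (s u) = c • 1 := by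
    intro u hu
    obtain ⟨c, hc⟩ := Module.End.exists_eigenvalue (K := ℂ) (ρ (s u))
    obtain ⟨w, hw⟩ := hc.exists_hasEigenvector
    refine ⟨c, LinearMap.ext_on_range (v := fun g => ρ g w) (hirr w hw.2) fun x => ?_⟩
    rw [← Module.End.mul_apply, hcomm u hu, Module.End.mul_apply, hw.apply_eq_smul, map_smul]
    rfl
  have hstabz : ∀ z, ψ (π z) = ψ 1 → ∃ c : ℂ, ρ z v₀ = c • v₀ := by
    intro z hz
    obtain ⟨a, ha⟩ := hdec z
    obtain ⟨c, hc⟩ := hscal _ hz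
    refine ⟨c * ψ a, ?_⟩
    rw [ha, map_mul, hc, Module.End.mul_apply]
    simp [hTv, mul_smul]
  have hline : ∀ x y, ψ (π x) = ψ (π y) → ∃ c : ℂ, ρ x v₀ = c • ρ y v₀ := by
    intro x y h
    obtain ⟨c, hc⟩ := hstabz (y⁻¹ * x) (by
      rw [map_mul, Units.val_mul, hψcongr _ _ _ h, map_inv, Units.inv_mul])
    refine ⟨c, ?_⟩
    rw [← map_smul, ← hc, ← Module.End.mul_apply, ← map_mul]; simp
  -- projections
  let P : ZMod (2 ^ n) → V →ₗ[ℂ] V := fun d => ∑ a, ψ (-(d * a)) • ρ (t (d * a))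
  have hN0 : ((2 : ℂ) ^ n) ≠ 0 := pow_ne_zero _ two_ne_zero
  have hP : ∀ d x, P d (ρ x v₀) =
      (if ψ ((((π x)⁻¹ : (ZMod (2 ^ n))ˣ) - 1) * d) = 1 then (2 : ℂ) ^ n else 0) • ρ x v₀ := by
    intro d x
    simp only [P, LinearMap.sum_apply, LinearMap.smul_apply, hTx, smul_smul,
      ← AddChar.map_add_eq_mul]
    rw [← Finset.sum_smul]
    congr 1
    have h1 : ∀ a, ψ (-(d * a) + ((π x)⁻¹ : (ZMod (2 ^ n))ˣ) * (d * a)) =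
        (ψ.mulShift ((((π x)⁻¹ : (ZMod (2 ^ n))ˣ) - 1) * d)) a := by
      intro a; rw [AddChar.mulShift_apply]; congr 1; ring
    simp only [h1]
    rw [AddChar.sum_eq_ite]
    have h2 : ψ.mulShift ((((π x)⁻¹ : (ZMod (2 ^ n))ˣ) - 1) * d) = 0 ↔
        ψ ((((π x)⁻¹ : (ZMod (2 ^ n))ˣ) - 1) * d) = 1 := by
      constructor
      · intro h
        have := DFunLike.congr_fun h 1
        simpa [AddChar.mulShift_apply] using this
      · intro h
        ext a
        rw [AddChar.mulShift_apply, mul_comm, hψmul, h]; simp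
    simp only [h2]
    split_ifs <;> simp [ZMod.card]
  have hPK : ∀ d, ψ d ∈ K → P d ∈ Submodule.span K (Set.range fun g => ρ g) := by
    intro d hd
    refine Submodule.sum_mem _ fun a _ => ?_
    have h1 : ψ (-(d * a)) ∈ K := by
      have : -(d * a) = (-a) * d := by ring
      rw [this, hψmul]; exact pow_mem hd _
    exact Submodule.smul_mem _ (⟨_, h1⟩ : K) (Submodule.subset_span ⟨_, rfl⟩)
  have hNV : ∀ (ι : Type) (I : Finset ι) (x : ι → G) (i₀ : ι), i₀ ∈ I → x i₀ = 1 →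
      (∀ i ∈ I, i ≠ i₀ → ψ (π (x i)) ≠ ψ 1) → ∑ i ∈ I, ρ (x i) v₀ ≠ 0 := by
    intro ι I x i₀ hi₀ hx hne h0
    have h1 := congrArg (P 1) h0
    rw [map_sum, map_zero, Finset.sum_eq_single i₀] at h1
    · rw [hP, hx] at h1
      simp [hv0] at h1
    · intro i hi hii
      rw [hP, if_neg, zero_smul]
      intro h2
      apply hne i hi hii
      rw [mul_one, AddChar.map_sub_eq_div] at h2
      have h3 : ψ ((π (x i))⁻¹ : (ZMod (2 ^ n))ˣ) = ψ 1 := by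
        have h4 : ψ 1 ≠ 0 := fun h => by rw [h] at h2; simp at h2
        field_simp at h2
        exact h2
      have := hψcongr (π (x i)) _ _ h3
      rw [Units.mul_inv, mul_one] at this
      exact this.symm
    · intro h; exact absurd hi₀ h
  have hrank : ∀ (F : V →ₗ[ℂ] V) (v₁ : V), (∀ x, ∃ c : ℂ, F (ρ x v₀) = c • v₁) →
      ∀ x, ∃ c : ℂ, F x = c • v₁ := by
    intro F v₁ h x
    have hx : x ∈ Submodule.span ℂ (Set.range fun g => ρ g v₀) := by rw [hirr v₀ hv0]; trivial
    induction hx using Submodule.span_induction with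
    | mem x hx => obtain ⟨g, rfl⟩ := hx; exact h g
    | zero => exact ⟨0, by simp⟩
    | add x y _ _ hx hy =>
      obtain ⟨c, hc⟩ := hx
      obtain ⟨d, hd⟩ := hy
      exact ⟨c + d, by rw [map_add, hc, hd, add_smul]⟩
    | smul a x _ hx =>
      obtain ⟨c, hc⟩ := hx
      exact ⟨a * c, by rw [map_smul, hc, mul_smul]⟩
  have hψinv : ∀ (u : (ZMod (2 ^ n))ˣ) d, ψ (((u⁻¹ : (ZMod (2 ^ n))ˣ) - 1) * d) = 1 →
      ψ (u * d) = ψ d := by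
    intro u d h
    have h1 : ψ (u * ((((u⁻¹ : (ZMod (2 ^ n))ˣ) : ZMod (2 ^ n)) - 1) * d)) = 1 := by
      rw [hψmul, h, one_pow]
    have h2 : (u : ZMod (2 ^ n)) * ((((u⁻¹ : (ZMod (2 ^ n))ˣ) : ZMod (2 ^ n)) - 1) * d) =
        d - u * d := by
      rw [← mul_assoc, mul_sub, Units.mul_inv]; ring
    rw [h2, AddChar.map_sub_eq_div] at h1
    have h3 : ψ ((u : ZMod (2 ^ n)) * d) ≠ 0 := fun h => by rw [h] at h1; simp at h1
    field_simp at h1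
    exact h1.symm
  -- case 0
  by_cases hζK : ζ ∈ K
  · refine ⟨P 1, v₀, hPK 1 (by rw [hψ1]; exact hζK), ?_, hrank _ _ ?_⟩
    · intro h
      have := hP 1 1
      rw [h] at this
      simp only [map_one, inv_one, Units.val_one, sub_self, zero_mul, AddChar.map_zero_eq_one,
        if_true, LinearMap.zero_apply, Module.End.one_apply] at this
      exact (smul_ne_zero hN0 hv0) this.symm
    · intro x
      rw [hP]
      split_ifs with h
      · have h1 := hψinv _ _ h
        rw [mul_one] at h1
        obtain ⟨c, hc⟩ := hstabz x h1
        exact ⟨2 ^ n * c, by rw [hc, mul_smul]⟩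
      · exact ⟨0, by simp⟩
  -- the order of ζ
  obtain ⟨k, hkn, hk⟩ := (Nat.dvd_prime_pow Nat.prime_two).1 (orderOf_dvd_of_pow_eq_one hζN)
  have hprim : IsPrimitiveRoot ζ (2 ^ k) := hk ▸ IsPrimitiveRoot.orderOf ζ
  have hψmod : ∀ a b : ℕ, ψ (a : ZMod (2 ^ n)) = ψ (b : ZMod (2 ^ n)) ↔ a ≡ b [MOD 2 ^ k] := by
    intro a b
    rw [hψnat, hψnat, Nat.modEq_iff_dvd]
    have hζ0 : ζ ≠ 0 := hprim.ne_zero (by positivity)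
    have := hprim.zpow_eq_one_iff_dvd ((b : ℤ) - a)
    push_cast at this ⊢
    rw [← this, zpow_sub₀ hζ0, zpow_natCast, zpow_natCast, div_eq_one_iff_eq (pow_ne_zero _ hζ0),
      eq_comm]
  have hk2 : 2 ≤ k := by
    by_contra! hlt
    apply hζK
    have : ζ ^ 2 = 1 := by
      rw [← orderOf_dvd_iff_pow_eq_one, hk]
      have : k ≤ 1 := by omega
      simpa using pow_dvd_pow 2 this
    rcases (mul_self_eq_one_iff.1 ((sq ζ).symm.trans this)) with h | h
    · rw [h]; exact K.one_mem
    · rw [h]; exact K.neg_mem K.one_mem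
  obtain ⟨r, rfl⟩ : ∃ r, k = r + 2 := ⟨k - 2, by omega⟩
  let five : (ZMod (2 ^ n))ˣ := ZMod.unitOfCoprime 5 (Nat.Coprime.pow_right n (by norm_num))
  have hfive : ∀ m : ℕ, ((five ^ m : (ZMod (2 ^ n))ˣ) : ZMod (2 ^ n)) = ((5 ^ m : ℕ) : ZMod (2 ^ n)) := by
    intro m
    rw [Units.val_pow_eq_pow_val]; simp [five]
  obtain ⟨ω, hω⟩ := hscal (five ^ (2 ^ r)) (by
    rw [hfive]
    obtain ⟨c, _, hc⟩ := nt1 r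
    have := (hψmod (5 ^ 2 ^ r) 1).2 (by
      rw [hc]; simp)
    simpa using this)
  have hωK : ω ∈ K := by
    have h1 := hK (s (five ^ (2 ^ r)))
    rw [hω, map_smul, LinearMap.trace_one, smul_eq_mul] at h1
    have h2 : (Module.finrank ℂ V : ℂ) ∈ K := natCast_mem K _
    have h3 : (Module.finrank ℂ V : ℂ) ≠ 0 := by
      exact_mod_cast (Module.finrank_pos (R := ℂ) (M := V)).ne'
    have h4 := K.div_mem h1 h2
    rwa [mul_div_cancel_right₀ _ h3] at h4
  have hωv : ρ (s (five ^ (2 ^ r))) v₀ = ω • v₀ := by rw [hω]; rfl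
  have hω1 : ω ^ (2 ^ (n - 1)) = 1 := by
    have h1 : (five ^ (2 ^ r)) ^ (2 ^ (n - 1)) = 1 := by
      have := ZMod.pow_totient (five ^ (2 ^ r))
      rwa [Nat.totient_prime_pow Nat.prime_two (by omega), Nat.add_one_sub_one, mul_one] at this
    have h2 : ρ (s (five ^ (2 ^ r))) ^ (2 ^ (n - 1)) = 1 := by
      rw [← map_pow, ← map_pow, h1, map_one, map_one]
    rw [hω, smul_pow, one_pow] at h2
    have h3 := LinearMap.congr_fun h2 v₀
    have h4 : ω ^ (2 ^ (n - 1)) • v₀ = (1 : ℂ) • v₀ := by rw [one_smul]; exact h3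
    exact smul_left_injective ℂ hv0 h4
  obtain ⟨j, -, hj⟩ := (Nat.dvd_prime_pow Nat.prime_two).1 (orderOf_dvd_of_pow_eq_one hω1)
  have hωj : ω ^ (2 ^ j) = 1 := hj ▸ pow_orderOf_eq_one ω
  have hωprim : IsPrimitiveRoot ω (2 ^ j) := hj ▸ IsPrimitiveRoot.orderOf ω
  have hhpow : ∀ (a : ZMod (2 ^ n)) (u : (ZMod (2 ^ n))ˣ) (i : ℕ),
      (t a * s u) ^ i = t (a * ∑ l ∈ Finset.range i, (u : ZMod (2 ^ n)) ^ l) * s (u ^ i) := by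
    intro a u i
    induction i with
    | zero => simp [ht0]
    | succ i ih =>
      rw [pow_succ, ih, Finset.sum_range_succ, mul_add, htadd, pow_succ u, map_mul]
      have := hconj (s (u ^ i)) a
      rw [hπs, Units.val_pow_eq_pow_val, mul_comm _ a] at this
      simp only [mul_assoc]
      rw [← mul_assoc (s (u ^ i)), this]
      simp only [mul_assoc]
  -- the key element h
  have hkey : ∀ (e f a₀ : ℕ), e + f = r →
      ρ ((t (a₀ : ZMod (2 ^ n)) * s (five ^ (2 ^ e))) ^ (2 ^ f)) v₀ =
        (ζ ^ (a₀ * ∑ l ∈ Finset.range (2 ^ f), (5 ^ (2 ^ e)) ^ l) * ω) • v₀ := by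
    intro e f a₀ hef
    rw [hhpow, map_mul, Module.End.mul_apply, ← pow_mul, ← pow_add, hef, hωv, map_smul, hTv,
      smul_smul, mul_comm, hfive, ← hψnat]
    push_cast
    rfl
  have hEgen : ∀ (h : G) (M : ℕ), ρ (h ^ M) v₀ = v₀ → ∀ i : ℕ,
      (∑ l ∈ Finset.range M, ρ h ^ l) ((ρ h ^ i) v₀) = (∑ l ∈ Finset.range M, ρ h ^ l) v₀ := by
    intro h M hM i
    induction i with
    | zero => simp
    | succ i ih =>
      rw [← ih]
      have h1 := geom_sum_mul (ρ h) M
      have h2 : (∑ l ∈ Finset.range M, ρ h ^ l) * (ρ h) ^ (i + 1) -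
          (∑ l ∈ Finset.range M, ρ h ^ l) * (ρ h) ^ i = ρ h ^ i * (ρ h ^ M - 1) := by
        rw [pow_succ', ← mul_assoc]
        have : (∑ l ∈ Finset.range M, ρ h ^ l) * (ρ h) ^ i =
          (∑ l ∈ Finset.range M, ρ h ^ l) * 1 * (ρ h) ^ i := by simp
        rw [this, ← sub_mul, ← mul_sub, h1]
        exact (((Commute.refl (ρ h)).pow_left M).sub_left (Commute.one_left _)).pow_right i
      have h3 := LinearMap.congr_fun h2 v₀
      simp only [LinearMap.sub_apply, Module.End.mul_apply, Module.End.one_apply] at h3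
      rw [← map_pow ρ h M, hM, sub_self, map_zero] at h3
      exact sub_eq_zero.1 h3
  have hπh : ∀ (a : ZMod (2 ^ n)) (e i : ℕ), ((π ((t a * s (five ^ (2 ^ e))) ^ i) : (ZMod (2 ^ n))ˣ) :
      ZMod (2 ^ n)) = ((5 ^ (2 ^ e * i) : ℕ) : ZMod (2 ^ n)) := by
    intro a e i
    rw [map_pow, map_mul, hπs, hπt, one_mul, ← pow_mul, hfive]
  have hmulspan : ∀ x, ∀ A ∈ Submodule.span K (Set.range fun g => ρ g),
      ρ x * A ∈ Submodule.span K (Set.range fun g => ρ g) := by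
    intro x A hA
    induction hA using Submodule.span_induction with
    | mem A hA =>
      obtain ⟨y, rfl⟩ := hA
      exact Submodule.subset_span ⟨x * y, by simp⟩
    | zero => simp
    | add A B _ _ hA hB => rw [mul_add]; exact Submodule.add_mem _ hA hB
    | smul a A _ hA =>
      have : ρ x * (a • A) = a • (ρ x * A) := by
        ext y; simp [IntermediateField.smul_def]
      rw [this]; exact Submodule.smul_mem _ _ hA
  have hEspan : ∀ (h : G) (M : ℕ), ∀ A ∈ Submodule.span K (Set.range fun g => ρ g),
      (∑ l ∈ Finset.range M, ρ h ^ l) * A ∈ Submodule.span K (Set.range fun g => ρ g) := by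
    intro h M A hA
    rw [Finset.sum_mul]
    refine Submodule.sum_mem _ fun i _ => ?_
    rw [← map_pow]; exact hmulspan _ _ hA
  rcases Nat.lt_or_ge j 2 with hj2 | hj2
  · -- case 1
    obtain ⟨c, hc, hcs⟩ := nt4 0 r
    have hω2 : ω = 1 ∨ ω = -1 := by
      have : ω ^ 2 = 1 := by
        rw [← orderOf_dvd_iff_pow_eq_one, hj]
        have : j ≤ 1 := by omega
        simpa using pow_dvd_pow 2 this
      exact mul_self_eq_one_iff.1 ((sq ω).symm.trans this)
    obtain ⟨a, ha⟩ : ∃ a : ℕ, ζ ^ (2 * a * (2 ^ r * c)) * ω = 1 := by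
      rcases hω2 with h | h
      · exact ⟨0, by simp [h]⟩
      · refine ⟨1, ?_⟩
        have h1 : IsPrimitiveRoot (ζ ^ (2 * 2 ^ r)) 2 := hprim.pow (by positivity) (by ring)
        have h2 : ζ ^ (2 * 2 ^ r) = -1 := h1.eq_neg_one_of_two_right
        rw [show 2 * 1 * (2 ^ r * c) = (2 * 2 ^ r) * c by ring, pow_mul, h2, hc.neg_one_pow, h]
        norm_num
    have hh := hkey 0 r (2 * a) (by simp)
    rw [hcs, ha, one_smul] at hh
    have hπi := hπh ((2 * a : ℕ) : ZMod (2 ^ n)) 0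
    set h : G := t ((2 * a : ℕ) : ZMod (2 ^ n)) * s (five ^ (2 ^ 0)) with hhdef
    set τ : G := t (-(a : ZMod (2 ^ n))) * s (-1) with hτdef
    have hττ : τ * τ = 1 := by
      have e1 := hconj (s (-1)) (-(a : ZMod (2 ^ n)))
      rw [hπs] at e1
      rw [hτdef, mul_assoc, ← mul_assoc (s (-1)), e1, mul_assoc, ← map_mul, ← mul_assoc, ← htadd]
      simp [ht0]
    have hhτ : h * τ = τ * h := by
      have e1 := hconj (s (-1)) ((2 * a : ℕ) : ZMod (2 ^ n))
      have e2 := hconj (s (five ^ (2 ^ 0))) (-(a : ZMod (2 ^ n)))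
      rw [hπs] at e1 e2
      rw [hτdef, hhdef, mul_assoc, ← mul_assoc (s (five ^ (2 ^ 0))), e2, mul_assoc, ← map_mul,
        ← mul_assoc, ← htadd, mul_assoc, ← mul_assoc (s (-1)), e1, mul_assoc, ← map_mul,
        ← mul_assoc, ← htadd, mul_comm (five ^ (2 ^ 0)), hfive]
      congr 2
      push_cast
      ring
    have hπτ : ((π τ : (ZMod (2 ^ n))ˣ) : ZMod (2 ^ n)) = -1 := by
      rw [hτdef, map_mul, hπt, hπs]; simp
    let E : V →ₗ[ℂ] V := ∑ l ∈ Finset.range (2 ^ r), ρ h ^ l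
    have hEdef : E = ∑ l ∈ Finset.range (2 ^ r), ρ h ^ l := rfl
    have hE : ∀ i : ℕ, E ((ρ h ^ i) v₀) = E v₀ := hEgen h (2 ^ r) hh
    have hcm : Commute (ρ h) (ρ τ) := by
      change ρ h * ρ τ = ρ τ * ρ h
      rw [← map_mul, hhτ, map_mul]
    have hEτ : Commute E (ρ τ) := Commute.sum_left _ _ _ fun i _ => hcm.pow_left i
    have hEc : Commute E (1 + ρ τ) := (Commute.one_right _).add_right hEτ
    have hFh : ∀ i : ℕ, (E * (1 + ρ τ)) ((ρ h ^ i) v₀) = (E * (1 + ρ τ)) v₀ := by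
      intro i
      rw [hEc.eq, Module.End.mul_apply, hE, Module.End.mul_apply]
    have hFτ : (E * (1 + ρ τ)) * ρ τ = E * (1 + ρ τ) := by
      rw [mul_assoc, add_mul, ← map_mul, hττ, map_one, one_mul, add_comm]
    have hFhτ : ∀ i : ℕ, (E * (1 + ρ τ)) (ρ (h ^ i * τ) v₀) = (E * (1 + ρ τ)) v₀ := by
      intro i
      have hcc : ρ (h ^ i * τ) = ρ τ * ρ h ^ i := by
        rw [map_mul, map_pow]; exact hcm.pow_left i
      rw [hcc, ← Module.End.mul_apply, ← mul_assoc, hFτ, Module.End.mul_apply, hFh]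
    refine ⟨E * (1 + ρ τ), (E * (1 + ρ τ)) v₀, hEspan _ _ _ ?_, ?_, hrank _ _ ?_⟩
    · exact Submodule.add_mem _ (Submodule.subset_span ⟨1, by simp⟩) (Submodule.subset_span ⟨τ, rfl⟩)
    · intro hF0
      have h1 := LinearMap.congr_fun hF0 v₀
      refine hNV (ℕ × ℕ) (Finset.range (2 ^ r) ×ˢ Finset.range 2) (fun p => h ^ p.1 * τ ^ p.2)
        (0, 0) (by simp) (by simp) ?_ ?_
      · rintro ⟨i, e⟩ hie hne hst
        simp only [Finset.mem_product, Finset.mem_range] at hie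
        obtain ⟨hi, he⟩ := hie
        have h2 := hπi i
        have he' : e = 0 ∨ e = 1 := by omega
        rcases he' with rfl | rfl
        · simp only [pow_zero, mul_one] at hst
          rw [h2] at hst
          have h3 := (hψmod (5 ^ (2 ^ 0 * i)) 1).1 (by rw [hst, Nat.cast_one])
          have h4 := nt3 0 r i (by simpa using h3) hi
          exact hne (by rw [h4])
        · simp only [pow_one] at hst
          rw [map_mul, Units.val_mul, h2, hπτ, mul_neg_one] at hst
          have h3 : ψ ((5 ^ (2 ^ 0 * i) + 1 : ℕ) : ZMod (2 ^ n)) = ψ ((0 : ℕ) : ZMod (2 ^ n)) := by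
            rw [Nat.cast_add, AddChar.map_add_eq_mul, Nat.cast_one, ← hst,
              ← AddChar.map_add_eq_mul]
            simp
          have h4 := (hψmod _ _).1 h3
          have h5 : 5 ^ (2 ^ 0 * i) + 1 ≡ 0 [MOD 4] := h4.of_dvd ⟨2 ^ r, by ring⟩
          have h6 : 5 ^ (2 ^ 0 * i) ≡ 1 [MOD 4] := by
            have h8 := (show 5 ≡ 1 [MOD 4] by decide).pow (2 ^ 0 * i)
            rwa [one_pow] at h8
          have h7 := (h6.add_right 1).symm.trans h5
          revert h7; decide
      · rw [Finset.sum_product]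
        simp only [Finset.sum_range_succ, Finset.sum_range_zero, zero_add, pow_zero, pow_one, mul_one]
        rw [hEdef, Finset.sum_mul, LinearMap.sum_apply] at h1
        rw [← LinearMap.zero_apply (σ₁₂ := RingHom.id ℂ) (M₂ := V) v₀, ← h1]
        refine Finset.sum_congr rfl fun i _ => ?_
        simp
    · intro x
      have hxc : (π x : ZMod (2 ^ n)).val.Coprime (2 ^ n) := ZMod.val_coe_unit_coprime _
      have hodd : Odd (π x : ZMod (2 ^ n)).val := by
        rw [← Nat.coprime_two_right]
        exact hxc.coprime_dvd_right (dvd_pow_self 2 (by omega))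
      have hlt : (π x : ZMod (2 ^ n)).val < 2 ^ n := ZMod.val_lt _
      have hcast := ZMod.natCast_zmod_val (π x : ZMod (2 ^ n))
      set w := (π x : ZMod (2 ^ n)).val with hw
      have h4n : 4 ∣ 2 ^ n := pow_dvd_pow 2 (show 2 ≤ n by omega)
      have hcases : w ≡ 1 [MOD 4] ∨ 2 ^ n - w ≡ 1 [MOD 4] := by
        obtain ⟨y, hy⟩ := hodd
        obtain ⟨z, hz⟩ := h4n
        simp only [Nat.ModEq]
        omega
      rcases hcases with h1 | h1
      · obtain ⟨i, hi⟩ := nt2 0 r w (by simpa using h1)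
        obtain ⟨d, hd⟩ := hline x (h ^ i) (by
          rw [hπi i, ← hcast, eq_comm]
          exact (hψmod _ _).2 (by simpa using hi))
        exact ⟨d, by rw [hd, map_smul, map_pow, hFh]⟩
      · obtain ⟨i, hi⟩ := nt2 0 r (2 ^ n - w) (by simpa using h1)
        obtain ⟨d, hd⟩ := hline x (h ^ i * τ) (by
          have h2 := (hψmod (5 ^ (2 ^ 0 * i)) (2 ^ n - w)).2 (by simpa using hi)
          have h3 := hψcongr (-1) _ _ h2
          rw [map_mul, Units.val_mul, hπi i, hπτ, ← hcast, mul_comm, h3]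
          congr 1
          rw [Nat.cast_sub hlt.le, ZMod.natCast_self]; ring)
        exact ⟨d, by rw [hd, map_smul, hFhτ]⟩
  · -- case 2
    have hjr : j < r + 2 := by
      by_contra! hle
      apply hζK
      have h1 : ζ ^ (2 ^ j) = 1 := (hprim.pow_eq_one_iff_dvd _).2 (pow_dvd_pow 2 hle)
      obtain ⟨i, -, hi⟩ := hωprim.eq_pow_of_pow_eq_one h1
      rw [← hi]; exact pow_mem hωK _
    obtain ⟨e, rfl⟩ : ∃ e, j = e + 2 := ⟨j - 2, by omega⟩
    obtain ⟨f, hf⟩ : ∃ f, e + f = r := ⟨r - e, by omega⟩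
    obtain ⟨c, hc, hcs⟩ := nt4 e f
    have hη : IsPrimitiveRoot (ζ ^ (2 ^ f)) (2 ^ (e + 2)) :=
      hprim.pow (by positivity) (by rw [← hf]; ring)
    have hη' : IsPrimitiveRoot ((ζ ^ (2 ^ f)) ^ c) (2 ^ (e + 2)) :=
      hη.pow_of_coprime c ((Nat.coprime_two_right.2 hc).pow_right _)
    obtain ⟨a, -, ha⟩ := hη'.eq_pow_of_pow_eq_one (ξ := ω⁻¹) (by rw [inv_pow, hωj, inv_one])
    have hω0 : ω ≠ 0 := hωprim.ne_zero (by positivity)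
    have hh := hkey e f a hf
    rw [hcs, show a * (2 ^ f * c) = 2 ^ f * c * a by ring, pow_mul, pow_mul, ha,
      inv_mul_cancel₀ hω0, one_smul] at hh
    have hπi := hπh (a : ZMod (2 ^ n)) e
    set h : G := t (a : ZMod (2 ^ n)) * s (five ^ (2 ^ e)) with hhdef
    let E : V →ₗ[ℂ] V := ∑ l ∈ Finset.range (2 ^ f), ρ h ^ l
    have hEdef : E = ∑ l ∈ Finset.range (2 ^ f), ρ h ^ l := rfl
    have hE : ∀ i : ℕ, E ((ρ h ^ i) v₀) = E v₀ := hEgen h (2 ^ f) hh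
    have hdK : ψ ((2 ^ f : ℕ) : ZMod (2 ^ n)) ∈ K := by
      rw [hψnat]
      obtain ⟨i, -, hi⟩ := hωprim.eq_pow_of_pow_eq_one hη.pow_eq_one
      rw [← hi]; exact pow_mem hωK _
    refine ⟨E * P ((2 ^ f : ℕ) : ZMod (2 ^ n)), E v₀, hEspan _ _ _ (hPK _ hdK), ?_, hrank _ _ ?_⟩
    · intro hF0
      have h1 := LinearMap.congr_fun hF0 (ρ 1 v₀)
      rw [Module.End.mul_apply, hP] at h1
      simp only [map_one, inv_one, Units.val_one, sub_self, zero_mul, AddChar.map_zero_eq_one,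
        if_true, LinearMap.zero_apply, Module.End.one_apply, map_smul] at h1
      have h2 := (smul_eq_zero.1 h1).resolve_left hN0
      refine hNV ℕ (Finset.range (2 ^ f)) (fun i => h ^ i) 0 (by simp) (by simp) ?_ ?_
      · intro i hi hne hst
        rw [hπi i] at hst
        have h3 := (hψmod (5 ^ (2 ^ e * i)) 1).1 (by rw [hst, Nat.cast_one])
        exact hne (nt3 e f i (by rw [hf]; exact h3) (Finset.mem_range.1 hi))
      · rw [hEdef, LinearMap.sum_apply] at h2
        simpa using h2
    · intro x
      rw [Module.End.mul_apply, hP]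
      split_ifs with h1
      · have h2 := hψinv _ _ h1
        have hcast := ZMod.natCast_zmod_val (π x : ZMod (2 ^ n))
        set w := (π x : ZMod (2 ^ n)).val with hw
        rw [← hcast, ← Nat.cast_mul, hψmod] at h2
        have h3 : w ≡ 1 [MOD 2 ^ (e + 2)] := by
          have h4 : 2 ^ f * w ≡ 2 ^ f * 1 [MOD 2 ^ f * 2 ^ (e + 2)] := by
            have : 2 ^ (r + 2) = 2 ^ f * 2 ^ (e + 2) := by rw [← hf]; ring
            rw [← this, mul_comm, mul_one]; exact h2
          exact Nat.ModEq.mul_left_cancel' (by positivity) h4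
        obtain ⟨i, hi⟩ := nt2 e f w h3
        rw [hf] at hi
        obtain ⟨d, hd⟩ := hline x (h ^ i) (by
          rw [hπi i, ← hcast, eq_comm]
          exact (hψmod _ _).2 hi)
        exact ⟨2 ^ n * d, by rw [map_smul, hd, map_smul, map_pow, hE, smul_smul]⟩
      · exact ⟨0, by simp⟩

/-- For `n ≥ 3`, every irreducible complex character of `Hol(C_{2^n})` has Schur index
`1` over `ℚ`: it is afforded by a representation realizable over its character field
`ℚ(χ)`. -/
theorem stmt12 (n : ℕ) (hn : 3 ≤ n)
    (V : FDRep ℂ (Hol (2 ^ n))) (hV : Simple V) :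
    ∃ W : FDRep (IntermediateField.adjoin ℚ (Set.range V.character)) (Hol (2 ^ n)),
      ∀ g : Hol (2 ^ n), (W.character g : ℂ) = V.character g := by
  classical
  have : NeZero (2 ^ n) := ⟨by positivity⟩
  have : Fintype (Cyc (2 ^ n)) := inferInstanceAs (Fintype (ZMod (2 ^ n)))
  have : Finite (MulAut (Cyc (2 ^ n))) :=
    Finite.of_injective (fun f : MulAut (Cyc (2 ^ n)) => (f : Cyc (2 ^ n) → Cyc (2 ^ n)))
      DFunLike.coe_injective
  have : Finite (Hol (2 ^ n)) := Finite.of_equiv _ SemidirectProduct.equivProd.symm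
  have : Fintype (Hol (2 ^ n)) := Fintype.ofFinite _
  have hirr := irr_of_simple_s12 V hV
  have hnt : Nontrivial V := by
    by_contra h
    rw [not_nontrivial_iff_subsingleton] at h
    apply Simple.not_isZero V
    rw [Limits.IsZero.iff_id_eq_zero]
    ext x
    exact Subsingleton.elim (α := V) _ _
  have hK : ∀ g, LinearMap.trace ℂ V (V.ρ g) ∈
      IntermediateField.adjoin ℚ (Set.range V.character) :=
    fun g => IntermediateField.subset_adjoin _ _ ⟨g, rfl⟩
  let au : (ZMod (2 ^ n))ˣ →* MulAut (Cyc (2 ^ n)) :=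
    { toFun := fun u => AddEquiv.toMultiplicative (DistribMulAction.toAddEquiv (ZMod (2 ^ n)) u)
      map_one' := by ext x; simp
      map_mul' := fun u v => by ext x; simp [mul_smul] }
  have hau : ∀ u a, au u (Multiplicative.ofAdd a) = Multiplicative.ofAdd ((u : ZMod (2 ^ n)) * a) :=
    fun u a => rfl
  have hlin : ∀ (f : MulAut (Cyc (2 ^ n))) (a : ZMod (2 ^ n)),
      (f (Multiplicative.ofAdd a)).toAdd = (f (Multiplicative.ofAdd 1)).toAdd * a := by
    intro f a
    have h1 : Multiplicative.ofAdd a = (Multiplicative.ofAdd (1 : ZMod (2 ^ n))) ^ a.val := by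
      rw [← ofAdd_nsmul, nsmul_one, ZMod.natCast_zmod_val]
    rw [h1, map_pow, toAdd_pow, nsmul_eq_mul, ZMod.natCast_zmod_val, mul_comm]
  let ua : MulAut (Cyc (2 ^ n)) →* (ZMod (2 ^ n))ˣ := MonoidHom.toHomUnits
    { toFun := fun f => (f (Multiplicative.ofAdd 1)).toAdd
      map_one' := rfl
      map_mul' := fun f g => by
        rw [MulAut.mul_apply, ← hlin, ofAdd_toAdd] }
  have hua : ∀ f a, f (Multiplicative.ofAdd a) = Multiplicative.ofAdd ((ua f : ZMod (2 ^ n)) * a) := by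
    intro f a
    apply Multiplicative.toAdd.injective
    exact hlin f a
  have huaau : ∀ u, ua (au u) = u := by
    intro u
    apply Units.ext
    exact mul_one _
  have hauua : ∀ f, au (ua f) = f := by
    intro f
    apply MulEquiv.ext
    intro a
    exact (hua f a.toAdd).symm
  obtain ⟨F, v₁, hF, hF0, hr⟩ := lemB V.ρ hirr _ hK n
    (fun a => SemidirectProduct.inl (Multiplicative.ofAdd a))
    (SemidirectProduct.inr.comp au) (ua.comp SemidirectProduct.rightHom)
    (fun a b => by rw [ofAdd_add, map_mul])
    (fun u => by simp [huaau])
    (fun a => by simp)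
    (fun x a => by
      apply SemidirectProduct.ext
      · simp only [SemidirectProduct.mul_left, SemidirectProduct.left_inl,
          SemidirectProduct.right_inl, map_one, MonoidHom.id_apply, MonoidHom.comp_apply,
          SemidirectProduct.rightHom_eq_right, MulAut.one_apply]
        rw [hua, mul_comm]
      · simp)
    (fun x => ⟨x.left.toAdd, by
      simp only [MonoidHom.comp_apply, SemidirectProduct.rightHom_eq_right, hauua, ofAdd_toAdd]
      exact (SemidirectProduct.inl_left_mul_inr_right x).symm⟩)
  exact lemA V.ρ hirr _ hK F hF hF0 v₁ hr
end

section
/- For p an odd prime and n ≥ 1, the number of inequivalent irreducible rational representations of Hol(C_{p^n}) equals d + n(n+1)/2, where d is the number of positive divisors of φ(p^n) = p^{n-1}(p−1). -/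
open CategoryTheory

section Part1

variable {G : Type} [Group G]

/-- The underlying linear map of a morphism. -/
def lin {V W : FDRep ℚ G} (f : V ⟶ W) : V →ₗ[ℚ] W := f.hom.hom.hom

lemma lin_comm {V W : FDRep ℚ G} (f : V ⟶ W) (g : G) (v : V) :
    lin f (V.ρ g v) = W.ρ g (lin f v) :=
  ConcreteCategory.congr_hom ((forget (FGModuleCat ℚ)).congr_map (f.comm g)) v

/-- Morphism from an equivariant linear map. -/
def mkHom {V W : FDRep ℚ G} (f : V →ₗ[ℚ] W) (h : ∀ g v, f (V.ρ g v) = W.ρ g (f v)) : V ⟶ W :=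
  ⟨InducedCategory.homMk (ModuleCat.ofHom f), fun g ↦ by
    ext1
    ext v
    exact h g v⟩

lemma lin_mkHom {V W : FDRep ℚ G} (f : V →ₗ[ℚ] W) (h : ∀ g v, f (V.ρ g v) = W.ρ g (f v)) :
    lin (mkHom f h) = f := rfl

lemma lin_injective {V W : FDRep ℚ G} {f g : V ⟶ W} (h : lin f = lin g) : f = g := by
  ext1
  ext1
  ext v
  exact LinearMap.congr_fun h v

lemma lin_comp {U V W : FDRep ℚ G} (f : U ⟶ V) (g : V ⟶ W) : lin (f ≫ g) = lin g ∘ₗ lin f := rfl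
lemma lin_id {V : FDRep ℚ G} : lin (𝟙 V) = LinearMap.id := rfl
lemma lin_zero {V W : FDRep ℚ G} : lin (0 : V ⟶ W) = 0 := rfl

/-- Irreducibility, concretely. -/
def Irr {V : Type*} [AddCommGroup V] [Module ℚ V] (ρ : Representation ℚ G V) : Prop :=
  Nontrivial V ∧ ∀ p : Submodule ℚ V, (∀ g v, v ∈ p → ρ g v ∈ p) → p = ⊥ ∨ p = ⊤

lemma irr_of_simple_s13 (W : FDRep ℚ G) [Simple W] : Irr W.ρ := by
  constructor
  · by_contra h
    rw [not_nontrivial_iff_subsingleton] at h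
    apply id_nonzero W
    apply lin_injective
    ext v
    exact Subsingleton.elim _ _
  · intro p hp
    let σ : Subrepresentation W.ρ := ⟨p, fun g v hv => hp g v hv⟩
    let ι : FDRep.of σ.toRepresentation ⟶ W := mkHom p.subtype (fun g v => rfl)
    have hι : Mono ι := by
      constructor
      intro Z f g hfg
      apply lin_injective
      ext v
      have := congrArg (fun k => lin k v) hfg
      exact this
    by_cases h0 : ι = 0
    · left
      rw [eq_bot_iff]
      intro v hv
      have := LinearMap.congr_fun (congrArg lin h0) (⟨v, hv⟩ : p)
      exact this
    · right
      have hiso : IsIso ι := isIso_of_mono_of_nonzero h0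
      rw [eq_top_iff]
      intro v _
      have h1 : lin (inv ι ≫ ι) v = v := by rw [IsIso.inv_hom_id]; rfl
      rw [← h1]
      exact (lin (inv ι) v).2

lemma simple_of_irr (W : FDRep ℚ G) (h : Irr W.ρ) : Simple W := by
  obtain ⟨hn, h⟩ := h
  refine ⟨fun {Y} f hf => ⟨?_, ?_⟩⟩
  · intro hi h0
    subst h0
    obtain ⟨v, hv⟩ := exists_ne (0 : W)
    apply hv
    have h1 : lin (inv (0 : Y ⟶ W) ≫ 0) v = v := by rw [IsIso.inv_hom_id]; rfl
    rw [← h1, Limits.comp_zero]; rfl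
  · intro h0
    have hr := h (LinearMap.range (lin f)) (by
      rintro g _ ⟨v, rfl⟩
      exact ⟨Y.ρ g v, lin_comm f g v⟩)
    rcases hr with hr | hr
    · exfalso; apply h0
      apply lin_injective
      rw [LinearMap.range_eq_bot] at hr
      exact hr
    · have he : Epi f := by
        constructor
        intro Z a b hab
        apply lin_injective
        ext v
        obtain ⟨u, rfl⟩ := LinearMap.range_eq_top.mp hr v
        exact congrArg (fun k => lin k u) hab
      exact isIso_of_mono_of_epi f

/-- Existence of an irreducible subrepresentation. -/
lemma exists_simple_sub {V : Type} [AddCommGroup V] [Module ℚ V] [Module.Finite ℚ V]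
    (ρ : Representation ℚ G V) (p : Submodule ℚ V) (hp : ∀ g v, v ∈ p → ρ g v ∈ p) (h0 : p ≠ ⊥) :
    ∃ W : FDRep ℚ G, Simple W ∧ ∃ f : W →ₗ[ℚ] V, Function.Injective f ∧
      (∀ g w, f (W.ρ g w) = ρ g (f w)) ∧ ∀ w, f w ∈ p := by
  have hwf := (inferInstance : WellFoundedLT (Submodule ℚ V)).wf
  let S : Set (Submodule ℚ V) := {q | (∀ g v, v ∈ q → ρ g v ∈ q) ∧ q ≠ ⊥ ∧ q ≤ p}
  obtain ⟨q, ⟨hq, hq0, hqp⟩, hmin⟩ := hwf.has_min S ⟨p, hp, h0, le_rfl⟩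
  let σ : Subrepresentation ρ := ⟨q, fun g v hv => hq g v hv⟩
  refine ⟨FDRep.of σ.toRepresentation, ?_, q.subtype, q.injective_subtype, fun g w => rfl,
    fun w => hqp w.2⟩
  apply simple_of_irr
  refine ⟨Submodule.nontrivial_iff_ne_bot.mpr hq0, ?_⟩
  intro r hr
  change Submodule ℚ q at r
  by_cases hr0 : r = ⊥
  · exact Or.inl hr0
  right
  have hm : r.map q.subtype ∈ S := by
    refine ⟨?_, ?_, ?_⟩
    · rintro g _ ⟨v, hv, rfl⟩
      exact ⟨_, hr g v hv, rfl⟩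
    · intro hb
      apply hr0
      apply Submodule.map_injective_of_injective q.injective_subtype
      rw [hb, Submodule.map_bot]
    · exact (Submodule.map_subtype_le q r).trans hqp
  have h1 := hmin _ hm
  have h2 : r.map q.subtype = q := by
    by_contra hne
    exact h1 (lt_of_le_of_ne (Submodule.map_subtype_le q r) hne)
  apply Submodule.map_injective_of_injective q.injective_subtype
  rw [h2]; simp

lemma iso_of_inner_ne_zero [Fintype G] (V W : FDRep ℚ G) [Simple V] [Simple W]
    (h : ∑ g : G, W.character g * V.character g⁻¹ ≠ 0) : Nonempty (V ≅ W) := by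
  have hc : (Nat.card G : ℚ) ≠ 0 := by simp
  have := invertibleOfNonzero hc
  have h1 := FDRep.scalar_product_char_eq_finrank_equivariant V W
  by_cases hf : ∃ f : V ⟶ W, f ≠ 0
  · obtain ⟨f, hf⟩ := hf
    have := isIso_of_hom_simple hf
    exact ⟨asIso f⟩
  · push Not at hf
    have : Subsingleton (V ⟶ W) := ⟨fun a b => by rw [hf a, hf b]⟩
    rw [Module.finrank_zero_of_subsingleton] at h1
    simp [h] at h1

end Part1
section Part2

variable {q : ℕ}

/-- The automorphism of the cyclic group given by a unit. -/
def autU (u : (ZMod q)ˣ) : MulAut (Cyc q) where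
  toFun x := Multiplicative.ofAdd ((u : ZMod q) * x.toAdd)
  invFun x := Multiplicative.ofAdd (((u⁻¹ : (ZMod q)ˣ) : ZMod q) * x.toAdd)
  left_inv x := by simp
  right_inv x := by simp
  map_mul' x y := by simp [mul_add]

/-- The element of the holomorph with coordinates `t, u`. -/
def el (t : ZMod q) (u : (ZMod q)ˣ) : Hol q := ⟨Multiplicative.ofAdd t, autU u⟩

lemma el_mul (t s : ZMod q) (u v : (ZMod q)ˣ) :
    el t u * el s v = el (t + (u : ZMod q) * s) (u * v) := by
  apply SemidirectProduct.ext
  · rfl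
  · ext x
    simp [el, autU, mul_assoc]

lemma el_one : el (0 : ZMod q) 1 = 1 := by
  apply SemidirectProduct.ext
  · rfl
  · ext x
    simp [el, autU]

lemma el_inv (t : ZMod q) (u : (ZMod q)ˣ) :
    (el t u)⁻¹ = el (-((u⁻¹ : (ZMod q)ˣ) : ZMod q) * t) u⁻¹ := by
  rw [inv_eq_iff_mul_eq_one, el_mul, ← el_one]
  congr 1 <;> simp

lemma el_bij : Function.Bijective (fun x : ZMod q × (ZMod q)ˣ => el x.1 x.2) := by
  constructor
  · rintro ⟨t, u⟩ ⟨s, v⟩ h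
    have h1 := congrArg SemidirectProduct.left h
    have h2 := congrArg SemidirectProduct.right h
    have h3 : t = s := h1
    have h4 := congrArg (fun a : MulAut (Cyc q) => (a (Multiplicative.ofAdd 1)).toAdd) h2
    have h5 : (u : ZMod q) = v := by simpa [el, autU] using h4
    rw [h3, Units.ext h5]
  · rintro ⟨x, a⟩
    have key : ∀ (b : MulAut (Cyc q)) (y : ZMod q),
        (b (Multiplicative.ofAdd y)).toAdd = (b (Multiplicative.ofAdd 1)).toAdd * y := by
      intro b y
      obtain ⟨k, rfl⟩ := ZMod.intCast_surjective y
      have : (Multiplicative.ofAdd (k : ZMod q)) = (Multiplicative.ofAdd (1 : ZMod q)) ^ k := by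
        rw [← ofAdd_zsmul]; simp
      rw [this, map_zpow, toAdd_zpow, zsmul_eq_mul, mul_comm]
    have h1 : (a (Multiplicative.ofAdd 1)).toAdd * (a⁻¹ (Multiplicative.ofAdd 1)).toAdd = 1 := by
      rw [← key]
      simp
    refine ⟨(x.toAdd, Units.mkOfMulEqOne _ _ h1), ?_⟩
    apply SemidirectProduct.ext
    · rfl
    · apply MulEquiv.ext
      intro y
      exact (key a y.toAdd).symm

lemma exists_el (g : Hol q) : ∃ t u, g = el t u := by
  obtain ⟨⟨t, u⟩, h⟩ := el_bij.2 g
  exact ⟨t, u, h.symm⟩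

end Part2

section Part3

variable {p n : ℕ}

lemma dich (hp : p.Prime) (t : ZMod (p ^ n)) :
    ∃ (k : ℕ) (v : (ZMod (p ^ n))ˣ), t = (p : ZMod (p ^ n)) ^ k * v := by
  have : NeZero (p ^ n) := ⟨(pow_pos hp.pos n).ne'⟩
  by_cases h : t = 0
  · refine ⟨n, 1, ?_⟩
    rw [h]
    have : ((p ^ n : ℕ) : ZMod (p ^ n)) = 0 := ZMod.natCast_self _
    push_cast at this
    simp [this]
  · have hv : t.val ≠ 0 := by rwa [Ne, ZMod.val_eq_zero]
    obtain ⟨k, m, hm, hk⟩ := Nat.exists_eq_pow_mul_and_not_dvd hv p hp.ne_one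
    have hc : IsUnit ((m : ℕ) : ZMod (p ^ n)) := by
      rw [ZMod.isUnit_iff_coprime]
      exact ((Nat.Prime.coprime_iff_not_dvd hp).mpr hm).symm.pow_right n
    refine ⟨k, hc.unit, ?_⟩
    rw [← ZMod.natCast_zmod_val t, hk]
    simp

lemma unit_of_coprime (hp : p.Prime) (i : ℕ) (hi : 0 < i) (hip : i < p) :
    IsUnit ((i : ℕ) : ZMod (p ^ n)) := by
  rw [ZMod.isUnit_iff_coprime]
  apply Nat.Coprime.pow_right
  exact ((Nat.Prime.coprime_iff_not_dvd hp).mpr (Nat.not_dvd_of_pos_of_lt hi hip)).symm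

lemma unit_add (v : (ZMod (p ^ n))ˣ) (s : ZMod (p ^ n)) :
    IsUnit ((v : ZMod (p ^ n)) + p * s) := by
  apply IsNilpotent.isUnit_add_left_of_commute _ v.isUnit (Commute.all _ _)
  refine ⟨n, ?_⟩
  have : ((p ^ n : ℕ) : ZMod (p ^ n)) = 0 := ZMod.natCast_self _
  push_cast at this
  rw [mul_pow, this, zero_mul]

/-- The stabilizer of level `j`. -/
def Bj (p n j : ℕ) : Subgroup (ZMod (p ^ n))ˣ where
  carrier := {u | ∃ s : ZMod (p ^ n), (u : ZMod (p ^ n)) = 1 + (p : ZMod (p ^ n)) ^ j * s}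
  one_mem' := ⟨0, by simp⟩
  mul_mem' := by
    rintro a b ⟨s, hs⟩ ⟨t, ht⟩
    refine ⟨s + t + p ^ j * s * t, ?_⟩
    rw [Units.val_mul, hs, ht]; ring
  inv_mem' := by
    rintro a ⟨s, hs⟩
    refine ⟨-(s * (a⁻¹ : (ZMod (p ^ n))ˣ)), ?_⟩
    have h1 : (a : ZMod (p ^ n)) * (a⁻¹ : (ZMod (p ^ n))ˣ) = 1 := by simp
    rw [hs] at h1
    linear_combination h1

lemma mem_Bj {j : ℕ} (u : (ZMod (p ^ n))ˣ) :
    u ∈ Bj p n j ↔ ∃ s : ZMod (p ^ n), (u : ZMod (p ^ n)) = 1 + (p : ZMod (p ^ n)) ^ j * s :=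
  Iff.rfl

lemma Bj_eq_ker (hp : p.Prime) {j : ℕ} (hj : j ≤ n) :
    Bj p n j = (ZMod.unitsMap (pow_dvd_pow p hj)).ker := by
  have : NeZero (p ^ n) := ⟨(pow_pos hp.pos n).ne'⟩
  ext u
  rw [mem_Bj, MonoidHom.mem_ker, Units.ext_iff, ZMod.unitsMap_val, Units.val_one]
  have hz : ((p : ZMod (p ^ j))) ^ j = 0 := by
    have : ((p ^ j : ℕ) : ZMod (p ^ j)) = 0 := ZMod.natCast_self _
    push_cast at this
    exact this
  constructor
  · rintro ⟨s, hs⟩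
    have := congrArg (ZMod.castHom (pow_dvd_pow p hj) (ZMod (p ^ j))) hs
    rw [map_add, map_mul, map_pow, map_natCast, hz, map_one, zero_mul, add_zero] at this
    simpa using this
  · intro h
    have h2 : (ZMod.castHom (pow_dvd_pow p hj) (ZMod (p ^ j))) ((u : ZMod (p ^ n)) - 1) = 0 := by
      rw [map_sub, map_one, ZMod.castHom_apply, h, sub_self]
    set t : ZMod (p ^ n) := (u : ZMod (p ^ n)) - 1 with ht
    rw [← ZMod.natCast_zmod_val t, map_natCast, ZMod.natCast_eq_zero_iff] at h2
    obtain ⟨m, hm⟩ := h2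
    refine ⟨m, ?_⟩
    have h3 : t = (p : ZMod (p ^ n)) ^ j * m := by
      rw [← ZMod.natCast_zmod_val t, hm]; push_cast; rfl
    rw [← h3, ht]; ring

lemma Bj_eq_zpowers (hp : p.Prime) {j : ℕ} (hj : j ≤ n) (γ : (ZMod (p ^ n))ˣ)
    (hγ : ∀ u, u ∈ Subgroup.zpowers γ) :
    Bj p n j = Subgroup.zpowers (γ ^ (p ^ j).totient) := by
  have : NeZero (p ^ n) := ⟨(pow_pos hp.pos n).ne'⟩
  have : NeZero (p ^ j) := ⟨(pow_pos hp.pos j).ne'⟩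
  rw [Bj_eq_ker hp hj]
  set f := ZMod.unitsMap (pow_dvd_pow p hj) with hf
  apply le_antisymm
  · intro u hu
    obtain ⟨k, rfl⟩ := hγ u
    rw [MonoidHom.mem_ker] at hu
    have hu' : f γ ^ k = 1 := by rw [← map_zpow]; exact hu
    have ho : orderOf (f γ) = (p ^ j).totient := by
      rw [← ZMod.card_units_eq_totient, ← Nat.card_eq_fintype_card]
      apply orderOf_eq_card_of_forall_mem_zpowers
      intro w
      obtain ⟨w', rfl⟩ := ZMod.unitsMap_surjective (pow_dvd_pow p hj) w
      obtain ⟨m, rfl⟩ := hγ w'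
      exact ⟨m, by simp [hf]⟩
    rw [← orderOf_dvd_iff_zpow_eq_one, ho] at hu'
    obtain ⟨m, rfl⟩ := hu'
    refine ⟨m, ?_⟩
    simp only [zpow_mul, zpow_natCast]
  · rw [Subgroup.zpowers_le, MonoidHom.mem_ker, map_pow, ZMod.pow_totient]

end Part3
section Part4

open Polynomial

variable {p n : ℕ} [NeZero (p ^ n)] {V : Type} [AddCommGroup V] [Module ℚ V]

/-- The type `(j, d)` of a representation. -/
structure HasType (γ : (ZMod (p ^ n))ˣ) (ρ : Representation ℚ (Hol (p ^ n)) V) (j d : ℕ) :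
    Prop where
  triv : ρ (el ((p : ZMod (p ^ n)) ^ j) 1) = 1
  sum : j ≠ 0 → ∑ s : ZMod (p ^ n), ρ (el ((p : ZMod (p ^ n)) ^ (j - 1) * s) 1) = 0
  cyc : aeval (ρ (el 0 (γ ^ (p ^ j).totient))) (cyclotomic d ℚ) = 0

variable (ρ : Representation ℚ (Hol (p ^ n)) V)

lemma fix_mul (hp : p.Prime) {a : ZMod (p ^ n)} {v : V} (h : ρ (el a 1) v = v) (s : ZMod (p ^ n)) :
    ρ (el (a * s) 1) v = v := by
  obtain ⟨k, rfl⟩ := ZMod.natCast_zmod_surjective s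
  induction k with
  | zero => simp [el_one]
  | succ k ih =>
    have : el (a * ((k + 1 : ℕ) : ZMod (p ^ n))) 1 = el (a * (k : ZMod (p ^ n))) 1 * el a 1 := by
      rw [el_mul]; congr 1
      · push_cast; simp; ring
      · simp
    rw [this, map_mul, Module.End.mul_apply, h, ih]

lemma triv_mul (hp : p.Prime) {a : ZMod (p ^ n)} (h : ρ (el a 1) = 1) (s : ZMod (p ^ n)) :
    ρ (el (a * s) 1) = 1 := by
  ext v
  exact fix_mul ρ hp (by rw [h]; rfl) s

/-- The level-`j` stabilizer is central modulo the kernel. -/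
lemma central (hp : p.Prime) {j : ℕ} (h : ρ (el ((p : ZMod (p ^ n)) ^ j) 1) = 1)
    {u : (ZMod (p ^ n))ˣ} (hu : u ∈ Bj p n j) (g : Hol (p ^ n)) :
    ρ (el 0 u) * ρ g = ρ g * ρ (el 0 u) := by
  obtain ⟨t, w, rfl⟩ := exists_el g
  obtain ⟨s, hs⟩ := hu
  rw [← map_mul, ← map_mul, el_mul, el_mul]
  have h2 : el (0 + (u : ZMod (p ^ n)) * t) (u * w) =
      el ((p : ZMod (p ^ n)) ^ j * (s * t)) 1 * el (t + (w : ZMod (p ^ n)) * 0) (w * u) := by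
    rw [el_mul]
    congr 1
    · rw [hs]; simp; ring
    · rw [mul_comm w u, one_mul]
  rw [h2, map_mul, triv_mul ρ hp h, one_mul]

lemma aeval_comm {V' : Type} [AddCommGroup V'] [Module ℚ V'] {f : Module.End ℚ V}
    {f' : Module.End ℚ V'} {g : V →ₗ[ℚ] V'} (h : ∀ v, g (f v) = f' (g v)) (P : ℚ[X]) (v : V) :
    g (aeval f P v) = aeval f' P (g v) := by
  have hk : ∀ (k : ℕ) (v : V), g ((f ^ k) v) = (f' ^ k) (g v) := by
    intro k
    induction k with
    | zero => intro v; simp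
    | succ k ih => intro v; rw [pow_succ, pow_succ, Module.End.mul_apply, ih, h]; rfl
  induction P using Polynomial.induction_on' with
  | add a b ha hb => simp [ha, hb]
  | monomial k c => simp [aeval_monomial, hk, Module.algebraMap_end_apply]

lemma shift_sum (a : ZMod (p ^ n)) :
    ρ (el a 1) * ∑ s : ZMod (p ^ n), ρ (el (a * s) 1) =
      ∑ s : ZMod (p ^ n), ρ (el (a * s) 1) := by
  rw [Finset.mul_sum]
  rw [← Equiv.sum_comp (Equiv.addRight (1 : ZMod (p ^ n))) (fun s => ρ (el (a * s) 1))]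
  apply Finset.sum_congr rfl
  intro s _
  rw [← map_mul, el_mul]
  congr 2
  · simp; ring
  · simp

lemma pow_p_eq_zero : (p : ZMod (p ^ n)) ^ n = 0 := by
  have : ((p ^ n : ℕ) : ZMod (p ^ n)) = 0 := ZMod.natCast_self _
  push_cast at this
  exact this

lemma exists_type (hp : p.Prime) (γ : (ZMod (p ^ n))ˣ) (hγ : ∀ u, u ∈ Subgroup.zpowers γ)
    (hρ : Irr ρ) : ∃ j ≤ n, ∃ d ∈ ((p ^ n).totient / (p ^ j).totient).divisors,
      HasType γ ρ j d := by
  classical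
  obtain ⟨hnt, hirr⟩ := hρ
  have hex : ∃ j, ρ (el ((p : ZMod (p ^ n)) ^ j) 1) = 1 := ⟨n, by
    rw [pow_p_eq_zero, el_one, map_one]⟩
  set j := Nat.find hex with hj
  have htriv : ρ (el ((p : ZMod (p ^ n)) ^ j) 1) = 1 := Nat.find_spec hex
  have hjn : j ≤ n := Nat.find_min' hex (by rw [pow_p_eq_zero, el_one, map_one])
  have hsum : j ≠ 0 →
      ∑ s : ZMod (p ^ n), ρ (el ((p : ZMod (p ^ n)) ^ (j - 1) * s) 1) = 0 := by
    intro hj0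
    set a := (p : ZMod (p ^ n)) ^ (j - 1) with ha
    have hne : ρ (el a 1) ≠ 1 := Nat.find_min hex (by omega)
    have hF := hirr (LinearMap.ker (ρ (el a 1) - 1)) (by
      intro g v hv
      rw [LinearMap.mem_ker, LinearMap.sub_apply, Module.End.one_apply, sub_eq_zero] at hv ⊢
      obtain ⟨t, u, rfl⟩ := exists_el g
      rw [← Module.End.mul_apply, ← map_mul]
      have : el a 1 * el t u = el t u * el (a * ((u⁻¹ : (ZMod (p ^ n))ˣ) : ZMod (p ^ n))) 1 := by
        rw [el_mul, el_mul]
        congr 1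
        · rw [mul_comm a, ← mul_assoc]; simp [add_comm]
        · simp
      rw [this, map_mul, Module.End.mul_apply, fix_mul ρ hp hv])
    rcases hF with hF | hF
    · ext v
      have hm : (∑ s : ZMod (p ^ n), ρ (el (a * s) 1)) v ∈
          LinearMap.ker (ρ (el a 1) - 1) := by
        rw [LinearMap.mem_ker, LinearMap.sub_apply, Module.End.one_apply, sub_eq_zero,
          ← Module.End.mul_apply, shift_sum ρ a]
      rw [hF] at hm
      exact hm
    · exfalso; apply hne
      rw [LinearMap.ker_eq_top, sub_eq_zero] at hF
      exact hF
  refine ⟨j, hjn, ?_⟩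
  set c := ρ (el 0 (γ ^ (p ^ j).totient)) with hc
  by_contra hcon
  push Not at hcon
  have hcB : γ ^ (p ^ j).totient ∈ Bj p n j := by
    rw [Bj_eq_zpowers hp hjn γ hγ]; exact Subgroup.mem_zpowers _
  have hinj : ∀ d ∈ ((p ^ n).totient / (p ^ j).totient).divisors,
      Function.Injective (aeval c (cyclotomic d ℚ)) := by
    intro d hd
    have hnz : aeval c (cyclotomic d ℚ) ≠ 0 := fun h0 => hcon d hd ⟨htriv, hsum, h0⟩
    rcases hirr (LinearMap.ker (aeval c (cyclotomic d ℚ))) (by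
      intro g v hv
      rw [LinearMap.mem_ker] at hv ⊢
      have := aeval_comm (f := c) (f' := c) (g := ρ g) (fun v => by
        have := central ρ hp htriv hcB g
        exact (LinearMap.congr_fun this v).symm) (cyclotomic d ℚ) v
      rw [← this, hv, map_zero]) with h | h
    · exact LinearMap.ker_eq_bot.mp h
    · exact absurd (LinearMap.ker_eq_top.mp h) hnz
  have hdvd : (p ^ j).totient ∣ (p ^ n).totient := Nat.totient_dvd_of_dvd (pow_dvd_pow p hjn)
  have hpos : 0 < (p ^ n).totient / (p ^ j).totient :=
    Nat.div_pos (Nat.le_of_dvd (Nat.totient_pos.mpr (pow_pos hp.pos n)) hdvd)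
      (Nat.totient_pos.mpr (pow_pos hp.pos j))
  have hprod : Function.Injective
      (aeval c (∏ d ∈ ((p ^ n).totient / (p ^ j).totient).divisors, cyclotomic d ℚ)) := by
    apply Finset.prod_induction (fun d => cyclotomic d ℚ)
      (fun P => Function.Injective (aeval c P))
    · intro a b ha hb
      rw [map_mul]
      exact ha.comp hb
    · rw [map_one]; exact Function.injective_id
    · exact hinj
  rw [prod_cyclotomic_eq_X_pow_sub_one hpos] at hprod
  have hz : aeval c (X ^ ((p ^ n).totient / (p ^ j).totient) - 1 : ℚ[X]) = 0 := by
    have hpw : ∀ (w : (ZMod (p ^ n))ˣ) (k : ℕ), ρ (el 0 w) ^ k = ρ (el 0 (w ^ k)) := by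
      intro w k
      induction k with
      | zero => simp [el_one]
      | succ k ih => rw [pow_succ, ih, ← map_mul, el_mul, pow_succ]; simp
    rw [map_sub, map_pow, aeval_X, map_one, hc, hpw, ← pow_mul, Nat.mul_div_cancel' hdvd,
      ZMod.pow_totient, el_one, map_one, sub_self]
  rw [hz] at hprod
  obtain ⟨v, hv⟩ := exists_ne (0 : V)
  exact hv (hprod (by simp))

lemma type_unique [Nontrivial V] (hp : p.Prime) (γ : (ZMod (p ^ n))ˣ) {j d j' d' : ℕ}
    (h : HasType γ ρ j d) (h' : HasType γ ρ j' d') : j = j' ∧ d = d' := by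
  have key : ∀ {j d j' d' : ℕ}, HasType γ ρ j d → HasType γ ρ j' d' → ¬ j < j' := by
    intro j d j' d' h h' hlt
    have h1 := h'.sum (by omega)
    have h2 : ∀ i ∈ (Finset.univ : Finset (ZMod (p ^ n))),
        ρ (el ((p : ZMod (p ^ n)) ^ (j' - 1) * i) 1) = 1 := by
      intro i _
      have : (p : ZMod (p ^ n)) ^ (j' - 1) * i =
          (p : ZMod (p ^ n)) ^ j * ((p : ZMod (p ^ n)) ^ (j' - 1 - j) * i) := by
        rw [← mul_assoc, ← pow_add]; congr 2; omega
      rw [this, triv_mul ρ hp h.triv]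
    rw [Finset.sum_congr rfl h2] at h1
    obtain ⟨v, hv⟩ := exists_ne (0 : V)
    have h3 := LinearMap.congr_fun h1 v
    rw [Finset.sum_const, Finset.card_univ, ZMod.card, ← Nat.cast_smul_eq_nsmul ℚ,
      LinearMap.smul_apply, LinearMap.zero_apply, Module.End.one_apply] at h3
    rcases smul_eq_zero.mp h3 with h4 | h4
    · exact (pow_pos hp.pos n).ne' (by exact_mod_cast h4)
    · exact hv h4
  have hj : j = j' := by
    have := key h h'
    have := key h' h
    omega
  subst hj
  refine ⟨rfl, ?_⟩
  by_contra hd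
  obtain ⟨a, b, hab⟩ := cyclotomic.isCoprime_rat hd
  have := congrArg (aeval (ρ (el 0 (γ ^ (p ^ j).totient)))) hab
  simp [h.cyc, h'.cyc] at this

end Part4
section Part5

open Polynomial

lemma exists_intertwine {V V' : Type} [AddCommGroup V] [Module ℚ V] [AddCommGroup V'] [Module ℚ V']
    [Nontrivial V] [Nontrivial V'] (c : Module.End ℚ V) (c' : Module.End ℚ V') (P : ℚ[X])
    (hP : Irreducible P) (h : aeval c P = 0) (h' : aeval c' P = 0) :
    ∃ f : V →ₗ[ℚ] V', f ≠ 0 ∧ ∀ v, f (c v) = c' (f v) := by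
  have hmax : (Ideal.span {P}).IsMaximal :=
    PrincipalIdealRing.isMaximal_of_irreducible hP
  letI : Field (ℚ[X] ⧸ Ideal.span {P}) := Ideal.Quotient.field _
  have lem : ∀ {U : Type} [AddCommGroup U] [Module ℚ U] (e : Module.End ℚ U), aeval e P = 0 →
      ∀ a ∈ Ideal.span {P}, (aeval e : ℚ[X] →ₐ[ℚ] Module.End ℚ U).toRingHom a = 0 := by
    intro U _ _ e he a ha
    obtain ⟨b, rfl⟩ := Ideal.mem_span_singleton'.mp ha
    simp [he]
  let φ : (ℚ[X] ⧸ Ideal.span {P}) →+* Module.End ℚ V := Ideal.Quotient.lift _ _ (lem c h)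
  let φ' : (ℚ[X] ⧸ Ideal.span {P}) →+* Module.End ℚ V' := Ideal.Quotient.lift _ _ (lem c' h')
  letI : Module (ℚ[X] ⧸ Ideal.span {P}) V := Module.compHom V φ
  letI : Module (ℚ[X] ⧸ Ideal.span {P}) V' := Module.compHom V' φ'
  obtain ⟨v, hv⟩ := exists_ne (0 : V)
  obtain ⟨w, hw⟩ := exists_ne (0 : V')
  have hℓ : ∃ ℓ : Module.Dual (ℚ[X] ⧸ Ideal.span {P}) V, ℓ v ≠ 0 := by
    by_contra hcon
    push Not at hcon
    exact hv ((Module.forall_dual_apply_eq_zero_iff _ v).mp hcon)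
  obtain ⟨ℓ, hℓ⟩ := hℓ
  let F : V →ₗ[ℚ[X] ⧸ Ideal.span {P}] V' := ℓ.smulRight w
  let x : ℚ[X] ⧸ Ideal.span {P} := Ideal.Quotient.mk _ X
  have hx : ∀ u : V, x • u = c u := by
    intro u
    change φ (Ideal.Quotient.mk _ X) u = c u
    simp [φ]
  have hx' : ∀ u : V', x • u = c' u := by
    intro u
    change φ' (Ideal.Quotient.mk _ X) u = c' u
    simp [φ']
  refine ⟨F.toAddMonoidHom.toRatLinearMap, ?_, ?_⟩
  · intro h0
    have h1 : ℓ v • w = 0 := LinearMap.congr_fun h0 v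
    exact (smul_ne_zero hℓ hw) h1
  · intro u
    change F (c u) = c' (F u)
    rw [← hx, ← hx', map_smul]

variable {p n : ℕ} [NeZero (p ^ n)] {V : Type} [AddCommGroup V] [Module ℚ V]
  (ρ : Representation ℚ (Hol (p ^ n)) V)

lemma chi_shift (t s : ZMod (p ^ n)) (u : (ZMod (p ^ n))ˣ) :
    ρ.character (el (t + (1 - (u : ZMod (p ^ n))) * s) u) = ρ.character (el t u) := by
  rw [← Representation.char_conj ρ (el t u) (el s 1)]
  congr 1
  rw [el_inv, el_mul, el_mul]
  congr 1
  · simp; ring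
  · simp

lemma chi_unit (t : ZMod (p ^ n)) (u w : (ZMod (p ^ n))ˣ) :
    ρ.character (el ((w : ZMod (p ^ n)) * t) u) = ρ.character (el t u) := by
  rw [← Representation.char_conj ρ (el t u) (el 0 w)]
  congr 1
  rw [el_inv, el_mul, el_mul]
  congr 1
  · simp
  · rw [mul_comm w u]; simp

variable {ρ} {γ : (ZMod (p ^ n))ˣ} {j d : ℕ}

lemma chi_triv (hp : p.Prime) (h : HasType γ ρ j d) (t s : ZMod (p ^ n)) (u : (ZMod (p ^ n))ˣ) :
    ρ.character (el (t + (p : ZMod (p ^ n)) ^ j * s) u) = ρ.character (el t u) := by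
  unfold Representation.character
  have : el (t + (p : ZMod (p ^ n)) ^ j * s) u = el ((p : ZMod (p ^ n)) ^ j * s) 1 * el t u := by
    rw [el_mul]; congr 1
    · simp; ring
    · simp
  rw [this, map_mul, triv_mul ρ hp h.triv, one_mul]

lemma chi_sum (h : HasType γ ρ j d) (hj : j ≠ 0) (t : ZMod (p ^ n)) (u : (ZMod (p ^ n))ˣ) :
    ∑ s : ZMod (p ^ n), ρ.character (el (t + (p : ZMod (p ^ n)) ^ (j - 1) * s) u) = 0 := by
  have h1 : ∀ s : ZMod (p ^ n), ρ.character (el (t + (p : ZMod (p ^ n)) ^ (j - 1) * s) u) =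
      LinearMap.trace ℚ V (ρ (el ((p : ZMod (p ^ n)) ^ (j - 1) * s) 1) * ρ (el t u)) := by
    intro s
    unfold Representation.character
    rw [← map_mul, el_mul]
    congr 3
    · simp; ring
    · simp
  simp_rw [h1]
  rw [← map_sum, ← Finset.sum_mul, h.sum hj, zero_mul, map_zero]

lemma chi_vanish (hp : p.Prime) (h : HasType γ ρ j d) (t : ZMod (p ^ n)) (u : (ZMod (p ^ n))ˣ)
    (hu : u ∉ Bj p n j) : ρ.character (el t u) = 0 := by
  have hj : j ≠ 0 := by
    rintro rfl
    exact hu ⟨(u : ZMod (p ^ n)) - 1, by simp⟩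
  obtain ⟨k, v, hv⟩ := dich hp ((u : ZMod (p ^ n)) - 1)
  have hk : k < j := by
    by_contra hk
    apply hu
    refine ⟨(p : ZMod (p ^ n)) ^ (k - j) * v, ?_⟩
    rw [← mul_assoc, ← pow_add, Nat.add_sub_cancel' (by omega), ← hv]; ring
  have h1 : ∀ s : ZMod (p ^ n),
      ρ.character (el (t + (p : ZMod (p ^ n)) ^ (j - 1) * s) u) = ρ.character (el t u) := by
    intro s
    rw [← chi_shift ρ t (-((v⁻¹ : (ZMod (p ^ n))ˣ) * (p : ZMod (p ^ n)) ^ (j - 1 - k) * s)) u]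
    congr 3
    have h2 : (p : ZMod (p ^ n)) ^ (j - 1) =
        (p : ZMod (p ^ n)) ^ k * (p : ZMod (p ^ n)) ^ (j - 1 - k) := by
      rw [← pow_add]; congr 1; omega
    have h3 : (v : ZMod (p ^ n)) * (v⁻¹ : (ZMod (p ^ n))ˣ) = 1 := by simp
    rw [h2]
    linear_combination
      (-(v⁻¹ : (ZMod (p ^ n))ˣ) * (p : ZMod (p ^ n)) ^ (j - 1 - k) * s) * hv -
        ((p : ZMod (p ^ n)) ^ k * (p : ZMod (p ^ n)) ^ (j - 1 - k) * s) * h3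
  have h2 := chi_sum h hj t u
  simp_rw [h1] at h2
  rw [Finset.sum_const, Finset.card_univ, ZMod.card, nsmul_eq_mul] at h2
  rcases mul_eq_zero.mp h2 with h3 | h3
  · exact absurd (by exact_mod_cast h3) (pow_pos hp.pos n).ne'
  · exact h3

open Classical in
/-- The normalized character of the level `j` on the normal cyclic subgroup. -/
noncomputable def psi (p n : ℕ) [NeZero (p ^ n)] (j : ℕ) (t : ZMod (p ^ n)) : ℚ :=
  if ∃ s, t = (p : ZMod (p ^ n)) ^ j * s then 1
  else if ∃ s, t = (p : ZMod (p ^ n)) ^ (j - 1) * s then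
    -((Finset.univ.filter (fun s : ZMod (p ^ n) => ¬ IsUnit s)).card : ℚ) /
      ((Finset.univ.filter (fun s : ZMod (p ^ n) => IsUnit s)).card : ℚ)
  else 0

lemma chi_psi (hp : p.Prime) (h : HasType γ ρ j d) (t : ZMod (p ^ n)) (u : (ZMod (p ^ n))ˣ) :
    ρ.character (el t u) = psi p n j t * ρ.character (el 0 u) := by
  classical
  unfold psi
  split_ifs with h1 h2
  · obtain ⟨s, rfl⟩ := h1
    have := chi_triv hp h 0 s u
    rw [zero_add] at this
    rw [this, one_mul]
  · have hj : j ≠ 0 := by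
      rintro rfl
      exact h1 ⟨t, by simp⟩
    have hpj : (p : ZMod (p ^ n)) ^ (j - 1) * p = (p : ZMod (p ^ n)) ^ j := by
      rw [← pow_succ]; congr 1; omega
    obtain ⟨s, rfl⟩ := h2
    have hdic : ∀ s : ZMod (p ^ n), ¬ IsUnit s → ∃ r, s = p * r := by
      intro s hs
      obtain ⟨k, v, hv⟩ := dich hp s
      rcases k with _ | k
      · exact absurd (by rw [hv]; simp) hs
      · exact ⟨(p : ZMod (p ^ n)) ^ k * v, by rw [hv]; ring⟩
    have hunit : ∀ s : ZMod (p ^ n), IsUnit s →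
        ρ.character (el ((p : ZMod (p ^ n)) ^ (j - 1) * s) u) =
        ρ.character (el ((p : ZMod (p ^ n)) ^ (j - 1)) u) := by
      rintro _ ⟨v, rfl⟩
      rw [mul_comm, chi_unit]
    have hnon : ∀ s : ZMod (p ^ n), ¬ IsUnit s →
        ρ.character (el ((p : ZMod (p ^ n)) ^ (j - 1) * s) u) = ρ.character (el 0 u) := by
      intro s hs
      obtain ⟨r, rfl⟩ := hdic s hs
      rw [← mul_assoc, hpj]
      have := chi_triv hp h 0 r u
      rwa [zero_add] at this
    have hs : IsUnit s := by
      by_contra hs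
      obtain ⟨r, rfl⟩ := hdic s hs
      exact h1 ⟨r, by rw [← mul_assoc, hpj]⟩
    rw [hunit s hs]
    have h3 := chi_sum h hj 0 u
    simp_rw [zero_add] at h3
    rw [← Finset.sum_filter_add_sum_filter_not Finset.univ (fun s : ZMod (p ^ n) => IsUnit s),
      Finset.sum_congr rfl (fun s hs => hunit s (Finset.mem_filter.mp hs).2),
      Finset.sum_congr rfl (fun s hs => hnon s (Finset.mem_filter.mp hs).2),
      Finset.sum_const, Finset.sum_const, nsmul_eq_mul, nsmul_eq_mul] at h3
    have hpos : ((Finset.univ.filter (fun s : ZMod (p ^ n) => IsUnit s)).card : ℚ) ≠ 0 := by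
      have : (Finset.univ.filter (fun s : ZMod (p ^ n) => IsUnit s)).card ≠ 0 := by
        apply Finset.card_ne_zero_of_mem (a := 1)
        simp
      exact_mod_cast this
    field_simp
    linarith
  · have hj : j ≠ 0 := by
      rintro rfl
      exact h1 ⟨t, by simp⟩
    obtain ⟨k, v, rfl⟩ := dich hp t
    have hk : k < j - 1 := by
      by_contra hk
      apply h2
      refine ⟨(p : ZMod (p ^ n)) ^ (k - (j - 1)) * v, ?_⟩
      rw [← mul_assoc, ← pow_add, Nat.add_sub_cancel' (by omega)]
    have h4 : ∀ s : ZMod (p ^ n),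
        ρ.character (el ((p : ZMod (p ^ n)) ^ k * v + (p : ZMod (p ^ n)) ^ (j - 1) * s) u) =
          ρ.character (el ((p : ZMod (p ^ n)) ^ k * v) u) := by
      intro s
      obtain ⟨w, hw⟩ := unit_add v ((p : ZMod (p ^ n)) ^ (j - 1 - k - 1) * s)
      have h5 : (p : ZMod (p ^ n)) ^ k * v + (p : ZMod (p ^ n)) ^ (j - 1) * s =
          w * (p : ZMod (p ^ n)) ^ k := by
        have : (p : ZMod (p ^ n)) ^ (j - 1) =
          (p : ZMod (p ^ n)) ^ k * (p * (p : ZMod (p ^ n)) ^ (j - 1 - k - 1)) := by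
          rw [← pow_succ', ← pow_add]; congr 1; omega
        rw [hw, this]; ring
      rw [h5, chi_unit, mul_comm, chi_unit]
    have h2 := chi_sum h hj ((p : ZMod (p ^ n)) ^ k * v) u
    simp_rw [h4] at h2
    rw [Finset.sum_const, Finset.card_univ, ZMod.card, nsmul_eq_mul] at h2
    rw [zero_mul]
    rcases mul_eq_zero.mp h2 with h3 | h3
    · exact absurd (by exact_mod_cast h3) (pow_pos hp.pos n).ne'
    · exact h3

end Part5
lemma exists_cyclotomic_field (m : ℕ) [NeZero m] : ∃ (K : Type) (_ : Field K) (_ : Algebra ℚ K)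
    (_ : FiniteDimensional ℚ K) (ζ : K), IsPrimitiveRoot ζ m := by
  let _ : Algebra ℚ (CyclotomicField m ℚ) := CyclotomicField.algebra m ℚ
  exact ⟨CyclotomicField m ℚ, inferInstance, CyclotomicField.algebra m ℚ,
    IsCyclotomicExtension.finiteDimensional {m} ℚ _, _,
    IsCyclotomicExtension.zeta_spec m ℚ (CyclotomicField m ℚ)⟩

section Part6

open Polynomial

variable {p n : ℕ} [NeZero (p ^ n)]

/-- The embedding of the level `j` stabilizer into the holomorph. -/
def embB (p n j : ℕ) : Bj p n j →* Hol (p ^ n) :=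
  MonoidHom.mk' (fun u => el 0 (u : (ZMod (p ^ n))ˣ)) (fun a b => by
    rw [el_mul]; simp)

lemma iso_of_type (hp : p.Prime) (γ : (ZMod (p ^ n))ˣ) (hγ : ∀ u, u ∈ Subgroup.zpowers γ)
    {j d : ℕ} (hj : j ≤ n) (hd : 0 < d) (V W : FDRep ℚ (Hol (p ^ n))) [Simple V] [Simple W]
    (hV : HasType γ V.ρ j d) (hW : HasType γ W.ρ j d) : Nonempty (V ≅ W) := by
  classical
  have : Finite (Hol (p ^ n)) := Finite.of_surjective _ el_bij.2
  let _ : Fintype (Hol (p ^ n)) := Fintype.ofFinite _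
  apply iso_of_inner_ne_zero
  have hVn : Nontrivial V := (irr_of_simple_s13 V).1
  have hWn : Nontrivial W := (irr_of_simple_s13 W).1
  let χ := Representation.character V.ρ
  let χ' := Representation.character W.ρ
  change ∑ g : Hol (p ^ n), χ' g * χ g⁻¹ ≠ 0
  rw [← Equiv.sum_comp (Equiv.ofBijective _ (el_bij (q := p ^ n)))]
  rw [Fintype.sum_prod_type]
  have h1 : ∀ (t : ZMod (p ^ n)) (u : (ZMod (p ^ n))ˣ),
      χ' (Equiv.ofBijective _ (el_bij (q := p ^ n)) (t, u)) *
        χ (Equiv.ofBijective _ (el_bij (q := p ^ n)) (t, u))⁻¹ =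
      psi p n j t ^ 2 * (χ' (el 0 u) * χ (el 0 u⁻¹)) := by
    intro t u
    change χ' (el t u) * χ (el t u)⁻¹ = _
    have h2 : χ (el t u)⁻¹ = χ (el t u⁻¹) := by
      rw [el_inv]
      have := chi_unit V.ρ t u⁻¹ (-u⁻¹)
      rw [Units.val_neg] at this
      exact this
    have h3 : χ' (el t u) = psi p n j t * χ' (el 0 u) := chi_psi hp hW t u
    have h4 : χ (el t u⁻¹) = psi p n j t * χ (el 0 u⁻¹) := chi_psi hp hV t u⁻¹
    rw [h2, h3, h4]; ring
  simp_rw [h1, ← Finset.mul_sum]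
  rw [← Finset.sum_mul]
  apply mul_ne_zero
  · have : 0 < ∑ t : ZMod (p ^ n), psi p n j t ^ 2 := by
      apply Finset.sum_pos' (fun t _ => sq_nonneg _)
      refine ⟨0, Finset.mem_univ _, ?_⟩
      have : psi p n j 0 = 1 := by
        unfold psi
        rw [if_pos ⟨0, by simp⟩]
      rw [this]; norm_num
    exact this.ne'
  · have h2 : ∑ u : (ZMod (p ^ n))ˣ, χ' (el 0 u) * χ (el 0 u⁻¹) =
        ∑ u : Bj p n j, χ' (el 0 (u : (ZMod (p ^ n))ˣ)) * χ (el 0 (u : (ZMod (p ^ n))ˣ)⁻¹) := by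
      rw [← Finset.sum_subset (Finset.subset_univ
        (Finset.univ.filter (fun u : (ZMod (p ^ n))ˣ => u ∈ Bj p n j)))]
      · rw [← Finset.sum_subtype_eq_sum_filter]
        apply Finset.sum_bij' (fun a _ => ⟨a.1, a.2⟩) (fun a _ => ⟨a.1, a.2⟩) <;> simp
      · intro u _ hu
        have hu' : u ∉ Bj p n j := by simpa using hu
        have : χ' (el 0 u) = 0 := chi_vanish hp hW 0 u hu'
        rw [this, zero_mul]
    rw [h2]
    let σ : Representation ℚ (Bj p n j) V := V.ρ.comp (embB p n j)
    let σ' : Representation ℚ (Bj p n j) W := W.ρ.comp (embB p n j)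
    have hc : (Nat.card (Bj p n j) : ℚ) ≠ 0 := by simp
    have := invertibleOfNonzero hc
    have h3 := Representation.card_inv_mul_sum_char_eq_finrank (Representation.linHom σ σ')
    have h4 : ∑ u : Bj p n j, (Representation.linHom σ σ').character u =
        ∑ u : Bj p n j, χ' (el 0 (u : (ZMod (p ^ n))ˣ)) * χ (el 0 (u : (ZMod (p ^ n))ˣ)⁻¹) := by
      apply Finset.sum_congr rfl
      intro u _
      rw [Representation.char_linHom, mul_comm]
      rfl
    rw [h4] at h3
    intro h0
    rw [h0, mul_zero] at h3
    have h5 : Module.finrank ℚ (Representation.linHom σ σ').invariants = 0 := by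
      exact_mod_cast h3.symm
    rw [Submodule.finrank_eq_zero] at h5
    obtain ⟨f, hf, hfc⟩ := exists_intertwine _ _ _ (cyclotomic.irreducible_rat hd) hV.cyc hW.cyc
    apply hf
    have hm : f ∈ (Representation.linHom σ σ').invariants := by
      have key0 : ∀ (k : ℕ) (v : V), f (V.ρ (el 0 ((γ ^ (p ^ j).totient) ^ k)) v) =
          W.ρ (el 0 ((γ ^ (p ^ j).totient) ^ k)) (f v) := by
        intro k
        induction k with
        | zero => intro v; simp [el_one]
        | succ k ih =>
          intro v
          have : ∀ w : (ZMod (p ^ n))ˣ, el 0 (w ^ (k + 1)) = el (0 : ZMod (p ^ n)) (w ^ k) * el 0 w := by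
            intro w
            rw [el_mul, pow_succ]; simp
          rw [this, map_mul, map_mul, Module.End.mul_apply, Module.End.mul_apply, ← hfc]
          apply ih
      have key : ∀ (u : Bj p n j) (v : V), f (σ u v) = σ' u (f v) := by
        rintro ⟨u, hu⟩ v
        rw [Bj_eq_zpowers hp hj γ hγ] at hu
        obtain ⟨k, rfl⟩ := (Submonoid.mem_powers_iff _ _).mp
          ((mem_powers_iff_mem_zpowers).mpr hu)
        exact key0 k v
      intro u
      ext v
      rw [Representation.linHom_apply]
      change σ' u (f (σ u⁻¹ v)) = f v
      rw [← key, ← Module.End.mul_apply, ← map_mul]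
      simp
    rw [h5] at hm
    exact hm

/-- The left regular representation on functions. -/
def regRep (G : Type) [Group G] (K : Type) [Field K] [Algebra ℚ K] : Representation ℚ G (G → K) where
  toFun g := LinearMap.funLeft ℚ K (fun h => g⁻¹ * h)
  map_one' := by ext f h; simp [LinearMap.funLeft]
  map_mul' a b := by ext f h; simp [LinearMap.funLeft, mul_assoc]

lemma regRep_el {K : Type} [Field K] [Algebra ℚ K] (F : Hol (p ^ n) → K) (s t : ZMod (p ^ n))
    (w u : (ZMod (p ^ n))ˣ) :
    regRep (Hol (p ^ n)) K (el s w) F (el t u) =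
      F (el (((w⁻¹ : (ZMod (p ^ n))ˣ) : ZMod (p ^ n)) * (t - s)) (w⁻¹ * u)) := by
  change F ((el s w)⁻¹ * el t u) = _
  rw [el_inv, el_mul]
  congr 2
  ring

/-- The model subspace. -/
def modelSub {K : Type} [Field K] [Algebra ℚ K] (χ : (ZMod (p ^ n))ˣ →* Kˣ) (j : ℕ) :
    Submodule ℚ (Hol (p ^ n) → K) where
  carrier := {F | (∀ t u, F (el t u) = F (el t 1) * (χ u : K)) ∧
    (∀ t s u, F (el (t + (p : ZMod (p ^ n)) ^ j * s) u) = F (el t u)) ∧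
    (j ≠ 0 → ∀ t u, ∑ s : ZMod (p ^ n), F (el (t + (p : ZMod (p ^ n)) ^ (j - 1) * s) u) = 0)}
  zero_mem' := by simp
  add_mem' := by
    rintro F F' ⟨h1, h2, h3⟩ ⟨h1', h2', h3'⟩
    refine ⟨fun t u => ?_, fun t s u => ?_, fun hj t u => ?_⟩
    · simp only [Pi.add_apply]; rw [h1, h1', add_mul]
    · simp only [Pi.add_apply]; rw [h2, h2']
    · simp only [Pi.add_apply]; rw [Finset.sum_add_distrib, h3 hj, h3' hj, add_zero]
  smul_mem' := by
    rintro c F ⟨h1, h2, h3⟩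
    refine ⟨fun t u => ?_, fun t s u => ?_, fun hj t u => ?_⟩
    · simp only [Pi.smul_apply]; rw [h1, smul_mul_assoc]
    · simp only [Pi.smul_apply]; rw [h2]
    · simp only [Pi.smul_apply, Algebra.smul_def]; rw [← Finset.mul_sum, h3 hj, mul_zero]

lemma modelSub_stable {K : Type} [Field K] [Algebra ℚ K] (χ : (ZMod (p ^ n))ˣ →* Kˣ) (j : ℕ)
    (g : Hol (p ^ n)) (F : Hol (p ^ n) → K) (hF : F ∈ modelSub χ j) :
    regRep (Hol (p ^ n)) K g F ∈ modelSub χ j := by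
  obtain ⟨s, w, rfl⟩ := exists_el g
  obtain ⟨h1, h2, h3⟩ := hF
  refine ⟨fun t u => ?_, fun t r u => ?_, fun hj t u => ?_⟩
  · rw [regRep_el, regRep_el, h1, h1 _ (w⁻¹ * 1)]
    simp [mul_assoc]
  · rw [regRep_el, regRep_el, ← h2 (((w⁻¹ : (ZMod (p ^ n))ˣ) : ZMod (p ^ n)) * (t - s))
      (((w⁻¹ : (ZMod (p ^ n))ˣ) : ZMod (p ^ n)) * r) (w⁻¹ * u)]
    congr 2
    ring
  · rw [← h3 hj (((w⁻¹ : (ZMod (p ^ n))ˣ) : ZMod (p ^ n)) * (t - s)) (w⁻¹ * u)]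
    rw [← Equiv.sum_comp (Units.mulLeft w⁻¹)
      (fun r => F (el (((w⁻¹ : (ZMod (p ^ n))ˣ) : ZMod (p ^ n)) * (t - s) + _ * r) (w⁻¹ * u)))]
    apply Finset.sum_congr rfl
    intro r _
    rw [regRep_el]
    congr 2
    simp only [Units.mulLeft_apply]
    ring

lemma not_dvd_aux (hp : p.Prime) {j : ℕ} (hj : j ≤ n) (hj0 : j ≠ 0) (s : ZMod (p ^ n)) :
    - (p : ZMod (p ^ n)) ^ (j - 1) ≠ (p : ZMod (p ^ n)) ^ j * s := by
  intro h
  have h1 := congrArg (ZMod.castHom (pow_dvd_pow p hj) (ZMod (p ^ j))) h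
  have hz : ((p : ZMod (p ^ j))) ^ j = 0 := by
    have : ((p ^ j : ℕ) : ZMod (p ^ j)) = 0 := ZMod.natCast_self _
    push_cast at this
    exact this
  rw [map_neg, map_mul, map_pow, map_pow, map_natCast, hz, zero_mul, neg_eq_zero] at h1
  have h2 : ((p ^ (j - 1) : ℕ) : ZMod (p ^ j)) = 0 := by push_cast; exact h1
  rw [ZMod.natCast_eq_zero_iff, Nat.pow_dvd_pow_iff_le_right hp.one_lt] at h2
  omega

lemma modelSub_ne_bot (hp : p.Prime) {K : Type} [Field K] [Algebra ℚ K]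
    (χ : (ZMod (p ^ n))ˣ →* Kˣ) {j : ℕ} (hj : j ≤ n) : modelSub χ j ≠ ⊥ := by
  classical
  let δ : ZMod (p ^ n) → K := fun t => if ∃ s, t = (p : ZMod (p ^ n)) ^ j * s then 1 else 0
  have hδ : ∀ t s, δ (t + (p : ZMod (p ^ n)) ^ j * s) = δ t := by
    intro t s
    simp only [δ]
    congr 1
    apply propext
    constructor
    · rintro ⟨r, hr⟩
      exact ⟨r - s, by linear_combination hr⟩
    · rintro ⟨r, hr⟩
      exact ⟨r + s, by linear_combination hr⟩
  let a : ZMod (p ^ n) → K :=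
    fun t => δ t - (if j = 0 then 0 else δ (t - (p : ZMod (p ^ n)) ^ (j - 1)))
  let E := Equiv.ofBijective _ (el_bij (q := p ^ n))
  let F : Hol (p ^ n) → K := fun g => a (E.symm g).1 * (χ (E.symm g).2 : K)
  have hF : ∀ t u, F (el t u) = a t * (χ u : K) := by
    intro t u
    have : E.symm (el t u) = (t, u) := by
      rw [Equiv.symm_apply_eq]; rfl
    simp only [F, this]
  have hmem : F ∈ modelSub χ j := by
    refine ⟨fun t u => ?_, fun t r u => ?_, fun hj t u => ?_⟩
    · rw [hF, hF]; simp
    · rw [hF, hF]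
      simp only [a]
      rw [hδ, add_sub_right_comm, hδ]
    · simp_rw [hF]
      rw [← Finset.sum_mul]
      simp only [a, if_neg hj]
      rw [Finset.sum_sub_distrib]
      rw [← Equiv.sum_comp (Equiv.addRight (1 : ZMod (p ^ n)))
        (fun s => δ (t + (p : ZMod (p ^ n)) ^ (j - 1) * s - (p : ZMod (p ^ n)) ^ (j - 1)))]
      have : ∀ s : ZMod (p ^ n), δ (t + (p : ZMod (p ^ n)) ^ (j - 1) *
          (Equiv.addRight (1 : ZMod (p ^ n)) s) - (p : ZMod (p ^ n)) ^ (j - 1)) =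
          δ (t + (p : ZMod (p ^ n)) ^ (j - 1) * s) := by
        intro s
        congr 1
        simp; ring
      simp_rw [this]
      simp
  intro hbot
  rw [hbot] at hmem
  have h0 : F (el 0 1) = 0 := by
    rw [(Submodule.mem_bot ℚ).mp hmem]; rfl
  rw [hF] at h0
  have hδ0 : δ 0 = 1 := by
    simp only [δ]
    rw [if_pos ⟨0, by simp⟩]
  have ha : a 0 = 1 := by
    simp only [a]
    split_ifs with hj0
    · rw [hδ0, sub_zero]
    · rw [hδ0]
      have : δ (0 - (p : ZMod (p ^ n)) ^ (j - 1)) = 0 := by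
        simp only [δ]
        rw [if_neg]
        rintro ⟨s, hs⟩
        rw [zero_sub] at hs
        exact not_dvd_aux hp hj hj0 s hs
      rw [this, sub_zero]
  rw [ha] at h0
  simp at h0

lemma exists_of_type (hp : p.Prime) (γ : (ZMod (p ^ n))ˣ) (hγ : ∀ u, u ∈ Subgroup.zpowers γ)
    {j d : ℕ} (hj : j ≤ n) (hd : d ∈ ((p ^ n).totient / (p ^ j).totient).divisors) :
    ∃ W : FDRep ℚ (Hol (p ^ n)), Simple W ∧ HasType γ W.ρ j d := by
  have : Finite (Hol (p ^ n)) := Finite.of_surjective _ el_bij.2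
  have hdvd : (p ^ j).totient ∣ (p ^ n).totient := Nat.totient_dvd_of_dvd (pow_dvd_pow p hj)
  have hjpos : 0 < (p ^ j).totient := Nat.totient_pos.mpr (pow_pos hp.pos j)
  have hdpos : 0 < d := Nat.pos_of_mem_divisors hd
  set m := (p ^ j).totient * d with hm
  have hmpos : 0 < m := Nat.mul_pos hjpos hdpos
  have hmd : m ∣ (p ^ n).totient := by
    rw [← Nat.mul_div_cancel' hdvd]
    exact Nat.mul_dvd_mul_left _ (Nat.dvd_of_mem_divisors hd)
  have : NeZero m := ⟨hmpos.ne'⟩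
  obtain ⟨K, _, _, _, ζ, hζ⟩ := exists_cyclotomic_field m
  let ζu : Kˣ := hζ.isUnit hmpos.ne' |>.unit
  have hζu : IsPrimitiveRoot ζu m := hζ.isUnit_unit hmpos.ne'
  have hγo : orderOf γ = (p ^ n).totient := by
    rw [orderOf_eq_card_of_forall_mem_zpowers hγ, Nat.card_eq_fintype_card,
      ZMod.card_units_eq_totient]
  let χ : (ZMod (p ^ n))ˣ →* Kˣ := monoidHomOfForallMemZpowers hγ (g' := ζu) (by
    rw [hγo, ← hζu.eq_orderOf]; exact hmd)
  have hχ : χ γ = ζu := monoidHomOfForallMemZpowers_apply_gen hγ _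
  obtain ⟨W, hW, f, hfi, hfe, hfm⟩ := exists_simple_sub (regRep (Hol (p ^ n)) K) (modelSub χ j)
    (modelSub_stable χ j) (modelSub_ne_bot hp χ hj)
  refine ⟨W, hW, ?_, ?_, ?_⟩
  · ext w
    apply hfi
    rw [hfe, Module.End.one_apply]
    obtain ⟨h1, h2, h3⟩ := hfm w
    funext g
    obtain ⟨t, u, rfl⟩ := exists_el g
    rw [regRep_el, ← h2 t (-1) u]
    congr 2
    · simp; ring
  · intro hj0
    ext w
    apply hfi
    obtain ⟨h1, h2, h3⟩ := hfm w
    funext g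
    obtain ⟨t, u, rfl⟩ := exists_el g
    rw [LinearMap.sum_apply, map_sum, Finset.sum_apply, LinearMap.zero_apply, map_zero,
      Pi.zero_apply, ← h3 hj0 t u, ← Equiv.sum_comp (Equiv.neg (ZMod (p ^ n)))]
    apply Finset.sum_congr rfl
    intro s _
    rw [hfe, regRep_el]
    congr 2
    · simp
  · ext w
    apply hfi
    obtain ⟨h1, h2, h3⟩ := hfm w
    set c := γ ^ (p ^ j).totient with hc
    have hcB : c ∈ Bj p n j := by
      rw [Bj_eq_zpowers hp hj γ hγ]; exact Subgroup.mem_zpowers _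
    have hz : IsPrimitiveRoot ((χ c)⁻¹) d := by
      rw [hc, map_pow, hχ]
      exact (hζu.pow hmpos hm).inv
    have hz' : IsPrimitiveRoot (((χ c)⁻¹ : Kˣ) : K) d := IsPrimitiveRoot.coe_units_iff.mpr hz
    set z : K := (((χ c)⁻¹ : Kˣ) : K) with hzdef
    rw [aeval_comm (f := W.ρ (el 0 c)) (f' := regRep (Hol (p ^ n)) K (el 0 c)) (fun v => hfe _ v)]
    let g : K →ₗ[ℚ] (Hol (p ^ n) → K) :=
      { toFun := fun k h => k * f w h
        map_add' := by intro a b; ext h; simp [add_mul]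
        map_smul' := by intro a b; ext h; simp }
    have hg : ∀ k, g (LinearMap.mulLeft ℚ z k) = regRep (Hol (p ^ n)) K (el 0 c) (g k) := by
      intro k
      funext h
      obtain ⟨t, u, rfl⟩ := exists_el h
      rw [regRep_el]
      change z * k * f w (el t u) = k * f w (el _ _)
      obtain ⟨s, hs⟩ := (Bj p n j).inv_mem hcB
      have h4 : ((c⁻¹ : (ZMod (p ^ n))ˣ) : ZMod (p ^ n)) * (t - 0) =
          t + (p : ZMod (p ^ n)) ^ j * (s * t) := by rw [hs]; ring
      rw [h4, h2, h1 t u, h1 t (c⁻¹ * u), map_mul, map_inv, Units.val_mul, ← hzdef]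
      ring
    have h5 := aeval_comm hg (cyclotomic d ℚ) 1
    have hg1 : g 1 = f w := by ext h; simp [g]
    rw [hg1] at h5
    rw [← h5]
    have h6 : aeval (LinearMap.mulLeft ℚ z) (cyclotomic d ℚ) = 0 := by
      have h7 : LinearMap.mulLeft ℚ z = Algebra.lmul ℚ K z := rfl
      rw [h7, aeval_algHom_apply]
      have h8 : aeval z (cyclotomic d ℚ) = 0 := by
        have := hz'.isRoot_cyclotomic hdpos
        rw [aeval_def, eval₂_eq_eval_map, map_cyclotomic]
        exact this
      rw [h8, map_zero]
    rw [h6]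
    simp

lemma card_count (hp : p.Prime) (hn : 1 ≤ n) :
    ((Finset.range (n + 1)).sigma
      (fun j => ((p ^ n).totient / (p ^ j).totient).divisors)).card =
    (p ^ n).totient.divisors.card + n * (n + 1) / 2 := by
  rw [Finset.card_sigma, Finset.sum_range_succ']
  have h : ∀ i ∈ Finset.range n, ((p ^ n).totient / (p ^ (i + 1)).totient).divisors.card =
      n - 1 - i + 1 := by
    intro i hi
    rw [Finset.mem_range] at hi
    have h1 : (p ^ n).totient / (p ^ (i + 1)).totient = p ^ (n - 1 - i) := by
      rw [Nat.totient_prime_pow hp (by omega), Nat.totient_prime_pow hp (by omega),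
        Nat.mul_div_mul_right _ _ (Nat.sub_pos_of_lt hp.one_lt), Nat.add_sub_cancel,
        Nat.pow_div (by omega) hp.pos]
    rw [h1, Nat.divisors_prime_pow hp, Finset.card_map, Finset.card_range]
  rw [Finset.sum_congr rfl h, Finset.sum_range_reflect (fun i => i + 1) n]
  have h2 : ∑ i ∈ Finset.range n, (i + 1) = n * (n + 1) / 2 := by
    have := Finset.sum_range_id (n + 1)
    rw [Finset.sum_range_succ'] at this
    simp only [add_zero, Nat.add_sub_cancel] at this
    rw [this, mul_comm]
  rw [h2]
  simp [add_comm]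

end Part6

/-- For an odd prime `p` and `n ≥ 1`, the number of inequivalent irreducible rational
representations of `Hol(C_{p^n})` equals `d + n(n+1)/2`, where `d` is the number of
positive divisors of `φ(p^n)`. -/
theorem stmt13 (p n : ℕ) (hp : p.Prime) (hodd : Odd p) (hn : 1 ≤ n) :
    ∃ V : Fin ((Nat.totient (p ^ n)).divisors.card + n * (n + 1) / 2) →
        FDRep ℚ (Hol (p ^ n)),
      (∀ i, Simple (V i)) ∧
      (∀ i j, i ≠ j → IsEmpty (V i ≅ V j)) ∧
      (∀ W : FDRep ℚ (Hol (p ^ n)), Simple W → ∃ i, Nonempty (W ≅ V i)) := by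
  have : NeZero (p ^ n) := ⟨(pow_pos hp.pos n).ne'⟩
  have hp2 : p ≠ 2 := by rintro rfl; exact absurd hodd (by decide)
  have hcyc : IsCyclic (ZMod (p ^ n))ˣ := ZMod.isCyclic_units_of_prime_pow p hp hp2 n
  obtain ⟨γ, hγ⟩ := hcyc.exists_generator
  let I := (Finset.range (n + 1)).sigma
      (fun j => ((p ^ n).totient / (p ^ j).totient).divisors)
  have hI : ∀ x : I, x.1.1 ≤ n ∧ x.1.2 ∈ ((p ^ n).totient / (p ^ x.1.1).totient).divisors := by
    intro x
    have := x.2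
    rw [Finset.mem_sigma, Finset.mem_range] at this
    exact ⟨by omega, this.2⟩
  have hex : ∀ x : I, ∃ W : FDRep ℚ (Hol (p ^ n)), Simple W ∧ HasType γ W.ρ x.1.1 x.1.2 :=
    fun x => exists_of_type hp γ hγ (hI x).1 (hI x).2
  choose R hR hT using hex
  let e : Fin ((Nat.totient (p ^ n)).divisors.card + n * (n + 1) / 2) ≃ I :=
    (finCongr (card_count hp hn).symm).trans I.equivFin.symm
  refine ⟨fun i => R (e i), fun i => hR _, ?_, ?_⟩
  · intro i j hij
    refine ⟨fun φ => hij ?_⟩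
    apply e.injective
    have hnt : Nontrivial (R (e i)) := by
      have := hR (e i)
      exact (irr_of_simple_s13 (R (e i))).1
    have hinj : Function.Injective (lin φ.hom) := by
      intro a b hab
      have h1 : ∀ v, lin φ.inv (lin φ.hom v) = v := fun v =>
        LinearMap.congr_fun (congrArg lin φ.hom_inv_id) v
      rw [← h1 a, hab, h1]
    have hty : HasType γ (R (e i)).ρ (e j).1.1 (e j).1.2 := by
      have hj := hT (e j)
      refine ⟨?_, fun h0 => ?_, ?_⟩
      · ext v
        apply hinj
        rw [lin_comm, hj.triv]; rfl
      · ext v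
        apply hinj
        have h2 := LinearMap.congr_fun (hj.sum h0) (lin φ.hom v)
        rw [LinearMap.sum_apply] at h2
        rw [LinearMap.sum_apply, map_sum]
        simp_rw [lin_comm]
        rw [h2]
        simp
      · ext v
        apply hinj
        rw [aeval_comm (fun v => lin_comm φ.hom _ v), hj.cyc]
        simp
    obtain ⟨h1, h2⟩ := type_unique _ hp γ (hT (e i)) hty
    apply Subtype.ext
    exact Sigma.ext h1 (heq_of_eq h2)
  · intro W hW
    obtain ⟨j, hj, d, hd, hWt⟩ := exists_type W.ρ hp γ hγ (irr_of_simple_s13 W)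
    let x : I := ⟨⟨j, d⟩, by rw [Finset.mem_sigma, Finset.mem_range]; exact ⟨Nat.lt_succ_of_le hj, hd⟩⟩
    refine ⟨e.symm x, ?_⟩
    have hs : Simple (R (e (e.symm x))) := hR _
    have ht : HasType γ (R (e (e.symm x))).ρ j d := by
      have := hT (e (e.symm x))
      rw [Equiv.apply_symm_apply] at this ⊢
      exact this
    exact iso_of_type hp γ hγ hj (Nat.pos_of_mem_divisors hd) W _ hWt ht
end

section
/- For any prime p and n ≥ 1, the group Hol(C_{p^n}) has, up to equivalence, exactly one faithful irreducible complex representation, and its degree is φ(p^n) = p^{n-1}(p−1); moreover this representation is induced from a faithful 1-dimensional representation of the normal subgroup C_{p^n}. -/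
open CategoryTheory
open scoped Classical

/-- The induced representation, on functions on the automorphism group. -/
noncomputable def indRep (m : ℕ) (θ : Cyc m →* ℂˣ) :
    Representation ℂ (Hol m) (MulAut (Cyc m) → ℂ) where
  toFun g :=
    { toFun := fun f u => (θ (u g.left) : ℂ) * f (u * g.right)
      map_add' := fun f f' => by ext u; simp [mul_add]
      map_smul' := fun c f => by ext u; simp; ring }
  map_one' := by ext; simp
  map_mul' g h := by
    refine LinearMap.ext fun f => funext fun u => ?_
    simp [mul_assoc]

theorem indRep_apply (m : ℕ) (θ : Cyc m →* ℂˣ) (g : Hol m) (f : MulAut (Cyc m) → ℂ)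
    (u : MulAut (Cyc m)) :
    indRep m θ g f u = (θ (u g.left) : ℂ) * f (u * g.right) := rfl

theorem indRep_injective (m : ℕ) (θ : Cyc m →* ℂˣ) (hθ : Function.Injective θ) :
    Function.Injective (indRep m θ) := by
  rw [injective_iff_map_eq_one]
  intro g hg
  have h (f : MulAut (Cyc m) → ℂ) (u : MulAut (Cyc m)) : (θ (u g.left) : ℂ) * f (u * g.right) = f u := by
    rw [← indRep_apply, hg]; rfl
  have h1 : g.left = 1 := by
    have := h (fun _ => 1) 1
    simp only [MulAut.one_apply, mul_one, Units.val_eq_one] at this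
    exact hθ (by simpa using this)
  have h2 : g.right = 1 := by
    have := h (Pi.single 1 1) 1
    by_contra hne
    simp [h1, Pi.single_apply, hne] at this
  exact SemidirectProduct.ext h1 h2

theorem indRep_single (m : ℕ) (θ : Cyc m →* ℂˣ) (u : MulAut (Cyc m)) :
    indRep m θ (SemidirectProduct.inr u⁻¹) (Pi.single 1 1) = Pi.single u 1 := by
  ext v
  simp [indRep_apply, Pi.single_apply, mul_inv_eq_one]

instance (m : ℕ) [NeZero m] : Finite (MulAut (Cyc m)) :=
  Finite.of_injective (fun u => (u : Cyc m → Cyc m)) DFunLike.coe_injective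

noncomputable instance (m : ℕ) [NeZero m] : Fintype (MulAut (Cyc m)) := Fintype.ofFinite _

instance (m : ℕ) [NeZero m] : Finite (Hol m) :=
  Finite.of_equiv _ SemidirectProduct.equivProd.symm

theorem indRep_trace (m : ℕ) [NeZero m] (θ : Cyc m →* ℂˣ) (g : Hol m) :
    LinearMap.trace ℂ _ (indRep m θ g) =
      if g.right = 1 then ∑ᶠ u : MulAut (Cyc m), (θ (u g.left) : ℂ) else 0 := by
  rw [LinearMap.trace_eq_matrix_trace ℂ (Pi.basisFun ℂ _), finsum_eq_sum_of_fintype,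
    Matrix.trace]
  simp only [Matrix.diag, LinearMap.toMatrix_apply, Pi.basisFun_apply, Pi.basisFun_repr,
    indRep_apply, Pi.single_apply, mul_eq_left]
  split_ifs <;> simp

/-- Morphisms of `FDRep` from intertwining linear maps. -/
noncomputable def homMk' {G : Type} [Group G] {V W : FDRep ℂ G} (f : V →ₗ[ℂ] W)
    (hf : ∀ g v, f (V.ρ g v) = W.ρ g (f v)) : V ⟶ W :=
  ⟨InducedCategory.homMk (ModuleCat.ofHom f), fun g ↦ by
    ext v
    exact hf g v⟩

theorem hom_ext' {G : Type} [Group G] {V W : FDRep ℂ G} (f g : V ⟶ W)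
    (h : ∀ v, f.hom.hom.hom v = g.hom.hom.hom v) : f = g := by
  ext v
  exact h v

theorem hom_comm' {G : Type} [Group G] {V W : FDRep ℂ G} (f : V ⟶ W) (g : G) (v : V) :
    f.hom.hom.hom (V.ρ g v) = W.ρ g (f.hom.hom.hom v) :=
  ConcreteCategory.congr_hom ((forget (FGModuleCat ℂ)).congr_map (f.comm g)) v

theorem end_scalar (m : ℕ) [NeZero m] (θ : Cyc m →* ℂˣ) (hθ : Function.Injective θ)
    (T : (MulAut (Cyc m) → ℂ) →ₗ[ℂ] (MulAut (Cyc m) → ℂ))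
    (hT : ∀ g v, T (indRep m θ g v) = indRep m θ g (T v)) :
    ∃ c : ℂ, T = c • LinearMap.id := by
  have h1 : T (Pi.single 1 1) = T (Pi.single 1 1) 1 • Pi.single 1 1 := by
    ext u
    by_cases hu : u = 1
    · subst hu; simp
    · simp only [Pi.smul_apply, Pi.single_apply, hu, if_false, smul_zero]
      by_contra hne
      apply hu
      ext x
      have := congrFun (hT (SemidirectProduct.inl x) (Pi.single 1 1)) u
      have e : indRep m θ (SemidirectProduct.inl x) (Pi.single 1 1) =
          (θ x : ℂ) • Pi.single 1 1 := by
        ext v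
        by_cases hv : v = 1
        · subst hv; simp [indRep_apply]
        · simp [indRep_apply, Pi.single_apply, hv]
      rw [e, map_smul] at this
      simp only [indRep_apply, SemidirectProduct.left_inl, SemidirectProduct.right_inl, mul_one,
        Pi.smul_apply, smul_eq_mul, mul_eq_mul_right_iff, hne, or_false] at this
      have := hθ (Units.ext this)
      rw [← this]; rfl
  refine ⟨T (Pi.single 1 1) 1, (Pi.basisFun ℂ _).ext fun u => ?_⟩
  have key : T (Pi.single u 1) = T (Pi.single 1 1) 1 • Pi.single u 1 := by
    have hs : indRep m θ (SemidirectProduct.inr u⁻¹) (Pi.single 1 1) = Pi.single u 1 := by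
      convert indRep_single m θ u
    rw [← hs, hT]
    conv_lhs => rw [h1]
    rw [map_smul]
  rw [Pi.basisFun_apply, LinearMap.smul_apply, LinearMap.id_apply]
  convert key

theorem simple_ind (m : ℕ) [NeZero m] (θ : Cyc m →* ℂˣ) (hθ : Function.Injective θ) :
    Simple (FDRep.of (indRep m θ)) := by
  have : NeZero (Nat.card (Hol m) : ℂ) := ⟨Nat.cast_ne_zero.mpr Nat.card_pos.ne'⟩
  rw [FDRep.simple_iff_end_is_rank_one]
  refine (finrank_eq_one_iff_of_nonzero' (𝟙 _) ?_).mpr ?_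
  · intro h
    have h2 : ∀ v : MulAut (Cyc m) → ℂ, v = 0 := fun v =>
      congrArg (fun f : FDRep.of (indRep m θ) ⟶ FDRep.of (indRep m θ) => f.hom.hom.hom v) h
    have := congrFun (h2 1) 1
    simp at this
  · intro f
    obtain ⟨c, hc⟩ := end_scalar m θ hθ f.hom.hom.hom (fun g v => hom_comm' f g v)
    refine ⟨c, hom_ext' _ _ fun v => ?_⟩
    exact (LinearMap.congr_fun hc v).symm

/-- If `W` contains a `θ`-eigenvector then there is a nonzero intertwiner. -/
theorem iso_of_eigen (m : ℕ) [NeZero m] (θ : Cyc m →* ℂˣ) (hθ : Function.Injective θ)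
    (W : FDRep ℂ (Hol m)) [Simple W] (w : W) (hw : w ≠ 0)
    (h : ∀ c, W.ρ (SemidirectProduct.inl c) w = (θ c : ℂ) • w) :
    Nonempty (W ≅ FDRep.of (indRep m θ)) := by
  have := simple_ind m θ hθ
  let T : (MulAut (Cyc m) → ℂ) →ₗ[ℂ] W :=
    ∑ u, (LinearMap.proj u : (MulAut (Cyc m) → ℂ) →ₗ[ℂ] ℂ).smulRight
      (W.ρ (SemidirectProduct.inr u⁻¹) w)
  have hTa (v) : T v = ∑ u, v u • W.ρ (SemidirectProduct.inr u⁻¹) w := by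
    simp [T]
  let F : FDRep.of (indRep m θ) ⟶ W := homMk' T (by
    intro g v
    change T (indRep m θ g v) = _
    rw [hTa, hTa, map_sum]
    rw [← Equiv.sum_comp (Equiv.mulRight g.right) (fun u => W.ρ g _)]
    refine Finset.sum_congr rfl fun u _ => ?_
    have e : g * SemidirectProduct.inr (u * g.right)⁻¹ =
        SemidirectProduct.inr u⁻¹ * SemidirectProduct.inl (u g.left) := by
      apply SemidirectProduct.ext <;> simp
    rw [Equiv.coe_mulRight, map_smul, ← Module.End.mul_apply, ← map_mul, e, map_mul,
      Module.End.mul_apply, h, map_smul, smul_smul, indRep_apply, mul_comm])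
  have hF : F ≠ 0 := by
    intro h0
    have : T (Pi.single 1 1) = 0 :=
      congrArg (fun f : FDRep.of (indRep m θ) ⟶ W =>
        f.hom.hom.hom (Pi.single 1 1 : MulAut (Cyc m) → ℂ)) h0
    rw [hTa, Finset.sum_eq_single 1] at this
    · simp [hw] at this
    · intro b _ hb; simp [Pi.single_apply, hb]
    · simp
  have := isIso_of_hom_simple hF
  exact ⟨(asIso F).symm⟩

theorem exists_eigen (p k : ℕ) (hp : p.Prime) (W : Type) [AddCommGroup W] [Module ℂ W]
    [FiniteDimensional ℂ W] (T : Module.End ℂ W) (h1 : T ^ (p ^ (k + 1)) = 1)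
    (h2 : T ^ (p ^ k) ≠ 1) :
    ∃ μ : ℂ, IsPrimitiveRoot μ (p ^ (k + 1)) ∧ ∃ w, w ≠ 0 ∧ T w = μ • w := by
  have : Fact p.Prime := ⟨hp⟩
  have : NeZero ((p ^ (k+1) : ℕ) : ℂ) := ⟨Nat.cast_ne_zero.mpr (pow_pos hp.pos _).ne'⟩
  have e := congrArg (Polynomial.aeval T) (Polynomial.cyclotomic_prime_pow_mul_X_pow_sub_one ℂ p k)
  simp only [map_mul, map_sub, map_pow, Polynomial.aeval_X, map_one, h1, sub_self] at e
  have hu : ¬ IsUnit (Polynomial.aeval T (Polynomial.cyclotomic (p ^ (k+1)) ℂ)) := by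
    intro hu
    exact h2 (sub_eq_zero.mp (hu.mul_right_eq_zero.mp e))
  rw [← spectrum.zero_mem_iff (R := ℂ), spectrum.map_polynomial_aeval_of_degree_pos _ _
    (Polynomial.degree_cyclotomic_pos _ _ (pow_pos hp.pos _))] at hu
  obtain ⟨μ, hμ, hr⟩ := hu
  refine ⟨μ, Polynomial.isRoot_cyclotomic_iff.mp hr, ?_⟩
  obtain ⟨w, hw⟩ := (Module.End.hasEigenvalue_iff_mem_spectrum.mpr hμ).exists_hasEigenvector
  exact ⟨w, hw.2, hw.apply_eq_smul⟩


theorem exists_theta_eigen (p k : ℕ) (hp : p.Prime) (θ : Cyc (p ^ (k + 1)) →* ℂˣ)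
    (hθ : Function.Injective θ)
    (W : FDRep ℂ (Hol (p ^ (k + 1)))) (hW : Function.Injective W.ρ) :
    ∃ w : W, w ≠ 0 ∧ ∀ c, W.ρ (SemidirectProduct.inl c) w = (θ c : ℂ) • w := by
  have : NeZero (p ^ (k + 1)) := ⟨(pow_pos hp.pos _).ne'⟩
  let a : Cyc (p ^ (k + 1)) := Multiplicative.ofAdd 1
  have ha : orderOf a = p ^ (k + 1) := by
    rw [orderOf_ofAdd_eq_addOrderOf, ZMod.addOrderOf_one]
  have hpow (j : ℕ) : W.ρ (SemidirectProduct.inl a) ^ j = 1 ↔ p ^ (k + 1) ∣ j := by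
    refine Iff.trans ?_ (Iff.of_eq (congrArg (· ∣ j) ha))
    have e : W.ρ (SemidirectProduct.inl a) ^ j = W.ρ (SemidirectProduct.inl (a ^ j)) :=
      (map_pow (W.ρ.comp SemidirectProduct.inl) a j).symm
    rw [orderOf_dvd_iff_pow_eq_one, e]
    constructor
    · intro h
      exact SemidirectProduct.inl_injective ((hW (h.trans (map_one W.ρ).symm)).trans
        (map_one SemidirectProduct.inl).symm)
    · intro h
      rw [h, map_one SemidirectProduct.inl, map_one W.ρ]
  obtain ⟨μ, hμ, w, hw, hwμ⟩ := exists_eigen p k hp W (W.ρ (SemidirectProduct.inl a))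
    ((hpow _).mpr dvd_rfl) (by
      rw [Ne, hpow, Nat.pow_dvd_pow_iff_le_right hp.one_lt]; omega)
  have hζ : IsPrimitiveRoot (θ a : ℂ) (p ^ (k + 1)) := by
    rw [IsPrimitiveRoot.coe_units_iff]
    have := IsPrimitiveRoot.orderOf (θ a)
    rwa [orderOf_injective θ hθ, ha] at this
  obtain ⟨i, -, hi, hiμ⟩ := (hμ.isPrimitiveRoot_iff).mp hζ
  let r : (ZMod (p ^ (k + 1)))ˣ := ZMod.unitOfCoprime i hi
  let u : MulAut (Cyc (p ^ (k + 1))) := AddEquiv.toMultiplicative (AddAut.mulRight r)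
  have hu : u a = a ^ i := by
    change Multiplicative.ofAdd ((1 : ZMod (p ^ (k + 1))) * (r : ZMod (p ^ (k + 1)))) = _
    rw [← ofAdd_nsmul]; simp [r]
  refine ⟨W.ρ (SemidirectProduct.inr u⁻¹) w, ?_, ?_⟩
  · intro h0
    apply hw
    have := congrArg (W.ρ (SemidirectProduct.inr u)) h0
    rw [map_zero, ← Module.End.mul_apply, ← map_mul, ← map_mul] at this
    simpa using this
  · have hpw (j : ℕ) : W.ρ (SemidirectProduct.inl (a ^ j)) w = μ ^ j • w := by
      induction j with
      | zero => simp
      | succ j ih =>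
        rw [pow_succ a, map_mul, map_mul, Module.End.mul_apply, hwμ, map_smul, ih, smul_smul,
          pow_succ μ, mul_comm]
    intro c
    obtain ⟨j, rfl⟩ : ∃ j : ℕ, a ^ j = c := by
      refine ⟨(Multiplicative.toAdd c).val, ?_⟩
      rw [← ofAdd_nsmul]; simp
    have e : (SemidirectProduct.inl (a ^ j) : Hol (p ^ (k + 1))) * SemidirectProduct.inr u⁻¹ =
        SemidirectProduct.inr u⁻¹ * SemidirectProduct.inl (a ^ (i * j)) := by
      apply SemidirectProduct.ext
      · have : u⁻¹ (a ^ (i * j)) = a ^ j := by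
          rw [pow_mul, ← hu, ← map_pow]; simp
        rw [SemidirectProduct.mul_left, SemidirectProduct.mul_left]
        simp only [SemidirectProduct.left_inl, SemidirectProduct.left_inr,
          SemidirectProduct.right_inr, map_one, mul_one, one_mul]
        exact this.symm
      · rw [SemidirectProduct.mul_right, SemidirectProduct.mul_right]
        simp only [SemidirectProduct.right_inl, SemidirectProduct.right_inr, mul_one, one_mul]
    rw [← Module.End.mul_apply, ← map_mul, e, map_mul, Module.End.mul_apply, hpw, map_smul,
      pow_mul, hiμ]
    simp

theorem stmt17 (p n : ℕ) (hp : p.Prime) (hn : 1 ≤ n) :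
    ∃ V : FDRep ℂ (Hol (p ^ n)), Simple V ∧ Function.Injective V.ρ ∧
      (∀ W : FDRep ℂ (Hol (p ^ n)), Simple W → Function.Injective W.ρ →
        Nonempty (W ≅ V)) ∧
      Module.finrank ℂ V = Nat.totient (p ^ n) ∧
      ∃ θ : Cyc (p ^ n) →* ℂˣ, Function.Injective θ ∧
        ∀ g : Hol (p ^ n), V.character g =
          if g.right = 1 then ∑ᶠ u : MulAut (Cyc (p ^ n)), (θ (u g.left) : ℂ)
          else 0 := by
  obtain ⟨k, rfl⟩ : ∃ k, n = k + 1 := ⟨n - 1, by omega⟩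
  have : NeZero (p ^ (k + 1)) := ⟨(pow_pos hp.pos _).ne'⟩
  let θ : Cyc (p ^ (k + 1)) →* ℂˣ :=
    (ZMod.stdAddChar (N := p ^ (k + 1))).toMonoidHom.toHomUnits
  have hθ : Function.Injective θ := by
    intro x y hxy
    have := congrArg (fun z : ℂˣ => (z : ℂ)) hxy
    exact Multiplicative.toAdd.injective (ZMod.injective_stdAddChar this)
  refine ⟨FDRep.of (indRep _ θ), simple_ind _ θ hθ, indRep_injective _ θ hθ, ?_, ?_, θ, hθ, ?_⟩
  · intro W hs hW
    obtain ⟨w, hw, h⟩ := exists_theta_eigen p k hp θ hθ W hW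
    exact iso_of_eigen _ θ hθ W w hw h
  · change Module.finrank ℂ (MulAut (Cyc (p ^ (k + 1))) → ℂ) = _
    rw [Module.finrank_fintype_fun_eq_card, ← Nat.card_eq_fintype_card, IsCyclic.card_mulAut]
    simp
  · intro g
    refine (indRep_trace _ θ g).trans ?_
    congr
end
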